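/- arXiv:1603.04180 — 2 statements merged into one kernel-verified Lean document; each statement's English description precedes it below -/
import Mathlib

section
/- For all integers k ≥ 3 and 1 ≤ ℓ < k/2 there exist C and γ₀ such that for all α > 0 and γ ∈ (0,γ₀) there exist β > 0 and ε > 0 such that the following holds for all sufficiently large t: if R is a k-uniform hypergraph on t vertices that is not β-fractionally (ℓ,Cγ)-extremal and deg(K) ≥ ((4(k−ℓ)−1)/(4(k−ℓ)²) − γ)·C(t,2) holds for all but at most ε·C(t,k−2) of the (k−2)-element subsets K of V(R), then there exists a β-hom(C_ℓ)-tiling h of R with weight w(h) at least (1−α)t. -/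
open Finset
open scoped Classical

/-- The first edge `{1,…,k}` of the cherry `C_ℓ` on the vertex set `[2k-2ℓ]`. -/
def cherryEdge1 (k l : ℕ) : Finset (Fin (2 * k - 2 * l)) :=
  Finset.univ.filter fun i => (i : ℕ) < k

/-- The second edge `{k-2ℓ+1,…,2k-2ℓ}` of the cherry `C_ℓ`. -/
def cherryEdge2 (k l : ℕ) : Finset (Fin (2 * k - 2 * l)) :=
  Finset.univ.filter fun i => k - 2 * l ≤ (i : ℕ)

/-- `φ` is a hypergraph homomorphism from the cherry `C_ℓ` to the hypergraph `ER`. -/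
def IsCherryHom (k l : ℕ) {t : ℕ} (ER : Finset (Finset (Fin t)))
    (φ : Fin (2 * k - 2 * l) → Fin t) : Prop :=
  (cherryEdge1 k l).image φ ∈ ER ∧ (cherryEdge2 k l).image φ ∈ ER

/-- The weight `w_h(v)` of the vertex `v` under the weight function `h`. -/
def weightAt (k l : ℕ) {t : ℕ} (h : (Fin (2 * k - 2 * l) → Fin t) → ℝ) (v : Fin t) : ℝ :=
  ∑ φ : Fin (2 * k - 2 * l) → Fin t,
    ((Finset.univ.filter fun u => φ u = v).card : ℝ) * h φ

/-- `h` is a `β`-hom(`C_ℓ`)-tiling of the hypergraph `ER`. -/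
def IsHomTiling (k l : ℕ) {t : ℕ} (β : ℝ) (ER : Finset (Finset (Fin t)))
    (h : (Fin (2 * k - 2 * l) → Fin t) → ℝ) : Prop :=
  (∀ φ, h φ ≠ 0 → IsCherryHom k l ER φ ∧ ∃ a : ℕ, 0 < a ∧ h φ = (a : ℝ) * β) ∧
  ∀ v, weightAt k l h v ≤ 1

/-- The total weight of a tiling. -/
def tilingWeight (k l : ℕ) {t : ℕ} (h : (Fin (2 * k - 2 * l) → Fin t) → ℝ) : ℝ :=
  ∑ v, weightAt k l h v

/-- `ER` is `β`-fractionally `(ℓ,ξ)`-extremal: there is a weight function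
`b : V(R) → {0} ∪ [β,1]` with `∑ b(v) ≥ (2(k-ℓ)-1)t/(2(k-ℓ))` and
`∑_{e∈E} ∏_{v∈e} b(v) ≤ ξ·C(t,k)`. -/
def FracExtremal (k l : ℕ) {t : ℕ} (β ξ : ℝ) (ER : Finset (Finset (Fin t))) : Prop :=
  ∃ b : Fin t → ℝ, (∀ v, b v = 0 ∨ (β ≤ b v ∧ b v ≤ 1)) ∧
    (2 * ((k : ℝ) - l) - 1) / (2 * ((k : ℝ) - l)) * t ≤ ∑ v, b v ∧
    ∑ e ∈ ER, ∏ v ∈ e, b v ≤ ξ * (Nat.choose t k)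

theorem exists_sparse_packing_or_cover {ι V : Type} [Finite ι] [Fintype V]
    (z : ι → V → ℝ) (M : ℝ) :
    (∃ (κ : Type) (_ : Fintype κ) (g : κ → ι) (w : κ → ℝ),
      Fintype.card κ ≤ Fintype.card V + 1 ∧ (∀ i, 0 ≤ w i) ∧ ∑ i, w i = 1 ∧
      ∀ v, ∑ i, w i * z (g i) v ≤ M) ∨
    (∃ c : V → ℝ, (∀ v, 0 ≤ c v) ∧ ∀ i, M * ∑ v, c v < ∑ v, c v * z i v) := by
  by_cases hne : ∃ y ∈ convexHull ℝ (Set.range z), ∀ v, y v ≤ M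
  · left
    obtain ⟨y, hy, hyM⟩ := hne
    obtain ⟨κ, hκ, x, w, hx, haff, hw, hw1, hwy⟩ := eq_pos_convex_span_of_mem_convexHull hy
    choose g hg using fun i => hx (Set.mem_range_self i)
    refine ⟨κ, hκ, g, w, ?_, fun i => (hw i).le, hw1, fun v => ?_⟩
    · have h1 := haff.card_le_finrank_succ
      have h2 := Submodule.finrank_le (vectorSpan ℝ (Set.range x))
      rw [Module.finrank_fintype_fun_eq_card] at h2
      omega
    · have h1 := congrFun hwy v
      simp only [Finset.sum_apply, Pi.smul_apply, smul_eq_mul] at h1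
      simp only [hg, h1, hyM]
  · right
    have hdisj : Disjoint {y : V → ℝ | ∀ v, y v ≤ M} (convexHull ℝ (Set.range z)) := by
      rw [Set.disjoint_left]
      intro y hy hy'
      exact hne ⟨y, hy', hy⟩
    have hconv : Convex ℝ {y : V → ℝ | ∀ v, y v ≤ M} := by
      have : {y : V → ℝ | ∀ v, y v ≤ M} = Set.Iic (fun _ => M) := by
        ext y; simp [Pi.le_def]
      rw [this]; exact convex_Iic _
    have hclosed : IsClosed {y : V → ℝ | ∀ v, y v ≤ M} := by
      have : {y : V → ℝ | ∀ v, y v ≤ M} = Set.Iic (fun _ => M) := by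
        ext y; simp [Pi.le_def]
      rw [this]; exact isClosed_Iic
    obtain ⟨F, u, u', hF1, huu, hF2⟩ := geometric_hahn_banach_closed_compact hconv hclosed
      (convex_convexHull ℝ _) ((Set.finite_range z).isCompact_convexHull (𝕜 := ℝ)) hdisj
    have hFsum : ∀ y : V → ℝ, F y = ∑ v, F (Pi.single v 1) * y v := by
      intro y
      conv_lhs => rw [pi_eq_sum_univ' y]
      simp only [map_sum, map_smul, smul_eq_mul, mul_comm]
    refine ⟨fun v => F (Pi.single v 1), fun v => ?_, fun i => ?_⟩
    · by_contra! hneg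
      set d := F (Pi.single v 1) with hd
      have key : ∀ x : ℝ, 0 ≤ x → F (fun _ => M) - x * d < u := by
        intro x hx
        have h1 := hF1 ((fun _ => M) - x • Pi.single v 1) (by
          intro w
          by_cases hw : w = v
          · subst hw; simp [hx]
          · simp [hw])
        simpa using h1
      have h0 := key 0 le_rfl
      have h1 := key ((u - F (fun _ => M)) / (-d)) (div_nonneg (by linarith) (by linarith))
      have h2 : (u - F (fun _ => M)) / (-d) * d = -(u - F (fun _ => M)) := by
        rw [div_neg, neg_mul, div_mul_cancel₀ _ hneg.ne]
      rw [h2] at h1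
      linarith
    · have h1 := hF1 (fun _ => M) (fun _ => le_rfl)
      have h2 := hF2 (z i) (subset_convexHull ℝ _ (Set.mem_range_self i))
      rw [hFsum] at h1 h2
      rw [← Finset.sum_mul] at h1
      linarith

theorem exists_cherryHom_onto_edge (k l : ℕ) (hk : 3 ≤ k) (hl1 : 1 ≤ l) (hl2 : 2 * l < k)
    {t : ℕ} (ER : Finset (Finset (Fin t))) (K : Finset (Fin t)) (x y : Fin t)
    (hK : K.card = k - 2) (hE : insert x (insert y K) ∈ ER) :
    ∃ φ : Fin (2 * k - 2 * l) → Fin t, IsCherryHom k l ER φ ∧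
      ∃ i j, i ≠ j ∧ φ i = x ∧ φ j = y ∧ ∀ p, p ≠ i → p ≠ j → φ p ∈ K := by
  obtain ⟨g, hgK, hgx, hgy, hgs⟩ : ∃ g : ℕ → Fin t, (∀ i < k - 2, g i ∈ K) ∧
      g (k - 2) = x ∧ g (k - 1) = y ∧ ∀ v ∈ K, ∃ i < k - 2, g i = v := by
    refine ⟨fun i => if h : i < k - 2 then (K.orderEmbOfFin hK ⟨i, h⟩) else
      if i = k - 2 then x else y, ?_, ?_, ?_, ?_⟩
    · intro i hi
      simp [hi]
    · simp
    · simp [show ¬ (k - 1 < k - 2) by omega, show k - 1 ≠ k - 2 by omega]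
    · intro v hv
      have : v ∈ Set.range (K.orderEmbOfFin hK) := by simpa using hv
      obtain ⟨⟨i, hi⟩, hiv⟩ := this
      exact ⟨i, hi, by simp [hi, hiv]⟩
  have hmem : ∀ i < k, g i ∈ insert x (insert y K) := by
    intro i hi
    rcases lt_trichotomy i (k - 2) with h | h | h
    · simp [hgK i h]
    · simp [h, hgx]
    · rw [show i = k - 1 by omega, hgy]; simp
  have hsurj : ∀ v ∈ insert x (insert y K), ∃ i < k, g i = v := by
    intro v hv
    simp only [Finset.mem_insert] at hv
    rcases hv with rfl | rfl | hv
    · exact ⟨k - 2, by omega, hgx⟩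
    · exact ⟨k - 1, by omega, hgy⟩
    · obtain ⟨i, hi, h⟩ := hgs v hv
      exact ⟨i, by omega, h⟩
  have h1 : (cherryEdge1 k l).image
      (fun i : Fin (2 * k - 2 * l) => if (i : ℕ) < k then g i else g (i - k)) = insert x (insert y K) := by
    ext v
    simp only [cherryEdge1, Finset.mem_image, Finset.mem_filter, Finset.mem_univ, true_and]
    constructor
    · rintro ⟨i, hi, rfl⟩
      simpa [hi] using hmem i hi
    · intro hv
      obtain ⟨i, hi, rfl⟩ := hsurj v hv
      exact ⟨⟨i, by omega⟩, hi, by simp [hi]⟩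
  have h2 : (cherryEdge2 k l).image
      (fun i : Fin (2 * k - 2 * l) => if (i : ℕ) < k then g i else g (i - k)) = insert x (insert y K) := by
    ext v
    simp only [cherryEdge2, Finset.mem_image, Finset.mem_filter, Finset.mem_univ, true_and]
    constructor
    · rintro ⟨i, hi, rfl⟩
      split_ifs with h
      · exact hmem i h
      · exact hmem _ (by omega)
    · intro hv
      obtain ⟨i, hi, rfl⟩ := hsurj v hv
      by_cases h : k - 2 * l ≤ i
      · exact ⟨⟨i, by omega⟩, h, by simp [hi]⟩
      · exact ⟨⟨i + k, by omega⟩, by simp; omega, by simp⟩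
  refine ⟨fun i : Fin (2 * k - 2 * l) => if (i : ℕ) < k then g i else g (i - k), ⟨h1.symm ▸ hE, h2.symm ▸ hE⟩,
    ⟨k - 2, by omega⟩, ⟨k - 1, by omega⟩, ?_, ?_, ?_, ?_⟩
  · simp; omega
  · simp [show k - 2 < k by omega, hgx]
  · simp [show k - 1 < k by omega, hgy]
  · intro p hp1 hp2
    rw [Ne, Fin.ext_iff] at hp1 hp2
    simp only at hp1 hp2
    dsimp only
    split_ifs with h
    · exact hgK _ (by omega)
    · exact hgK _ (by omega)

theorem card_pairs_add_ge_one_le {t : ℕ} (f : Fin t → ℝ) {s : ℝ} (hs : s ≤ 1 / 2) :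
    ((Finset.univ.filter fun p : Fin t × Fin t => 1 ≤ f p.1 + f p.2).card : ℝ) ≤
      (t : ℝ) ^ 2 - ((t - ((Finset.univ.filter fun v => 1 - s ≤ f v).card : ℝ)) ^ 2 -
        (((Finset.univ.filter fun v => s ≤ f v).card : ℝ) -
          ((Finset.univ.filter fun v => 1 - s ≤ f v).card : ℝ)) ^ 2) := by
  set A := Finset.univ.filter fun v => 1 - s ≤ f v with hA
  set P := Finset.univ.filter fun v => s ≤ f v with hP
  set T := Finset.univ.filter fun p : Fin t × Fin t => 1 ≤ f p.1 + f p.2 with hT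
  have hAP : A ⊆ P := by
    intro v hv
    simp only [hA, hP, Finset.mem_filter, Finset.mem_univ, true_and] at hv ⊢
    linarith
  have hsub : (P \ A) ×ˢ (P \ A) ⊆ Aᶜ ×ˢ Aᶜ :=
    Finset.product_subset_product (fun v hv => by simp_all) (fun v hv => by simp_all)
  have hT' : T ⊆ ((Aᶜ ×ˢ Aᶜ) \ ((P \ A) ×ˢ (P \ A)))ᶜ := by
    intro p hp
    rw [Finset.mem_compl]
    intro h
    simp only [hT, hA, hP, Finset.mem_filter, Finset.mem_univ, true_and, Finset.mem_compl,
      Finset.mem_sdiff, Finset.mem_product, not_le] at hp h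
    obtain ⟨⟨h1, h2⟩, h3⟩ := h
    exact h3 ⟨⟨by linarith, h1⟩, ⟨by linarith, h2⟩⟩
  have hc := Finset.card_le_card hT'
  have hc1 := Finset.card_add_card_compl ((Aᶜ ×ˢ Aᶜ) \ ((P \ A) ×ˢ (P \ A)))
  have hc2 := Finset.card_sdiff_add_card_eq_card hsub
  have hc3 := Finset.card_add_card_compl A
  have hc4 := Finset.card_sdiff_add_card_eq_card hAP
  simp only [Finset.card_product, Fintype.card_prod, Fintype.card_fin] at hc1 hc2 hc3
  have hd : (T.card : ℝ) ≤ _ := Nat.cast_le.2 hc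
  have hd1 := congrArg (Nat.cast (R := ℝ)) hc1
  have hd2 := congrArg (Nat.cast (R := ℝ)) hc2
  have hd3 := congrArg (Nat.cast (R := ℝ)) hc3
  have hd4 := congrArg (Nat.cast (R := ℝ)) hc4
  push_cast at hd1 hd2 hd3 hd4
  have e1 : (t : ℝ) - A.card = Aᶜ.card := by linarith
  have e2 : (P.card : ℝ) - A.card = (P \ A).card := by linarith
  rw [e1, e2]
  nlinarith

theorem sum_card_level_sets_le {t : ℕ} (f : Fin t → ℝ) (hf : ∀ v, 0 ≤ f v) (n : ℕ) :
    ∑ j ∈ Finset.range n,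
      ((Finset.univ.filter fun v => ((j : ℝ) + 1) / (n + 1) ≤ f v).card : ℝ) ≤
      (n + 1) * ∑ v, f v := by
  have h1 : ∀ v, ∑ j ∈ Finset.range n, (if ((j : ℝ) + 1) / (n + 1) ≤ f v then (1 : ℝ) else 0) ≤
      (n + 1) * f v := by
    intro v
    have hx : 0 ≤ (n + 1) * f v := mul_nonneg (by positivity) (hf v)
    rw [Finset.sum_boole]
    have : (Finset.range n).filter (fun j : ℕ => ((j : ℝ) + 1) / (n + 1) ≤ f v) ⊆
        Finset.range ⌊(n + 1) * f v⌋₊ := by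
      intro j hj
      simp only [Finset.mem_filter, Finset.mem_range] at hj ⊢
      have h2 := hj.2
      rw [div_le_iff₀ (by positivity)] at h2
      apply Nat.le_floor
      push_cast
      linarith
    have h3 := Finset.card_le_card this
    rw [Finset.card_range] at h3
    exact (Nat.cast_le.2 h3).trans (Nat.floor_le hx)
  calc _ = ∑ j ∈ Finset.range n, ∑ v, (if ((j : ℝ) + 1) / (n + 1) ≤ f v then (1 : ℝ) else 0) := by
        simp only [Finset.sum_boole]
    _ = ∑ v, ∑ j ∈ Finset.range n, (if ((j : ℝ) + 1) / (n + 1) ≤ f v then (1 : ℝ) else 0) :=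
        Finset.sum_comm
    _ ≤ ∑ v, (n + 1) * f v := Finset.sum_le_sum fun v _ => h1 v
    _ = _ := by rw [Finset.mul_sum]

theorem sub_le_avg_of_le_quadratic {a p μ g : ℝ} (ha : 0 ≤ a) (hap : a ≤ p) (hμ : μ ≤ 1 / 4)
    (hg : 0 < g) (h : 2 * μ - μ ^ 2 - g ≤ 1 - ((1 - a) ^ 2 - (p - a) ^ 2)) :
    2 * (μ - g) ≤ a + p := by
  by_contra! hlt
  obtain ⟨u, rfl⟩ : ∃ u, p = 2 * u - a := ⟨(a + p) / 2, by ring⟩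
  have hu : u < μ - g := by linarith
  have hau : a ≤ u := by linarith
  have h1 : 0 ≤ (u - a) * (2 - 5 * u + 3 * a) := mul_nonneg (by linarith) (by linarith)
  have h2 : (μ - u) * (3 / 2) ≤ (μ - u) * (2 - μ - u) :=
    mul_le_mul_of_nonneg_left (by linarith) (by linarith)
  nlinarith

theorem le_of_le_quadratic_of_avg_le {a p μ g c : ℝ} (ha : 0 ≤ a) (hap : a ≤ p) (hμ0 : 0 ≤ μ)
    (hμ : μ ≤ 1 / 4) (hg : 0 < g) (hc : 0 ≤ c) (hcg : 20 * c * g ≤ 1)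
    (h : 2 * μ - μ ^ 2 - g ≤ 1 - ((1 - a) ^ 2 - (p - a) ^ 2)) (hu : a + p ≤ 2 * (μ + c * g)) :
    p ≤ μ + (5 * c + 2) * g := by
  obtain ⟨u, rfl⟩ : ∃ u, p = 2 * u - a := ⟨(a + p) / 2, by ring⟩
  have hu : u ≤ μ + c * g := by linarith
  have hau : a ≤ u := by linarith
  have hcg0 : 0 ≤ c * g := by positivity
  have h1 : (u - a) * (1 / 2) ≤ (u - a) * (2 - 5 * u + 3 * a) :=
    mul_le_mul_of_nonneg_left (by linarith) (by linarith)
  have h2 : 2 * u - u ^ 2 ≤ 2 * μ - μ ^ 2 + 2 * (c * g) := by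
    nlinarith [mul_nonneg (show (0 : ℝ) ≤ μ + c * g - u by linarith)
      (show (0 : ℝ) ≤ 2 - (μ + c * g) - u by linarith), mul_nonneg hcg0 hμ0, sq_nonneg (c * g)]
  nlinarith

theorem card_level_set_le {t m : ℕ} (hm : 4 ≤ m) (ht : 0 < t) (f : Fin t → ℝ)
    (hf : ∀ v, 0 ≤ f v) (hsum : ∑ v, f v ≤ (t : ℝ) / m) {g : ℝ} (hg : 0 < g)
    (hgm : 20 * m * g ≤ 1)
    (hT : ((2 * (m : ℝ) - 1) / (m : ℝ) ^ 2 - g) * (t : ℝ) ^ 2 ≤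
      ((Finset.univ.filter fun p : Fin t × Fin t => 1 ≤ f p.1 + f p.2).card : ℝ)) :
    ((Finset.univ.filter fun v => 1 / (m : ℝ) ≤ f v).card : ℝ) ≤
      (1 / (m : ℝ) + (5 * m + 2) * g) * t := by
  have hm4 : (4 : ℝ) ≤ m := by exact_mod_cast hm
  have hm0 : (0 : ℝ) < m := by linarith
  have ht0 : (0 : ℝ) < t := by exact_mod_cast ht
  set μ : ℝ := 1 / m with hμdef
  have hmμ : m * μ = 1 := by rw [hμdef]; field_simp
  have hμ0 : 0 < μ := by positivity
  have hμ : μ ≤ 1 / 4 := by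
    rw [hμdef]; exact one_div_le_one_div_of_le (by norm_num) hm4
  set p : ℝ → ℝ := fun s => ((Finset.univ.filter fun v => s ≤ f v).card : ℝ) / t with hp
  have hpt : ∀ s, ((Finset.univ.filter fun v => s ≤ f v).card : ℝ) = p s * t := by
    exact fun s => (div_mul_cancel₀ _ ht0.ne').symm
  have hp0 : ∀ s, 0 ≤ p s := fun s => div_nonneg (Nat.cast_nonneg _) ht0.le
  have hanti : ∀ s s', s ≤ s' → p s' ≤ p s := by
    intro s s' h
    apply div_le_div_of_nonneg_right _ ht0.le
    apply Nat.cast_le.2 (Finset.card_le_card _)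
    intro v hv
    simp only [Finset.mem_filter, Finset.mem_univ, true_and] at hv ⊢
    linarith
  have hquad : ∀ s ≤ 1 / 2,
      2 * μ - μ ^ 2 - g ≤ 1 - ((1 - p (1 - s)) ^ 2 - (p s - p (1 - s)) ^ 2) := by
    intro s hs
    have h1 := hT.trans (card_pairs_add_ge_one_le f hs)
    rw [hpt, hpt] at h1
    have h2 : (2 * (m : ℝ) - 1) / (m : ℝ) ^ 2 = 2 * μ - μ ^ 2 := by
      rw [hμdef]; field_simp
    rw [h2] at h1
    have h3 : (0 : ℝ) < t ^ 2 := by positivity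
    nlinarith
  rw [hpt]
  refine mul_le_mul_of_nonneg_right ?_ ht0.le
  by_contra! hcon
  obtain ⟨M, hM⟩ := exists_nat_ge (1 / g)
  have hMg : 1 ≤ M * g := by rwa [div_le_iff₀ hg] at hM
  have hM0 : 0 < M := by
    rcases Nat.eq_zero_or_pos M with h | h
    · subst h; norm_num at hMg
    · exact h
  obtain ⟨n, hn⟩ : ∃ n, n + 1 = m * M := ⟨m * M - 1, Nat.sub_add_cancel (Nat.mul_pos (by omega) hM0)⟩
  have hMn : M ≤ n := by nlinarith
  have hn' : (n : ℝ) + 1 = m * M := by exact_mod_cast hn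
  have hM0' : (0 : ℝ) < M := by exact_mod_cast hM0
  have hall : ∀ s, 2 * (μ - g) ≤ p s + p (1 - s) := by
    intro s
    rcases le_total s (1 / 2) with h | h
    · have := sub_le_avg_of_le_quadratic (hp0 _) (hanti s (1 - s) (by linarith)) hμ hg (hquad s h)
      linarith
    · have h2 := hquad (1 - s) (by linarith)
      rw [sub_sub_cancel] at h2
      exact sub_le_avg_of_le_quadratic (hp0 _) (hanti _ _ (by linarith)) hμ hg h2
  have hlow : ∀ s ≤ μ, 2 * (μ + m * g) ≤ p s + p (1 - s) := by
    intro s hs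
    by_contra! h
    have := le_of_le_quadratic_of_avg_le (hp0 _) (hanti s (1 - s) (by linarith)) hμ0.le hμ hg
      hm0.le hgm (hquad s (by linarith)) (by linarith)
    have := hanti s μ hs
    linarith
  have hup : ∑ j ∈ Finset.range n, p (((j : ℝ) + 1) / (n + 1)) ≤ M := by
    have h1 := sum_card_level_sets_le f hf n
    simp only [hpt] at h1
    rw [← Finset.sum_mul, hn'] at h1
    have h2 : m * M * ∑ v, f v ≤ M * t := by
      calc m * M * ∑ v, f v ≤ m * M * (t / m) := by gcongr
        _ = M * t := by field_simp
    rw [hn']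
    exact le_of_mul_le_mul_right (h1.trans h2) ht0
  have hrefl : ∑ j ∈ Finset.range n, p (1 - ((j : ℝ) + 1) / (n + 1)) =
      ∑ j ∈ Finset.range n, p (((j : ℝ) + 1) / (n + 1)) := by
    rw [← Finset.sum_range_reflect]
    refine Finset.sum_congr rfl fun j hj => ?_
    have hj' := Finset.mem_range.1 hj
    congr 1
    rw [Nat.sub_sub, Nat.cast_sub (by omega)]
    field_simp
    push_cast
    ring
  have hlower : ∑ j ∈ Finset.range n, (2 * (μ - g) + if j < M then 2 * (m + 1) * g else 0) ≤
      ∑ j ∈ Finset.range n, (p (((j : ℝ) + 1) / (n + 1)) + p (1 - ((j : ℝ) + 1) / (n + 1))) := by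
    refine Finset.sum_le_sum fun j _ => ?_
    split_ifs with h
    · have hjM : (j : ℝ) + 1 ≤ M := by exact_mod_cast h
      have := hlow (((j : ℝ) + 1) / (n + 1)) (by
        rw [hn', div_le_iff₀ (by positivity)]
        nlinarith)
      linarith
    · simpa using hall _
  have hif : ∑ j ∈ Finset.range n, (if j < M then 2 * ((m : ℝ) + 1) * g else 0) =
      M * (2 * (m + 1) * g) := by
    rw [← Finset.sum_filter, Finset.sum_const, nsmul_eq_mul]
    congr 2
    rw [show (Finset.range n).filter (fun j => j < M) = Finset.range M by
      ext j; simp; omega, Finset.card_range]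
  rw [Finset.sum_add_distrib, Finset.sum_add_distrib, hif, hrefl, Finset.sum_const,
    Finset.card_range, nsmul_eq_mul] at hlower
  have hnr : (n : ℝ) * (2 * (μ - g)) = (m * M - 1) * (2 * (μ - g)) := by
    rw [← hn']; ring
  rw [hnr] at hlower
  have hmMμ : m * M * μ = M := by rw [mul_right_comm, hmμ, one_mul]
  nlinarith

theorem exists_homTiling_or_cover {k l : ℕ} (hl : 2 * l < k) {t : ℕ} (ht : 0 < t)
    (ER : Finset (Finset (Fin t))) {α β : ℝ} (hα0 : 0 < α) (hα1 : α < 1) (hβ : 0 < β)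
    (hβα : 4 * ((2 * k - 2 * l : ℕ) : ℝ) * β ≤ α) :
    (∃ h : (Fin (2 * k - 2 * l) → Fin t) → ℝ,
      IsHomTiling k l β ER h ∧ (1 - α) * t ≤ tilingWeight k l h) ∨
    ∃ c : Fin t → ℝ, (∀ v, 0 ≤ c v) ∧
      ∑ v, c v ≤ (1 - α / 2) * t / ((2 * k - 2 * l : ℕ) : ℝ) ∧
      ∀ φ, IsCherryHom k l ER φ → 1 ≤ ∑ i, c (φ i) := by
  set m : ℕ := 2 * k - 2 * l with hm
  have hm0 : (0 : ℝ) < m := by exact_mod_cast (show 0 < m by omega)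
  have ht0 : (0 : ℝ) < t := by exact_mod_cast ht
  have ht1 : (1 : ℝ) ≤ t := by exact_mod_cast ht
  set M : ℝ := m / ((1 - α / 2) * t) with hM
  have hα2 : 0 < 1 - α / 2 := by linarith
  have hM0 : 0 < M := by positivity
  have hmM : m / M = (1 - α / 2) * t := by rw [hM]; field_simp
  have hsumz : ∀ (φ : Fin m → Fin t) (c : Fin t → ℝ),
      ∑ v, c v * ((Finset.univ.filter fun u => φ u = v).card : ℝ) = ∑ u, c (φ u) := by
    intro φ c
    rw [← Finset.sum_fiberwise (s := Finset.univ) (g := φ) (f := fun u => c (φ u))]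
    refine Finset.sum_congr rfl fun v _ => ?_
    rw [Finset.sum_congr rfl (g := fun _ => c v)]
    · rw [Finset.sum_const, nsmul_eq_mul, mul_comm]
    · intro u hu
      rw [(Finset.mem_filter.1 hu).2]
  rcases exists_sparse_packing_or_cover
    (fun (φ : {φ : Fin m → Fin t // IsCherryHom k l ER φ}) v =>
      ((Finset.univ.filter fun u => φ.1 u = v).card : ℝ)) M with
    ⟨κ, _, g, w, hκ, hw, hw1, hwM⟩ | ⟨c, hc0, hc⟩
  · left
    rw [Fintype.card_fin] at hκ
    set a : κ → ℕ := fun i => ⌊w i / (M * β)⌋₊ with ha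
    have ha1 : ∀ i, (a i : ℝ) * β ≤ w i / M := by
      intro i
      have := Nat.floor_le (div_nonneg (hw i) (by positivity : 0 ≤ M * β))
      calc (a i : ℝ) * β ≤ w i / (M * β) * β := by gcongr
        _ = w i / M := by field_simp
    have ha2 : ∀ i, w i / M - β ≤ (a i : ℝ) * β := by
      intro i
      have h1 := (Nat.lt_floor_add_one (w i / (M * β))).le
      have : w i / M = w i / (M * β) * β := by field_simp
      rw [this]
      nlinarith
    have hweight : ∀ v, weightAt k l
        (fun φ => ((∑ i ∈ Finset.univ.filter (fun i => (g i).1 = φ), a i : ℕ) : ℝ) * β) v =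
        ∑ i, (a i : ℝ) * β * ((Finset.univ.filter fun u => (g i).1 u = v).card : ℝ) := by
      intro v
      unfold weightAt
      rw [← Finset.sum_fiberwise (s := Finset.univ) (g := fun i => (g i).1)]
      refine Finset.sum_congr rfl fun φ _ => ?_
      push_cast
      rw [Finset.sum_mul, Finset.mul_sum]
      refine Finset.sum_congr rfl fun i hi => ?_
      rw [(Finset.mem_filter.1 hi).2]
      ring
    refine ⟨fun φ => ((∑ i ∈ Finset.univ.filter (fun i => (g i).1 = φ), a i : ℕ) : ℝ) * β,
      ⟨fun φ hφ => ?_, fun v => ?_⟩, ?_⟩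
    · have hne : ∑ i ∈ Finset.univ.filter (fun i => (g i).1 = φ), a i ≠ 0 := by
        intro h0
        apply hφ
        simp only [h0, Nat.cast_zero, zero_mul]
      obtain ⟨i, hi, -⟩ := Finset.exists_ne_zero_of_sum_ne_zero hne
      exact ⟨(Finset.mem_filter.1 hi).2 ▸ (g i).2, _, Nat.pos_of_ne_zero hne, rfl⟩
    · rw [hweight]
      calc _ ≤ ∑ i, w i / M * ((Finset.univ.filter fun u => (g i).1 u = v).card : ℝ) := by
            gcongr with i
            exact ha1 i
        _ = (∑ i, w i * ((Finset.univ.filter fun u => (g i).1 u = v).card : ℝ)) / M := by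
            rw [Finset.sum_div]
            exact Finset.sum_congr rfl fun i _ => by ring
        _ ≤ 1 := by
            rw [div_le_one hM0]
            exact hwM v
    · unfold tilingWeight
      simp only [hweight]
      rw [Finset.sum_comm]
      have h1 : ∀ i, ∑ v, (a i : ℝ) * β *
          ((Finset.univ.filter fun u => (g i).1 u = v).card : ℝ) = m * (a i * β) := by
        intro i
        rw [hsumz (g i).1 (fun _ => (a i : ℝ) * β)]
        simp
      simp only [h1]
      rw [← Finset.mul_sum]
      have h2 : ∑ i, (w i / M - β) ≤ ∑ i, (a i : ℝ) * β := Finset.sum_le_sum fun i _ => ha2 i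
      rw [Finset.sum_sub_distrib, ← Finset.sum_div, hw1, Finset.sum_const, Finset.card_univ,
        nsmul_eq_mul] at h2
      have hκ' : (Fintype.card κ : ℝ) ≤ t + 1 := by exact_mod_cast hκ
      have h3 : m * (1 / M) = (1 - α / 2) * t := by rw [← hmM]; ring
      have h4 : m * (1 / M - Fintype.card κ * β) ≤ m * ∑ i, (a i : ℝ) * β := by gcongr
      have h5 : (m : ℝ) * (Fintype.card κ * β) ≤ m * ((t + t) * β) := by
        gcongr
        linarith
      have h6 : 4 * (m : ℝ) * β * t ≤ α * t := by gcongr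
      nlinarith
  · right
    have hS : 0 ≤ ∑ v, c v := Finset.sum_nonneg fun v _ => hc0 v
    refine ⟨fun v => c v / (M * ∑ v, c v), fun v => ?_, ?_, fun φ hφ => ?_⟩
    · have := hc0 v
      positivity
    · rw [← Finset.sum_div]
      rcases hS.eq_or_lt with h | h
      · rw [← h]
        simp only [mul_zero, div_zero]
        exact div_nonneg (mul_nonneg hα2.le ht0.le) hm0.le
      · apply le_of_eq
        change _ = (1 - α / 2) * (t : ℝ) / (m : ℝ)
        rw [← hmM]
        field_simp
    · have h1 := hc ⟨φ, hφ⟩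
      simp only at h1
      rw [hsumz φ c] at h1
      rw [← Finset.sum_div]
      rcases hS.eq_or_lt with h | h
      · exfalso
        have h0 : ∀ v, c v = 0 := fun v =>
          (Finset.sum_eq_zero_iff_of_nonneg fun v _ => hc0 v).1 h.symm v (Finset.mem_univ v)
        simp [h0] at h1
      · rw [le_div_iff₀ (by positivity), one_mul]
        exact h1.le

theorem fracExtremal_of_card_le {k l : ℕ} (hl : 2 * l < k) {t : ℕ}
    (ER : Finset (Finset (Fin t))) (hER : ∀ e ∈ ER, e.card = k) (W : Finset (Fin t))
    (hW : ∀ e ∈ ER, ∃ v ∈ e, v ∈ W) {β θ D : ℝ} (hβθ : β ≤ θ)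
    (hθ0 : 0 ≤ θ) (hθ1 : θ ≤ 1) (hD : ((2 * k - 2 * l : ℕ) : ℝ) * D ≤ θ)
    (hcard : (W.card : ℝ) ≤ (1 / ((2 * k - 2 * l : ℕ) : ℝ) + D) * t) :
    FracExtremal k l β θ ER := by
  have hm : ((2 * k - 2 * l : ℕ) : ℝ) = 2 * ((k : ℝ) - l) := by
    rw [Nat.cast_sub (by omega)]; push_cast; ring
  have hm0 : (0 : ℝ) < ((2 * k - 2 * l : ℕ) : ℝ) := by exact_mod_cast (show 0 < _ by omega)
  rw [hm] at hD hcard hm0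
  set m : ℝ := 2 * ((k : ℝ) - l)
  refine ⟨fun v => if v ∈ W then θ else 1, fun v => ?_, ?_, ?_⟩
  · right
    dsimp only
    split_ifs
    · exact ⟨hβθ, hθ1⟩
    · exact ⟨hβθ.trans hθ1, le_rfl⟩
  · have h1 : ∑ v : Fin t, (if v ∈ W then θ else (1 : ℝ)) = t - (1 - θ) * W.card := by
      have : ∀ v : Fin t, (if v ∈ W then θ else (1 : ℝ)) = 1 - if v ∈ W then (1 - θ) else 0 := by
        intro v; split_ifs <;> ring
      simp only [this, Finset.sum_sub_distrib, Finset.sum_ite_mem, Finset.univ_inter,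
        Finset.sum_const, Finset.card_univ, Fintype.card_fin, nsmul_eq_mul]
      ring
    rw [h1, sub_div, div_self hm0.ne', sub_mul, one_mul]
    have ht0 : (0 : ℝ) ≤ t := Nat.cast_nonneg t
    have h2 : (1 - θ) * W.card ≤ 1 / m * t := by
      rcases le_total ((W.card : ℝ)) (1 / m * t) with h | h
      · have : (0 : ℝ) ≤ W.card := Nat.cast_nonneg _
        nlinarith
      · have h3 : D * t ≤ θ * (1 / m * t) := by
          have : D ≤ θ * (1 / m) := by
            rw [mul_one_div, le_div_iff₀ hm0]; linarith
          calc D * t ≤ θ * (1 / m) * t := by gcongr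
            _ = _ := by ring
        have h4 : θ * (1 / m * t) ≤ θ * W.card := by gcongr
        linarith
    linarith
  · have h1 : ∀ e ∈ ER, ∏ v ∈ e, (if v ∈ W then θ else (1 : ℝ)) ≤ θ := by
      intro e he
      obtain ⟨v, hve, hvW⟩ := hW e he
      rw [← Finset.mul_prod_erase e _ hve, if_pos hvW]
      refine mul_le_of_le_one_right hθ0 (Finset.prod_le_one (fun i _ => ?_) fun i _ => ?_)
      · split_ifs
        · exact hθ0
        · norm_num
      · split_ifs
        · exact hθ1
        · exact le_rfl
    have h2 : ER.card ≤ t.choose k := by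
      have : ER ⊆ (Finset.univ : Finset (Fin t)).powersetCard k := fun e he =>
        Finset.mem_powersetCard.2 ⟨Finset.subset_univ _, hER e he⟩
      simpa using Finset.card_le_card this
    calc _ ≤ ∑ e ∈ ER, θ := Finset.sum_le_sum h1
      _ = θ * ER.card := by rw [Finset.sum_const, nsmul_eq_mul, mul_comm]
      _ ≤ θ * (t.choose k : ℕ) := by gcongr

theorem two_mul_degree_le_card_pairs {k t : ℕ} (hk : 2 ≤ k) (ER : Finset (Finset (Fin t)))
    (hER : ∀ e ∈ ER, e.card = k) (K : Finset (Fin t)) (hK : K.card = k - 2)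
    (T : Finset (Fin t × Fin t))
    (hT : ∀ x y, insert x (insert y K) ∈ ER → (x, y) ∈ T) :
    2 * (ER.filter fun e => K ⊆ e).card ≤ T.card := by
  have hcard : ∀ e ∈ ER.filter (fun e => K ⊆ e), (e \ K).card = 2 := by
    intro e he
    obtain ⟨he, hKe⟩ := Finset.mem_filter.1 he
    rw [Finset.card_sdiff_of_subset hKe, hER e he, hK]
    omega
  have hun : ∀ e x y, K ⊆ e → (e \ K).card = 2 → (x, y) ∈ (e \ K).offDiag →
      insert x (insert y K) = e := by
    intro e x y hKe hc hxy
    rw [Finset.mem_offDiag] at hxy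
    obtain ⟨hx, hy, hne⟩ := hxy
    have : ({x, y} : Finset (Fin t)) = e \ K :=
      Finset.eq_of_subset_of_card_le (by simp [Finset.insert_subset_iff, hx, hy])
        (by rw [hc, Finset.card_pair hne])
    rw [← Finset.sdiff_union_of_subset hKe, ← this]
    simp [Finset.insert_union]
  have hdisj : Set.PairwiseDisjoint (SetLike.coe (ER.filter fun e => K ⊆ e))
      (fun e => (e \ K).offDiag) := by
    intro e he e' he' hne
    refine Finset.disjoint_left.2 fun ⟨x, y⟩ h h' => hne ?_
    rw [← hun e x y (Finset.mem_filter.1 he).2 (hcard e he) h,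
      hun e' x y (Finset.mem_filter.1 he').2 (hcard e' he') h']
  have hsub : (ER.filter fun e => K ⊆ e).biUnion (fun e => (e \ K).offDiag) ⊆ T := by
    intro ⟨x, y⟩ h
    obtain ⟨e, he, hxy⟩ := Finset.mem_biUnion.1 h
    apply hT
    rw [hun e x y (Finset.mem_filter.1 he).2 (hcard e he) hxy]
    exact (Finset.mem_filter.1 he).1
  have := Finset.card_le_card hsub
  rw [Finset.card_biUnion hdisj, Finset.sum_congr rfl (g := fun _ => 2)] at this
  · simpa [mul_comm] using this
  · intro e he
    rw [Finset.offDiag_card, hcard e he]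

theorem exists_lowest_subset {t r : ℕ} (hr : r ≤ t) (c : Fin t → ℝ) :
    ∃ L : Finset (Fin t), L.card = r ∧ ∀ x ∈ L, ∀ y ∉ L, c x ≤ c y := by
  refine ⟨(Finset.univ.filter fun i : Fin t => (i : ℕ) < r).map (Tuple.sort c).toEmbedding,
    ?_, ?_⟩
  · rw [Finset.card_map, Fin.card_filter_val_lt, min_eq_right hr]
  · intro x hx y hy
    obtain ⟨i, rfl⟩ := (Tuple.sort c).surjective x
    obtain ⟨j, rfl⟩ := (Tuple.sort c).surjective y
    simp at hx hy
    exact Tuple.monotone_sort c (show i ≤ j by rw [Fin.le_def]; omega)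

theorem lt_choose_floor {j t : ℕ} {η : ℝ} (hη : 0 < η) (hj : 2 * (j : ℝ) ≤ η * t) (ht : 0 < t) :
    (η / 2) ^ j / 2 * t.choose j < (⌊η * t⌋₊.choose j : ℝ) := by
  have ht0 : (0 : ℝ) < t := by exact_mod_cast ht
  have h1 := Nat.pow_le_choose (α := ℝ) j ⌊η * t⌋₊
  have h2 := Nat.choose_le_pow_div (α := ℝ) j t
  have h3 : η * t / 2 ≤ ((⌊η * t⌋₊ + 1 - j : ℕ) : ℝ) := by
    have h4 := (Nat.lt_floor_add_one (η * t)).le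
    have h5 : ((⌊η * t⌋₊ + 1 : ℕ) : ℝ) - j ≤ ((⌊η * t⌋₊ + 1 - j : ℕ) : ℝ) := by
      rw [sub_le_iff_le_add]
      exact_mod_cast (by omega : ⌊η * t⌋₊ + 1 ≤ ⌊η * t⌋₊ + 1 - j + j)
    push_cast at h5
    linarith
  have hpos : 0 < (η * t / 2) ^ j / (j.factorial : ℝ) := by positivity
  calc (η / 2) ^ j / 2 * t.choose j ≤ (η / 2) ^ j / 2 * (t ^ j / j.factorial) := by gcongr
    _ = (η * t / 2) ^ j / (j.factorial : ℝ) / 2 := by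
        rw [show η * t / 2 = η / 2 * t by ring, mul_pow]; ring
    _ < (η * t / 2) ^ j / (j.factorial : ℝ) := half_lt_self hpos
    _ ≤ ((⌊η * t⌋₊ + 1 - j : ℕ) : ℝ) ^ j / (j.factorial : ℝ) := by gcongr
    _ ≤ _ := by exact_mod_cast h1

theorem exists_good_subset_of_few_bad {t r j : ℕ} {ε : ℝ} (L : Finset (Fin t)) (hL : L.card = r)
    (P : Finset (Fin t) → Prop)
    (hbad : (((Finset.univ : Finset (Fin t)).powersetCard j).filter fun K => ¬ P K).card ≤
      ε * (t.choose j))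
    (hlt : ε * (t.choose j) < r.choose j) :
    ∃ K ⊆ L, K.card = j ∧ P K := by
  by_contra! hcon
  have hsub : L.powersetCard j ⊆
      ((Finset.univ : Finset (Fin t)).powersetCard j).filter fun K => ¬ P K := by
    intro K hK
    obtain ⟨hKL, hKj⟩ := Finset.mem_powersetCard.1 hK
    exact Finset.mem_filter.2 ⟨Finset.mem_powersetCard.2 ⟨Finset.subset_univ _, hKj⟩,
      hcon K hKL hKj⟩
  have h1 := Finset.card_le_card hsub
  rw [Finset.card_powersetCard, hL] at h1
  have h2 : (r.choose j : ℝ) ≤ _ := Nat.cast_le.2 h1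
  linarith

theorem exists_one_div_le_of_mem_edge {k l : ℕ} (hk : 3 ≤ k) (hl1 : 1 ≤ l) (hl2 : 2 * l < k)
    {t : ℕ} {ER : Finset (Finset (Fin t))} (hER : ∀ e ∈ ER, e.card = k) {c : Fin t → ℝ}
    (hc : ∀ φ, IsCherryHom k l ER φ → 1 ≤ ∑ i, c (φ i)) {e : Finset (Fin t)} (he : e ∈ ER) :
    ∃ v ∈ e, 1 / ((2 * k - 2 * l : ℕ) : ℝ) ≤ c v := by
  obtain ⟨K, hKe, hK⟩ := Finset.exists_subset_card_eq (show k - 2 ≤ e.card by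
    rw [hER e he]; omega)
  have h2 : (e \ K).card = 2 := by
    rw [Finset.card_sdiff_of_subset hKe, hER e he, hK]; omega
  obtain ⟨x, y, -, hxy⟩ := Finset.card_eq_two.1 h2
  have hins : insert x (insert y K) = e := by
    rw [← Finset.sdiff_union_of_subset hKe, hxy]
    simp [Finset.insert_union]
  obtain ⟨φ, hφ, i, j, -, hi, hj, hrest⟩ :=
    exists_cherryHom_onto_edge k l hk hl1 hl2 ER K x y hK (hins ▸ he)
  have hmem : ∀ p, φ p ∈ e := by
    intro p
    rw [← hins]
    by_cases h1 : p = i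
    · simp [h1, hi]
    by_cases h2 : p = j
    · simp [h2, hj]
    simp [hrest p h1 h2]
  by_contra! hcon
  have hm0 : (0 : ℝ) < ((2 * k - 2 * l : ℕ) : ℝ) := by exact_mod_cast (show 0 < _ by omega)
  have h3 : ∑ p, c (φ p) < ∑ _p : Fin (2 * k - 2 * l), 1 / ((2 * k - 2 * l : ℕ) : ℝ) :=
    Finset.sum_lt_sum_of_nonempty ⟨i, Finset.mem_univ i⟩ fun p _ => hcon _ (hmem p)
  rw [Finset.sum_const, Finset.card_univ, Fintype.card_fin, nsmul_eq_mul,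
    mul_one_div_cancel hm0.ne'] at h3
  linarith [hc φ hφ]

theorem one_le_of_insert_insert_mem {k l : ℕ} (hk : 3 ≤ k) (hl1 : 1 ≤ l) (hl2 : 2 * l < k)
    {t : ℕ} {ER : Finset (Finset (Fin t))} {c : Fin t → ℝ}
    (hc : ∀ φ, IsCherryHom k l ER φ → 1 ≤ ∑ i, c (φ i)) {K : Finset (Fin t)}
    (hK : K.card = k - 2) {c₀ : ℝ} (hKc : ∀ v ∈ K, c v ≤ c₀) {x y : Fin t}
    (he : insert x (insert y K) ∈ ER) :
    1 ≤ (((2 * k - 2 * l : ℕ) : ℝ) - 2) * c₀ + c x + c y := by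
  obtain ⟨φ, hφ, i, j, hij, rfl, rfl, hrest⟩ :=
    exists_cherryHom_onto_edge k l hk hl1 hl2 ER K x y hK he
  have h1 := hc φ hφ
  rw [← Finset.add_sum_erase _ _ (Finset.mem_univ i),
    ← Finset.add_sum_erase _ _ (Finset.mem_erase.2 ⟨hij.symm, Finset.mem_univ j⟩)] at h1
  have h2 : ∑ p ∈ (Finset.univ.erase i).erase j, c (φ p) ≤
      ((Finset.univ.erase i).erase j).card • c₀ := by
    refine Finset.sum_le_card_nsmul _ _ _ fun p hp => ?_
    rw [Finset.mem_erase, Finset.mem_erase] at hp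
    exact hKc _ (hrest p hp.2.1 hp.1)
  rw [Finset.card_erase_of_mem (Finset.mem_erase.2 ⟨hij.symm, Finset.mem_univ j⟩),
    Finset.card_erase_of_mem (Finset.mem_univ i), Finset.card_univ, Fintype.card_fin,
    nsmul_eq_mul, Nat.sub_sub, Nat.cast_sub (by omega)] at h2
  push_cast at h2 ⊢
  linarith

theorem sum_normalized_cover_le {m t : ℕ} (hm : 0 < m) (ht : 0 < t) {c : Fin t → ℝ}
    (hc : ∀ v, 0 ≤ c v) {α : ℝ} (hα0 : 0 < α) (hα1 : α < 1)
    (hsum : ∑ v, c v ≤ (1 - α / 2) * t / (m : ℝ)) {L : Finset (Fin t)}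
    (hL : (L.card : ℝ) ≤ α / 4 * t) {c₀ : ℝ} (hc₀ : 0 ≤ c₀) (hcL : ∀ v ∉ L, c₀ ≤ c v) :
    m * c₀ < 1 ∧ ∑ v, max 0 (c v - c₀) / (1 - m * c₀) ≤ (t : ℝ) / m := by
  have hm0 : (0 : ℝ) < m := by exact_mod_cast hm
  have ht0 : (0 : ℝ) < t := by exact_mod_cast ht
  rw [le_div_iff₀ hm0] at hsum
  have hsub : ∑ v, max 0 (c v - c₀) ≤ ∑ v, c v - (t * c₀ - L.card * c₀) := by
    have h1 : ∀ v, max 0 (c v - c₀) ≤ c v - (c₀ - if v ∈ L then c₀ else 0) := by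
      intro v
      have := hc v
      split_ifs with h
      · exact max_le (by linarith) (by linarith)
      · have := hcL v h
        exact max_le (by linarith) (by linarith)
    refine (Finset.sum_le_sum fun v _ => h1 v).trans (le_of_eq ?_)
    rw [Finset.sum_sub_distrib, Finset.sum_sub_distrib, Finset.sum_ite_mem, Finset.univ_inter]
    simp
  have hLc : L.card * c₀ ≤ α / 4 * t * c₀ := by gcongr
  have hmax : 0 ≤ ∑ v, max 0 (c v - c₀) := Finset.sum_nonneg fun v _ => le_max_left _ _
  have h2 : (∑ v, max 0 (c v - c₀)) * m ≤ (1 - α / 2) * t - (1 - α / 4) * (m * c₀) * t := by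
    nlinarith
  have h3 : m * c₀ < 1 := by
    by_contra! h
    have h4 : 0 ≤ (∑ v, max 0 (c v - c₀)) * m := by positivity
    have h5 : (1 - α / 4) * 1 * t ≤ (1 - α / 4) * (m * c₀) * t := by
      gcongr
      linarith
    nlinarith [mul_pos hα0 ht0]
  refine ⟨h3, ?_⟩
  rw [← Finset.sum_div, div_le_div_iff₀ (by linarith) hm0]
  have h4 : α / 4 * (m * c₀) * t ≤ α / 4 * 1 * t := by gcongr
  nlinarith [mul_pos hα0 ht0]

theorem fracExtremal_of_cover {k l : ℕ} (hk : 3 ≤ k) (hl1 : 1 ≤ l) (hl2 : 2 * l < k) {t : ℕ}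
    (ht : 0 < t) {ER : Finset (Finset (Fin t))} (hER : ∀ e ∈ ER, e.card = k) {α β γ : ℝ}
    (hα0 : 0 < α) (hα1 : α < 1) (hγ : 0 < γ) (hγt : 1 ≤ γ * t)
    (hγm : 40 * ((2 * k - 2 * l : ℕ) : ℝ) * γ ≤ 1) {θ : ℝ}
    (hθ : θ = 2 * ((2 * k - 2 * l : ℕ) : ℝ) * (5 * ((2 * k - 2 * l : ℕ) : ℝ) + 2) * γ)
    (hθ1 : θ ≤ 1) (hβθ : β ≤ θ) {c : Fin t → ℝ} (hc0 : ∀ v, 0 ≤ c v)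
    (hsum : ∑ v, c v ≤ (1 - α / 2) * t / ((2 * k - 2 * l : ℕ) : ℝ))
    (hc : ∀ φ, IsCherryHom k l ER φ → 1 ≤ ∑ i, c (φ i))
    {L : Finset (Fin t)} (hL : (L.card : ℝ) ≤ α / 4 * t) (hcL : ∀ x ∈ L, ∀ y ∉ L, c x ≤ c y)
    {K : Finset (Fin t)} (hKL : K ⊆ L) (hK : K.card = k - 2)
    (hdeg : ((4 * ((k : ℝ) - l) - 1) / (4 * ((k : ℝ) - l) ^ 2) - γ) * (Nat.choose t 2) ≤
      ((ER.filter fun e => K ⊆ e).card : ℝ)) :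
    FracExtremal k l β θ ER := by
  have hm : ((2 * k - 2 * l : ℕ) : ℝ) = 2 * ((k : ℝ) - l) := by
    rw [Nat.cast_sub (by omega)]; push_cast; ring
  have hm4 : 4 ≤ 2 * k - 2 * l := by omega
  have hmem := fun e he => exists_one_div_le_of_mem_edge (e := e) hk hl1 hl2 hER hc he
  have hpair := fun c₀ hKc x y he =>
    one_le_of_insert_insert_mem (c₀ := c₀) (x := x) (y := y) hk hl1 hl2 hc hK hKc he
  refine fracExtremal_of_card_le (D := (5 * ((2 * k - 2 * l : ℕ) : ℝ) + 2) * (2 * γ)) hl2 ER hER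
    (Finset.univ.filter fun v => 1 / ((2 * k - 2 * l : ℕ) : ℝ) ≤ c v) ?_ hβθ ?_ hθ1 ?_ ?_
  · intro e he
    obtain ⟨v, hv, hcv⟩ := hmem e he
    exact ⟨v, hv, by simpa using hcv⟩
  · rw [hθ]; positivity
  · rw [hθ]; apply le_of_eq; ring
  have hδ : (4 * ((k : ℝ) - l) - 1) / (4 * ((k : ℝ) - l) ^ 2) =
      (2 * ((2 * k - 2 * l : ℕ) : ℝ) - 1) / ((2 * k - 2 * l : ℕ) : ℝ) ^ 2 := by
    rw [hm]; congr 1 <;> ring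
  rw [hδ] at hdeg
  clear hδ hc
  generalize 2 * k - 2 * l = m at *
  have hm4' : (4 : ℝ) ≤ m := by exact_mod_cast hm4
  have hm0 : (0 : ℝ) < m := by linarith
  have ht0 : (0 : ℝ) < t := by exact_mod_cast ht
  obtain ⟨v₀, hv₀, hmax⟩ := K.exists_max_image c (Finset.card_pos.1 (by omega))
  obtain ⟨hmc, hfsum⟩ := sum_normalized_cover_le (by omega) ht hc0 hα0 hα1 hsum hL (hc0 v₀)
    (fun y hy => hcL v₀ (hKL hv₀) y hy)
  set c₀ := c v₀
  have hd : 0 < 1 - m * c₀ := by linarith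
  set f : Fin t → ℝ := fun v => max 0 (c v - c₀) / (1 - m * c₀) with hf
  have hf0 : ∀ v, 0 ≤ f v := fun v => div_nonneg (le_max_left _ _) hd.le
  have hcf : ∀ v, c v - c₀ ≤ f v * (1 - m * c₀) := by
    intro v
    rw [hf, div_mul_cancel₀ _ hd.ne']
    exact le_max_right _ _
  have hdeg2 := two_mul_degree_le_card_pairs (by omega) ER hER K hK
    (Finset.univ.filter fun p : Fin t × Fin t => 1 ≤ f p.1 + f p.2) (by
      intro x y he
      have h1 := hpair c₀ hmax x y he
      simp only [Finset.mem_filter, Finset.mem_univ, true_and]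
      have h2 := hcf x
      have h3 := hcf y
      refine le_of_mul_le_mul_right ?_ hd
      linarith)
  have hdeg3 : (2 : ℝ) * ((ER.filter fun e => K ⊆ e).card : ℝ) ≤
      ((Finset.univ.filter fun p : Fin t × Fin t => 1 ≤ f p.1 + f p.2).card : ℝ) := by
    exact_mod_cast hdeg2
  have hδ1 : (2 * (m : ℝ) - 1) / (m : ℝ) ^ 2 ≤ 1 := by
    rw [div_le_one (by positivity)]; nlinarith
  have hT : ((2 * (m : ℝ) - 1) / (m : ℝ) ^ 2 - 2 * γ) * (t : ℝ) ^ 2 ≤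
      ((Finset.univ.filter fun p : Fin t × Fin t => 1 ≤ f p.1 + f p.2).card : ℝ) := by
    refine le_trans ?_ hdeg3
    rw [Nat.cast_choose_two] at hdeg
    have h1 : ((2 * (m : ℝ) - 1) / (m : ℝ) ^ 2 - γ) * t ≤ 1 * t := by
      gcongr
      linarith
    nlinarith
  refine le_trans (Nat.cast_le.2 (Finset.card_le_card ?_))
    (card_level_set_le hm4 ht f hf0 hfsum (g := 2 * γ) (by linarith) (by linarith) hT)
  intro v hv
  simp only [Finset.mem_filter, Finset.mem_univ, true_and] at hv ⊢
  refine le_trans ?_ (div_le_div_of_nonneg_right (le_max_right _ _) hd.le)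
  rw [div_le_div_iff₀ hm0 hd]
  rw [div_le_iff₀ hm0] at hv
  linarith

theorem stmt9 (k l : ℕ) (hk : 3 ≤ k) (hl1 : 1 ≤ l) (hl2 : 2 * l < k) :
    ∃ C γ₀ : ℝ, 0 < C ∧ 0 < γ₀ ∧
      ∀ α γ : ℝ, 0 < α → 0 < γ → γ < γ₀ →
        ∃ β ε : ℝ, 0 < β ∧ 0 < ε ∧
          ∃ t₀ : ℕ, ∀ t : ℕ, t₀ ≤ t →
            ∀ ER : Finset (Finset (Fin t)), (∀ e ∈ ER, e.card = k) →
              ¬ FracExtremal k l β (C * γ) ER →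
              ((((Finset.univ : Finset (Fin t)).powersetCard (k - 2)).filter fun K =>
                  ¬ (((4 * ((k : ℝ) - l) - 1) / (4 * ((k : ℝ) - l) ^ 2) - γ) *
                      (Nat.choose t 2) ≤
                    ((ER.filter fun e => K ⊆ e).card : ℝ))).card : ℝ) ≤
                ε * (Nat.choose t (k - 2)) →
              ∃ h : (Fin (2 * k - 2 * l) → Fin t) → ℝ,
                IsHomTiling k l β ER h ∧ (1 - α) * t ≤ tilingWeight k l h := by
  have hm4 : 4 ≤ 2 * k - 2 * l := by omega
  have hm4' : (4 : ℝ) ≤ ((2 * k - 2 * l : ℕ) : ℝ) := by exact_mod_cast hm4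
  set C : ℝ := 2 * ((2 * k - 2 * l : ℕ) : ℝ) * (5 * ((2 * k - 2 * l : ℕ) : ℝ) + 2) with hC
  have hC0 : 0 < C := by positivity
  have hC40 : 40 * ((2 * k - 2 * l : ℕ) : ℝ) ≤ C := by nlinarith
  refine ⟨C, 1 / C, hC0, by positivity, fun α γ hα hγ hγC => ?_⟩
  have hCγ : C * γ ≤ 1 := by
    rw [lt_div_iff₀ hC0] at hγC
    linarith
  refine ⟨min (C * γ) (α / (4 * ((2 * k - 2 * l : ℕ) : ℝ))), (α / 4 / 2) ^ (k - 2) / 2,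
    by positivity, by positivity, ⌈1 / γ⌉₊ + ⌈2 * k / (α / 4)⌉₊ + 1, fun t ht ER hER hext hbad => ?_⟩
  rcases le_or_gt 1 α with hα1 | hα1
  · refine ⟨fun _ => 0, ⟨fun φ hφ => absurd rfl hφ, fun v => ?_⟩, ?_⟩
    · simp [weightAt]
    · simp only [tilingWeight, weightAt, mul_zero, Finset.sum_const_zero]
      exact mul_nonpos_of_nonpos_of_nonneg (by linarith) (Nat.cast_nonneg t)
  have ht0 : 0 < t := by omega
  have hγt : 1 ≤ γ * t := by
    have h1 : 1 / γ ≤ t := (Nat.le_ceil _).trans (Nat.cast_le.2 (by omega))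
    rw [div_le_iff₀ hγ] at h1
    linarith
  have hkt : 2 * (k : ℝ) ≤ α / 4 * t := by
    have h1 : 2 * k / (α / 4) ≤ (t : ℝ) := (Nat.le_ceil _).trans (Nat.cast_le.2 (by omega))
    rw [div_le_iff₀ (by positivity)] at h1
    linarith
  rcases exists_homTiling_or_cover hl2 ht0 ER hα hα1
    (β := min (C * γ) (α / (4 * ((2 * k - 2 * l : ℕ) : ℝ)))) (by positivity) (by
      rw [← le_div_iff₀' (by positivity)]
      exact min_le_right _ _) with h | ⟨c, hc0, hsum, hc⟩
  · exact h
  · exfalso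
    apply hext
    have hfloor : (⌊α / 4 * t⌋₊ : ℝ) ≤ α / 4 * t := Nat.floor_le (by positivity)
    have hrt : ⌊α / 4 * t⌋₊ ≤ t := by
      have : (⌊α / 4 * t⌋₊ : ℝ) ≤ t := hfloor.trans (by
        have : (0 : ℝ) ≤ t := Nat.cast_nonneg t
        nlinarith)
      exact_mod_cast this
    obtain ⟨L, hLr, hcL⟩ := exists_lowest_subset hrt c
    have hk2 : ((k - 2 : ℕ) : ℝ) ≤ k := Nat.cast_le.2 (Nat.sub_le _ _)
    obtain ⟨K, hKL, hK, hdeg⟩ := exists_good_subset_of_few_bad L hLr _ hbad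
      (lt_choose_floor (by positivity) (by linarith) ht0)
    exact fracExtremal_of_cover hk hl1 hl2 ht0 hER hα hα1 hγ hγt
      ((mul_le_mul_of_nonneg_right hC40 hγ.le).trans hCγ) (by rw [hC]) hCγ (min_le_left _ _)
      hc0 hsum hc (hLr ▸ hfloor) hcL hKL hK hdeg
end

section
/- For all integers k ≥ 3 and 1 ≤ ℓ < k/2 there exist C, γ₀ > 0 such that for all α > 0 and γ ≤ γ₀ there exists an integer s such that the following holds for all sufficiently large n: if H is a k-uniform hypergraph on n vertices with δ_{k−2}(H) ≥ ((4(k−ℓ)−1)/(4(k−ℓ)²) − γ)·C(n,2), then either there is a family of at most s pairwise vertex-disjoint ℓ-paths in H that together cover all but at most αn vertices of H, or H is (ℓ,Cγ)-extremal. -/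
open Finset

/-- Number of edges of the hypergraph `E` containing the vertex set `S`. -/
def degH {n : ℕ} (E : Finset (Finset (Fin n))) (S : Finset (Fin n)) : ℕ :=
  (E.filter fun e => S ⊆ e).card

/-- `vs` is (the vertex list of) an ℓ-path in the hypergraph `E`. -/
def IsPath {n : ℕ} (k l : ℕ) (E : Finset (Finset (Fin n))) (vs : List (Fin n)) : Prop :=
  vs.Nodup ∧ (∃ p : ℕ, 1 ≤ p ∧ vs.length = p * (k - l) + l) ∧
    ∀ i : ℕ, i * (k - l) + k ≤ vs.length →
      ((vs.drop (i * (k - l))).take k).toFinset ∈ E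

/-- `E` is `(ℓ,ξ)`-extremal: there is a vertex set `B` of size
`⌊(2(k-ℓ)-1)n/(2(k-ℓ))⌋` spanning at most `ξ·C(n,k)` edges. -/
def IsExtremal {n : ℕ} (k l : ℕ) (ξ : ℝ) (E : Finset (Finset (Fin n))) : Prop :=
  ∃ B : Finset (Fin n), B.card = (2 * (k - l) - 1) * n / (2 * (k - l)) ∧
    ((E.filter fun e => e ⊆ B).card : ℝ) ≤ ξ * (Nat.choose n k)

/-- Pairs of total weight at least one are covered by the heavy vertices together with the pairs of
medium vertices. -/
theorem card_pairs_le {V : Type*} [Fintype V] [DecidableEq V] (g : V → ℝ) (x : ℝ) :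
    ((univ.filter fun p : V × V => 1 ≤ g p.1 + g p.2).card : ℝ) ≤
      2 * (univ.filter fun v => 1 - x ≤ g v).card * (Fintype.card V : ℝ)
        - ((univ.filter fun v => 1 - x ≤ g v).card : ℝ) ^ 2
        + ((univ.filter fun v => x ≤ g v ∧ g v < 1 - x).card : ℝ) ^ 2 := by
  set A := univ.filter fun v => 1 - x ≤ g v with hA
  set I := univ.filter fun v => x ≤ g v ∧ g v < 1 - x with hI
  have hsub : (univ.filter fun p : V × V => 1 ≤ g p.1 + g p.2) ⊆
      (univ \ (Aᶜ ×ˢ Aᶜ)) ∪ I ×ˢ I := by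
    intro p hp
    simp only [mem_filter, mem_univ, true_and] at hp
    simp only [mem_union, mem_sdiff, mem_univ, true_and, mem_product, mem_compl, hA, hI,
      mem_filter, not_le]
    by_cases h : g p.1 < 1 - x ∧ g p.2 < 1 - x
    · right
      exact ⟨⟨by linarith [h.2], h.1⟩, ⟨by linarith [h.1], h.2⟩⟩
    · left; exact h
  have h1 := (card_le_card hsub).trans (card_union_le _ _)
  have h2 : (univ \ (Aᶜ ×ˢ Aᶜ) : Finset (V × V)).card + Aᶜ.card * Aᶜ.card
      = Fintype.card V * Fintype.card V := by
    rw [← card_product, card_sdiff_add_card_eq_card (subset_univ _), card_univ, Fintype.card_prod]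
  have h3 : A.card + Aᶜ.card = Fintype.card V := card_add_card_compl A
  rw [card_product I I] at h1
  have h1' : ((univ.filter fun p : V × V => 1 ≤ g p.1 + g p.2).card : ℝ) ≤
    (univ \ (Aᶜ ×ˢ Aᶜ) : Finset (V × V)).card + (I.card : ℝ) * I.card := by exact_mod_cast h1
  have h2' : ((univ \ (Aᶜ ×ˢ Aᶜ) : Finset (V × V)).card : ℝ) + (Aᶜ.card : ℝ) * Aᶜ.card
      = (Fintype.card V : ℝ) * Fintype.card V := by exact_mod_cast h2
  have h3' : (A.card : ℝ) + Aᶜ.card = Fintype.card V := by exact_mod_cast h3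
  rw [← h3'] at h2' ⊢
  nlinarith

theorem card_grid_le (K : ℕ) (hK : 0 < K) (g : ℝ) (hg : 0 ≤ g) :
    (((Ioo 0 K).filter fun i : ℕ => (i : ℝ) / (2 * K) ≤ g).card : ℝ) +
      ((Ioo 0 K).filter fun i : ℕ => 1 - (i : ℝ) / (2 * K) ≤ g).card ≤ 2 * K * g := by
  have hK' : (0 : ℝ) < 2 * K := by positivity
  have hinj : Set.InjOn (fun i : ℕ => 2 * K - i)
      ((Ioo 0 K).filter fun i : ℕ => 1 - (i : ℝ) / (2 * K) ≤ g) := by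
    intro i hi j hj h
    simp only [coe_filter, mem_Ioo, Set.mem_ofPred_eq] at hi hj h
    omega
  rw [← card_image_of_injOn hinj]
  have hdisj : Disjoint ((Ioo 0 K).filter fun i : ℕ => (i : ℝ) / (2 * K) ≤ g)
      (((Ioo 0 K).filter fun i : ℕ => 1 - (i : ℝ) / (2 * K) ≤ g).image fun i : ℕ => 2 * K - i) := by
    rw [disjoint_left]
    intro i hi hj
    simp only [mem_filter, mem_Ioo, mem_image] at hi hj
    obtain ⟨j, hj, rfl⟩ := hj
    omega
  rw [← Nat.cast_add, ← card_union_of_disjoint hdisj]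
  have hsub : ((Ioo 0 K).filter fun i : ℕ => (i : ℝ) / (2 * K) ≤ g) ∪
      (((Ioo 0 K).filter fun i : ℕ => 1 - (i : ℝ) / (2 * K) ≤ g).image fun i : ℕ => 2 * K - i) ⊆
      Icc 1 ⌊2 * K * g⌋₊ := by
    intro i hi
    simp only [mem_union, mem_filter, mem_Ioo, mem_image] at hi
    rw [mem_Icc, Nat.le_floor_iff (by positivity)]
    rcases hi with ⟨h1, h2⟩ | ⟨j, ⟨h1, h2⟩, rfl⟩
    · refine ⟨by omega, ?_⟩
      rw [div_le_iff₀ hK'] at h2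
      linarith
    · refine ⟨by omega, ?_⟩
      rw [Nat.cast_sub (by omega)]
      push_cast
      have : (j : ℝ) / (2 * K) * (2 * K) = j := by field_simp
      nlinarith
  calc _ ≤ ((Icc 1 ⌊2 * K * g⌋₊).card : ℝ) := by exact_mod_cast card_le_card hsub
    _ = ⌊2 * K * g⌋₊ := by simp
    _ ≤ _ := Nat.floor_le (by positivity)

theorem sq_sub_stability (a γ η σ α : ℝ) (ha : 0 ≤ a) (ha4 : a ≤ 1 / 4) (hη0 : 0 ≤ η)
    (hη : η ≤ 1 / 20) (hα : 0 ≤ α) (hασ : α ≤ σ) (hσ : σ ≤ a + η)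
    (h : 2 * a - a ^ 2 - γ ≤ 2 * α - α ^ 2 + (2 * σ - α - α) ^ 2) :
    2 * σ - α ≤ a + (5 * η + 2 * γ) := by
  have h0 : 0 ≤ σ - α := by linarith
  have h6 : (σ - α) * (1 / 2) ≤ (σ - α) * (2 - 5 * σ + 3 * α) := by
    apply mul_le_mul_of_nonneg_left _ h0; linarith
  have h7 : 2 * σ - σ ^ 2 ≤ 2 * a - a ^ 2 + 2 * η := by
    rcases le_total σ a with hc | hc
    · nlinarith [mul_nonneg (sub_nonneg.2 hc) (by linarith : 0 ≤ 2 - a - σ)]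
    · nlinarith [mul_nonneg (sub_nonneg.2 hc) (by linarith : 0 ≤ a + σ)]
  nlinarith

/-- Stability for the number of pairs of total weight at least one: if a weighting of average at
most `a` has nearly the maximum possible number of such pairs, then few weights are at least `a`. -/
theorem card_heavy_le {V : Type*} [Fintype V] [DecidableEq V] (hV : 0 < Fintype.card V)
    (a γ : ℝ) (ha : 0 < a) (ha4 : a ≤ 1 / 4) (hγ : 0 < γ) (hγa : 40 * γ ≤ a)
    (g : V → ℝ) (hg : ∀ v, 0 ≤ g v) (hsum : ∑ v, g v ≤ a * Fintype.card V)
    (hP : (2 * a - a ^ 2 - γ) * (Fintype.card V : ℝ) ^ 2 ≤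
      (univ.filter fun p : V × V => 1 ≤ g p.1 + g p.2).card) :
    ((univ.filter fun v => a ≤ g v).card : ℝ) ≤ (a + (10 / a + 2) * γ) * Fintype.card V := by
  set N : ℝ := (Fintype.card V : ℝ) with hN
  have hN0 : 0 < N := by rw [hN]; exact_mod_cast hV
  set F : ℝ → ℝ := fun x => (univ.filter fun v => x ≤ g v).card / N with hF
  have hFmono : ∀ x y, x ≤ y → F y ≤ F x := by
    intro x y hxy
    apply div_le_div_of_nonneg_right _ hN0.le
    exact_mod_cast card_le_card (fun v hv => by simp only [mem_filter] at hv ⊢; exact ⟨hv.1, hxy.trans hv.2⟩)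
  have hF0 : ∀ x, 0 ≤ F x := fun x => by positivity
  -- the pair bound at level `x`
  have key : ∀ x, x ≤ 1 / 2 → 2 * a - a ^ 2 - γ ≤
      2 * F (1 - x) - F (1 - x) ^ 2 + (F x - F (1 - x)) ^ 2 := by
    intro x hx
    have h := hP.trans (card_pairs_le g x)
    have hsplit : (univ.filter fun v => x ≤ g v).card =
        (univ.filter fun v => 1 - x ≤ g v).card +
          (univ.filter fun v => x ≤ g v ∧ g v < 1 - x).card := by
      rw [← card_union_of_disjoint]
      · congr 1
        ext v
        simp only [mem_filter, mem_univ, true_and, mem_union]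
        constructor
        · intro h; by_cases h' : 1 - x ≤ g v
          · exact Or.inl h'
          · exact Or.inr ⟨h, not_le.1 h'⟩
        · rintro (h | h)
          · linarith
          · exact h.1
      · rw [disjoint_left]
        intro v h1 h2
        simp only [mem_filter, mem_univ, true_and] at h1 h2
        linarith [h2.2]
    have hsplit' : F x - F (1 - x) = (univ.filter fun v => x ≤ g v ∧ g v < 1 - x).card / N := by
      simp only [hF, hsplit]
      push_cast
      ring
    rw [hsplit']
    have e1 : ((univ.filter fun v => 1 - x ≤ g v).card : ℝ) = F (1 - x) * N := by
      simp only [hF]; field_simp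
    rw [e1, ← hN] at h
    have e2 : ((univ.filter fun v => x ≤ g v ∧ g v < 1 - x).card : ℝ) =
        (univ.filter fun v => x ≤ g v ∧ g v < 1 - x).card / N * N :=
      (div_mul_cancel₀ _ hN0.ne').symm
    rw [e2] at h
    have hNN : 0 < N ^ 2 := by positivity
    refine le_of_mul_le_mul_right ?_ hNN
    linarith
  obtain ⟨K, hK⟩ := exists_nat_ge (max (2 / a) (a / γ) + 2)
  have hK1 : 2 / a ≤ K := by linarith [le_max_left (2 / a) (a / γ)]
  have hK2 : a / γ ≤ K := by linarith [le_max_right (2 / a) (a / γ)]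
  have hK3 : (2 : ℝ) ≤ K := by
    have : 0 ≤ max (2 / a) (a / γ) := le_max_of_le_left (by positivity)
    linarith
  rw [div_le_iff₀ ha] at hK1
  rw [div_le_iff₀ hγ] at hK2
  have hK0 : 0 < K := by exact_mod_cast (by linarith : (0 : ℝ) < K)
  have hK3' : 2 ≤ K := by exact_mod_cast hK3
  set x : ℕ → ℝ := fun i => (i : ℝ) / (2 * K) with hx
  have hx2 : ∀ i ∈ Ioo 0 K, x i ≤ 1 / 2 := by
    intro i hi
    simp only [hx]
    rw [div_le_div_iff₀ (by positivity) (by norm_num)]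
    have : (i : ℝ) ≤ K := by exact_mod_cast (mem_Ioo.1 hi).2.le
    linarith
  set s : ℕ → ℝ := fun i => (F (x i) + F (1 - x i)) / 2 with hs
  have hssum : ∑ i ∈ Ioo 0 K, s i ≤ K * a := by
    have hsw : ∀ (t : ℕ → ℝ), ∑ i ∈ Ioo 0 K, F (t i) =
        (∑ v, (((Ioo 0 K).filter fun i => t i ≤ g v).card : ℝ)) / N := by
      intro t
      simp only [hF]
      rw [← sum_div]
      congr 1
      simp only [card_filter]
      push_cast
      rw [sum_comm]
    have : ∑ i ∈ Ioo 0 K, s i = (∑ i ∈ Ioo 0 K, F (x i) + ∑ i ∈ Ioo 0 K, F (1 - x i)) / 2 := by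
      rw [← sum_add_distrib, sum_div]
    rw [this, hsw x, hsw fun i => 1 - x i, ← add_div, ← sum_add_distrib, div_div,
      div_le_iff₀ (by positivity)]
    calc _ ≤ ∑ v, 2 * K * g v := sum_le_sum fun v _ => card_grid_le K hK0 (g v) (hg v)
      _ = 2 * K * ∑ v, g v := by rw [mul_sum]
      _ ≤ 2 * K * (a * N) := by gcongr
      _ = _ := by ring
  have hslow : ∀ i ∈ Ioo 0 K, a - γ ≤ s i := by
    intro i hi
    by_contra! hlt
    have h1 := key (x i) (hx2 i hi)
    have h2 : F (1 - x i) ≤ F (x i) := hFmono _ _ (by linarith [hx2 i hi])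
    have h3 := hF0 (1 - x i)
    simp only [hs] at hlt
    set α := F (1 - x i)
    set φ := F (x i)
    nlinarith [mul_nonneg h3 (sub_nonneg.2 h2), mul_nonneg (sub_nonneg.2 h2) (by linarith : 0 ≤ a - (φ + α) / 2)]
  obtain ⟨i, hi, hia, hsi⟩ : ∃ i ∈ Ioo 0 K, x i ≤ a ∧ s i ≤ a + 2 / a * γ := by
    by_contra! hcon
    have hlt : ∑ i ∈ Ioo 0 K, ((a - γ) + if x i ≤ a then 2 / a * γ else 0) ≤ ∑ i ∈ Ioo 0 K, s i := by
      refine sum_le_sum fun i hi => ?_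
      split_ifs with h
      · have := hcon i hi h
        linarith
      · linarith [hslow i hi]
    rw [sum_add_distrib, sum_const, ← sum_filter, sum_const, nsmul_eq_mul, nsmul_eq_mul,
      Nat.card_Ioo] at hlt
    have hcard : 2 * K * a - 1 ≤ (((Ioo 0 K).filter fun i => x i ≤ a).card : ℝ) := by
      have hsub : Icc 1 ⌊2 * K * a⌋₊ ⊆ (Ioo 0 K).filter fun i => x i ≤ a := by
        intro i hi
        rw [mem_Icc, Nat.le_floor_iff (by positivity)] at hi
        simp only [mem_filter, mem_Ioo, hx]
        refine ⟨⟨by omega, ?_⟩, ?_⟩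
        · have : (i : ℝ) < K := by nlinarith
          exact_mod_cast this
        · rw [div_le_iff₀ (by positivity)]; linarith
      have := card_le_card hsub
      rw [Nat.card_Icc] at this
      have h' : ((⌊2 * K * a⌋₊ + 1 - 1 : ℕ) : ℝ) ≤ ((Ioo 0 K).filter fun i => x i ≤ a).card := by
        exact_mod_cast this
      rw [Nat.add_sub_cancel] at h'
      have := Nat.lt_floor_add_one (2 * K * a)
      linarith
    have hle := hlt.trans hssum
    have e : ((K - 0 - 1 : ℕ) : ℝ) = K - 1 := by
      rw [Nat.sub_zero, Nat.cast_sub (by omega)]; norm_num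
    rw [e] at hle
    have h5 : (2 * K * a - 1) * (2 / a * γ) ≤
        (((Ioo 0 K).filter fun i => x i ≤ a).card : ℝ) * (2 / a * γ) := by gcongr
    have h6 : (2 * K * a - 1) * (2 / a * γ) = 4 * K * γ - 2 / a * γ := by field_simp; ring
    have h7 : 2 / a * γ ≤ K * γ := by
      gcongr
      rw [div_le_iff₀ ha]; exact hK1
    nlinarith
  have h1 := key (x i) (hx2 i hi)
  have h2 : F (1 - x i) ≤ F (x i) := hFmono _ _ (by linarith [hx2 i hi])
  have h3 := hF0 (1 - x i)
  have h4 : F a ≤ F (x i) := hFmono _ _ hia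
  have h5 : F a ≤ a + (10 / a + 2) * γ := by
    have hη : 10 / a * γ = 5 * (2 / a * γ) := by ring
    have hη2 : 2 / a * γ ≤ 1 / 20 := by
      rw [div_mul_eq_mul_div, div_le_iff₀ ha]; linarith
    have hη0 : 0 ≤ 2 / a * γ := by positivity
    rw [add_mul, hη]
    simp only [hs] at hsi
    generalize 2 / a * γ = η at *
    set α := F (1 - x i)
    set φ := F (x i)
    set σ := (φ + α) / 2 with hσ
    have hφ : φ = 2 * σ - α := by rw [hσ]; ring
    rw [hφ] at h1 h2 h4
    have := sq_sub_stability a γ η σ α ha.le ha4 hη0 hη2 h3 (by linarith) hsi h1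
    linarith
  simp only [hF] at h5
  rwa [div_le_iff₀ hN0] at h5

/-- Consecutive blocks of `h` elements in the order of increasing `y`. -/
theorem exists_low_blocks {N : ℕ} {J : Type*} [Fintype J] [DecidableEq J] (y : Fin N → ℝ) (h : ℕ)
    (hh : Fintype.card J * h < N) :
    ∃ (B : J → Finset (Fin N)) (low : Finset (Fin N)) (y₀ : ℝ) (v₀ : Fin N), y v₀ = y₀ ∧
      (∀ j, (B j).card = h) ∧ (∀ i j, i ≠ j → Disjoint (B i) (B j)) ∧ (∀ j, B j ⊆ low) ∧
      low.card = Fintype.card J * h ∧ (∀ v ∈ low, y v ≤ y₀) ∧ ∀ v ∉ low, y₀ ≤ y v := by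
  set σ := Tuple.sort y
  have hσ : Monotone (y ∘ σ) := Tuple.monotone_sort y
  let idx := Fintype.equivFin J
  have hcard : ∀ a b : ℕ, b ≤ N →
      (univ.filter fun v : Fin N => a ≤ (σ.symm v : ℕ) ∧ (σ.symm v : ℕ) < b).card = b - a := by
    intro a b hb
    rw [← Nat.card_Ico a b]
    apply card_bij (fun v _ => (σ.symm v : ℕ))
    · intro v hv
      simpa using hv
    · intro v _ v' _ h
      exact σ.symm.injective (Fin.ext h)
    · intro i hi
      rw [mem_Ico] at hi
      exact ⟨σ ⟨i, by omega⟩, by simpa using hi, by simp⟩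
  have hidx : ∀ j, ((idx j : ℕ) + 1) * h ≤ Fintype.card J * h := fun j =>
    Nat.mul_le_mul_right _ (idx j).2
  refine ⟨fun j => univ.filter fun v => (idx j : ℕ) * h ≤ (σ.symm v : ℕ) ∧
      (σ.symm v : ℕ) < ((idx j : ℕ) + 1) * h,
    univ.filter fun v => 0 ≤ (σ.symm v : ℕ) ∧ (σ.symm v : ℕ) < Fintype.card J * h,
    y (σ ⟨_, hh⟩), σ ⟨_, hh⟩, rfl, ?_, ?_, ?_, ?_, ?_, ?_⟩
  · intro j
    rw [hcard _ _ ((hidx j).trans hh.le)]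
    rw [Nat.add_mul, one_mul, Nat.add_sub_cancel_left]
  · intro i j hij
    rw [disjoint_left]
    intro v hi hj
    simp only [mem_filter, mem_univ, true_and] at hi hj
    have hne : (idx i : ℕ) ≠ idx j := fun h => hij (idx.injective (Fin.ext h))
    rcases lt_or_gt_of_ne hne with hlt | hlt
    · have := Nat.mul_le_mul_right h (Nat.succ_le_of_lt hlt)
      simp only [Nat.succ_eq_add_one] at this
      omega
    · have := Nat.mul_le_mul_right h (Nat.succ_le_of_lt hlt)
      simp only [Nat.succ_eq_add_one] at this
      omega
  · intro j v hv
    simp only [mem_filter, mem_univ, true_and] at hv ⊢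
    have := hidx j
    omega
  · rw [hcard _ _ hh.le, Nat.sub_zero]
  · intro v hv
    simp only [mem_filter, mem_univ, true_and] at hv
    have := hσ (show σ.symm v ≤ ⟨_, hh⟩ from Fin.le_def.2 hv.2.le)
    simpa using this
  · intro v hv
    simp only [mem_filter, mem_univ, true_and, not_lt, Nat.zero_le] at hv
    have := hσ (show ⟨_, hh⟩ ≤ σ.symm v from Fin.le_def.2 hv)
    simpa using this

theorem sum_card_update_le {N : ℕ} {J : Type*} [Fintype J] [DecidableEq J] {j₀ j₁ : J}
    (hj : j₀ ≠ j₁) (A Bad : Finset (J → Fin N)) :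
    ∑ s ∈ A, (univ.filter fun p : Fin N × Fin N =>
      Function.update (Function.update s j₀ p.1) j₁ p.2 ∈ Bad).card ≤ Bad.card * N ^ 2 := by
  rw [← card_sigma]
  have e : Bad.card * N ^ 2 = (Bad ×ˢ (univ : Finset (Fin N × Fin N))).card := by
    rw [card_product, card_univ, Fintype.card_prod, Fintype.card_fin, sq]
  rw [e]
  refine card_le_card_of_injOn (fun x => (Function.update (Function.update x.1 j₀ x.2.1) j₁ x.2.2,
    (x.1 j₀, x.1 j₁))) ?_ ?_
  · intro x hx
    simp only [coe_sigma, coe_filter, Set.mem_sigma_iff, mem_coe, mem_univ, true_and,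
      Set.mem_ofPred_eq] at hx
    simpa using hx.2
  · rintro ⟨s, p⟩ _ ⟨s', p'⟩ _ h
    simp only [Prod.mk.injEq] at h
    obtain ⟨h, h0, h1⟩ := h
    have hp1 : p.2 = p'.2 := by simpa using congrFun h j₁
    have hp0 : p.1 = p'.1 := by simpa [hj] using congrFun h j₀
    have hs : s = s' := by
      funext j
      by_cases hj0 : j = j₀
      · rw [hj0, h0]
      by_cases hj1 : j = j₁
      · rw [hj1, h1]
      simpa [hj0, hj1] using congrFun h j
    rw [hs, Prod.ext hp0 hp1]

/-- If all tuples in `Good`, which is almost all of `Edg`, have large `y`-weight, then the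
(normalised, shifted) weighting `y` witnesses that the tuples of `Good` avoid the set of light
vertices. -/
theorem exists_weighting {N : ℕ} {J : Type*} [Fintype J] [DecidableEq J] {j₀ j₁ : J}
    (hj : j₀ ≠ j₁) (w : J → ℝ) (hw : ∀ j, 0 ≤ w j) (hw0 : w j₀ = 1 / 2) (hw1 : w j₁ = 1 / 2)
    (m : ℝ) (hm : 0 < m) (hwm : ∑ j, w j = m) (Edg Good : Finset (J → Fin N)) (D γ κ lam : ℝ)
    (h : ℕ) (hN : 0 < N) (hlam : 0 < lam) (hlam1 : lam ≤ 1) (hD : γ < D)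
    (hbad : ((Edg \ Good).card : ℝ) ≤ γ * (lam * N) ^ Fintype.card J)
    (hdeg : ∀ s : J → Fin N, Set.InjOn s {j | j ≠ j₀ ∧ j ≠ j₁} →
      D * (N : ℝ) ^ 2 ≤ (univ.filter fun p : Fin N × Fin N =>
        Function.update (Function.update s j₀ p.1) j₁ p.2 ∈ Edg).card)
    (hlamh : lam * N ≤ h) (hh : 2 * (Fintype.card J * h : ℝ) ≤ N)
    (hhκ : 2 * m * (Fintype.card J * h : ℝ) ≤ κ * N)
    (y : Fin N → ℝ) (hy : ∀ v, 0 ≤ y v) (Y : ℝ) (hY : ∑ v, y v = Y * N) (hY1 : Y ≤ 1)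
    (hgood : ∀ f ∈ Good, m * Y + κ < ∑ j, w j * y (f j)) :
    ∃ g : Fin N → ℝ, (∀ v, 0 ≤ g v) ∧ ∑ v, g v ≤ 1 / (2 * m) * N ∧
      (D - γ) * (N : ℝ) ^ 2 ≤ (univ.filter fun p : Fin N × Fin N => 1 ≤ g p.1 + g p.2).card ∧
      ∀ f ∈ Good, ∃ j, 1 / (2 * m) ≤ g (f j) := by
  have hN' : (0 : ℝ) < N := by exact_mod_cast hN
  have hcJ : 0 < Fintype.card J := Fintype.card_pos_iff.2 ⟨j₀⟩
  have hlt : Fintype.card J * h < N := by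
    have : (Fintype.card J * h : ℝ) < N := by linarith
    exact_mod_cast this
  obtain ⟨B, low, y₀, v₀, hv₀, hBc, hBd, hBl, hlc, hl1, hl2⟩ := exists_low_blocks (J := J) y h hlt
  have hlc' : (low.card : ℝ) = Fintype.card J * h := by exact_mod_cast hlc
  set A : Finset (J → Fin N) :=
    Fintype.piFinset fun j => if j = j₀ ∨ j = j₁ then univ else B j with hA
  have hAc : (lam * N) ^ Fintype.card J ≤ (A.card : ℝ) := by
    rw [hA, Fintype.card_piFinset, Nat.cast_prod, ← card_univ, ← prod_const]
    refine prod_le_prod (fun _ _ => by positivity) fun j _ => ?_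
    split_ifs
    · rw [card_univ, Fintype.card_fin]; nlinarith
    · rw [hBc]; exact hlamh
  have hAmem : ∀ s ∈ A, ∀ j, j ≠ j₀ → j ≠ j₁ → s j ∈ B j := by
    intro s hs j h0 h1
    have := Fintype.mem_piFinset.1 hs j
    rwa [if_neg (by tauto)] at this
  have hApos : (0 : ℝ) < A.card := lt_of_lt_of_le (by positivity) hAc
  obtain ⟨s, hsA, hs⟩ : ∃ s ∈ A, ((univ.filter fun p : Fin N × Fin N =>
      Function.update (Function.update s j₀ p.1) j₁ p.2 ∈ Edg \ Good).card : ℝ) ≤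
        γ * (N : ℝ) ^ 2 := by
    by_contra! hcon
    have h1 : ∑ s ∈ A, γ * (N : ℝ) ^ 2 < ∑ s ∈ A, ((univ.filter fun p : Fin N × Fin N =>
      Function.update (Function.update s j₀ p.1) j₁ p.2 ∈ Edg \ Good).card : ℝ) :=
      sum_lt_sum_of_nonempty (card_pos.1 (by exact_mod_cast hApos)) hcon
    have h2 := sum_card_update_le hj A (Edg \ Good)
    have h2' : ∑ s ∈ A, ((univ.filter fun p : Fin N × Fin N =>
      Function.update (Function.update s j₀ p.1) j₁ p.2 ∈ Edg \ Good).card : ℝ) ≤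
        (Edg \ Good).card * (N : ℝ) ^ 2 := by exact_mod_cast h2
    rw [sum_const, nsmul_eq_mul] at h1
    have hγ : 0 ≤ γ := by
      have := (Nat.cast_nonneg (α := ℝ) (Edg \ Good).card).trans hbad
      exact nonneg_of_mul_nonneg_left this (by positivity)
    have h3 : γ * (lam * N) ^ Fintype.card J * (N : ℝ) ^ 2 ≤ γ * A.card * (N : ℝ) ^ 2 := by
      gcongr
    have h4 : ((Edg \ Good).card : ℝ) * (N : ℝ) ^ 2 ≤
      γ * (lam * N) ^ Fintype.card J * (N : ℝ) ^ 2 := by gcongr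
    linarith
  have hsinj : Set.InjOn s {j | j ≠ j₀ ∧ j ≠ j₁} := by
    intro i hi j hj' hij
    by_contra hne
    exact disjoint_left.1 (hBd i j hne) (hAmem s hsA i hi.1 hi.2)
      (hij ▸ hAmem s hsA j hj'.1 hj'.2)
  have hpairs : (D - γ) * (N : ℝ) ^ 2 ≤ (univ.filter fun p : Fin N × Fin N =>
      Function.update (Function.update s j₀ p.1) j₁ p.2 ∈ Good).card := by
    have h1 := hdeg s hsinj
    have h2 : (univ.filter fun p : Fin N × Fin N =>
        Function.update (Function.update s j₀ p.1) j₁ p.2 ∈ Edg).card ≤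
        (univ.filter fun p : Fin N × Fin N =>
          Function.update (Function.update s j₀ p.1) j₁ p.2 ∈ Edg \ Good).card +
        (univ.filter fun p : Fin N × Fin N =>
          Function.update (Function.update s j₀ p.1) j₁ p.2 ∈ Good).card := by
      refine (card_le_card ?_).trans (card_union_le _ _)
      intro p hp
      simp only [mem_filter, mem_univ, true_and, mem_union, mem_sdiff] at hp ⊢
      tauto
    have h2' : ((univ.filter fun p : Fin N × Fin N =>
        Function.update (Function.update s j₀ p.1) j₁ p.2 ∈ Edg).card : ℝ) ≤
        (univ.filter fun p : Fin N × Fin N =>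
          Function.update (Function.update s j₀ p.1) j₁ p.2 ∈ Edg \ Good).card +
        (univ.filter fun p : Fin N × Fin N =>
          Function.update (Function.update s j₀ p.1) j₁ p.2 ∈ Good).card := by exact_mod_cast h2
    linarith
  set z : Fin N → ℝ := fun v => max (y v - y₀) 0 with hz
  have hz0 : ∀ v, 0 ≤ z v := fun v => le_max_right _ _
  have hzy : ∀ v, y v ≤ y₀ + z v := fun v => by linarith [le_max_left (y v - y₀) 0]
  set t : ℝ := m * (Y - y₀) + κ with ht
  -- the sum of the shifted weights
  have hlowN : (low.card : ℝ) * 2 ≤ N := by rw [hlc']; linarith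
  have hsplit : ∀ F : Fin N → ℝ, ∑ v, F v = ∑ v ∈ low, F v + ∑ v ∈ lowᶜ, F v := fun F =>
    (sum_add_sum_compl low F).symm
  have hcompl : (lowᶜ.card : ℝ) = N - low.card := by
    have : low.card + lowᶜ.card = N := by rw [card_add_card_compl, Fintype.card_fin]
    have : (low.card : ℝ) + lowᶜ.card = N := by exact_mod_cast this
    linarith
  have hy₀0 : 0 ≤ y₀ := hv₀ ▸ hy v₀
  have hy₀ : y₀ ≤ 2 := by
    have h1 : (lowᶜ.card : ℝ) * y₀ ≤ ∑ v ∈ lowᶜ, y v := by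
      rw [← nsmul_eq_mul]
      exact card_nsmul_le_sum _ _ _ fun v hv => hl2 v (mem_compl.1 hv)
    have h2 : 0 ≤ ∑ v ∈ low, y v := sum_nonneg fun v _ => hy v
    have h3 := hsplit y
    rw [hcompl] at h1
    by_contra! hc
    nlinarith
  have hzsum : ∑ v, z v ≤ t / m * N := by
    have h1 : ∑ v ∈ low, z v = 0 := sum_eq_zero fun v hv => by
      simp only [hz]; exact max_eq_right (by linarith [hl1 v hv])
    have h2 : ∑ v ∈ lowᶜ, z v = ∑ v ∈ lowᶜ, y v - (N - low.card) * y₀ := by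
      rw [← hcompl, ← nsmul_eq_mul, ← sum_const, ← sum_sub_distrib]
      refine sum_congr rfl fun v hv => ?_
      simp only [hz]; exact max_eq_left (by linarith [hl2 v (mem_compl.1 hv)])
    have h3 : 0 ≤ ∑ v ∈ low, y v := sum_nonneg fun v _ => hy v
    rw [hsplit z, h1, h2]
    have h4 := hsplit y
    have h5 : t / m * N = (Y - y₀) * N + κ * N / m := by rw [ht]; field_simp
    have h6 : 2 * (Fintype.card J * h : ℝ) ≤ κ * N / m := by
      rw [le_div_iff₀ hm]; linarith
    rw [← hlc'] at h6
    rw [h5]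
    have h7 : (low.card : ℝ) * y₀ ≤ low.card * 2 := by gcongr
    linarith
  have hpair : ∀ p : Fin N × Fin N,
      Function.update (Function.update s j₀ p.1) j₁ p.2 ∈ Good → 2 * t < z p.1 + z p.2 := by
    intro p hp
    have h1 := hgood _ hp
    have h2 : ∑ j, w j * y (Function.update (Function.update s j₀ p.1) j₁ p.2 j) ≤
        ∑ j, (w j * y₀ + ((if j = j₀ then z p.1 / 2 else 0) + if j = j₁ then z p.2 / 2 else 0)) := by
      refine sum_le_sum fun j _ => ?_
      by_cases hj0 : j = j₀
      · subst hj0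
        rw [if_pos rfl, if_neg hj, Function.update_of_ne hj, Function.update_self, hw0]
        linarith [hzy p.1]
      by_cases hj1 : j = j₁
      · subst hj1
        rw [if_pos rfl, if_neg hj0, Function.update_self, hw1]
        linarith [hzy p.2]
      rw [if_neg hj0, if_neg hj1, Function.update_of_ne hj1, Function.update_of_ne hj0, add_zero,
        add_zero]
      exact mul_le_mul_of_nonneg_left (hl1 _ (hBl j (hAmem s hsA j hj0 hj1))) (hw j)
    rw [sum_add_distrib, sum_add_distrib, sum_ite_eq' univ j₀, sum_ite_eq' univ j₁, ← sum_mul,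
      hwm, if_pos (mem_univ _), if_pos (mem_univ _)] at h2
    rw [ht]; linarith
  have ht0 : 0 < t := by
    have h0 : (0 : ℝ) < (D - γ) * (N : ℝ) ^ 2 := by
      have : 0 < D - γ := by linarith
      positivity
    have h1 := h0.trans_le hpairs
    have h2 := card_pos.1 (show 0 < _ by exact_mod_cast h1)
    obtain ⟨p, hp⟩ := h2
    have hp' := hpair p (mem_filter.1 hp).2
    have h3 : 0 ≤ t := by
      have := (sum_nonneg fun v _ => hz0 v).trans hzsum
      have := nonneg_of_mul_nonneg_left this hN'
      by_contra! hc
      have := div_neg_of_neg_of_pos hc hm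
      linarith
    rcases h3.lt_or_eq with h3 | h3
    · exact h3
    · exfalso
      rw [← h3, zero_div, zero_mul] at hzsum
      have h4 : ∀ v, z v ≤ 0 := fun v =>
        (single_le_sum (f := z) (fun v _ => hz0 v) (mem_univ v)).trans hzsum
      have := h4 p.1
      have := h4 p.2
      linarith
  refine ⟨fun v => z v / (2 * t), fun v => by have := hz0 v; positivity, ?_, ?_, ?_⟩
  · rw [← sum_div, div_le_iff₀ (by positivity)]
    calc _ ≤ _ := hzsum
      _ = _ := by field_simp
  · refine hpairs.trans ?_
    have : (univ.filter fun p : Fin N × Fin N =>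
      Function.update (Function.update s j₀ p.1) j₁ p.2 ∈ Good) ⊆
      univ.filter fun p : Fin N × Fin N => 1 ≤ z p.1 / (2 * t) + z p.2 / (2 * t) := by
      intro p hp
      have := hpair p (mem_filter.1 hp).2
      rw [mem_filter, ← add_div, le_div_iff₀ (by positivity)]
      exact ⟨mem_univ _, by linarith⟩
    exact_mod_cast card_le_card this
  · intro f hf
    by_contra! hcon
    have h1 := hgood f hf
    have h2 : ∀ j, y (f j) < y₀ + t / m := by
      intro j
      have := hcon j
      rw [div_lt_div_iff₀ (by positivity) (by positivity)] at this
      have h3 : z (f j) < t / m := by rw [lt_div_iff₀ hm]; linarith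
      linarith [hzy (f j)]
    have h3 : ∑ j, w j * y (f j) ≤ ∑ j, w j * (y₀ + t / m) :=
      sum_le_sum fun j _ => mul_le_mul_of_nonneg_left (h2 j).le (hw j)
    rw [← sum_mul, hwm] at h3
    have h4 : m * (y₀ + t / m) = m * Y + κ := by rw [ht]; field_simp; ring
    linarith

/-- A labelling of `Fin N` can be approximated by an equipartition into `q` blocks: all but few
vertices lie in blocks on which the labelling is constant. -/
theorem exists_equipartition_refining {N : ℕ} {A : Type*} [Fintype A] (lab : Fin N → A) (q b : ℕ)
    (hb : 0 < b) (hN : N = q * b) :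
    ∃ (c : Fin N → Fin q) (X : Finset (Fin N)),
      (∀ i, (univ.filter fun v => c v = i).card = b) ∧
      (∀ v ∈ X, ∀ v', c v' = c v → v' ∈ X ∧ lab v' = lab v) ∧
      Xᶜ.card ≤ Fintype.card A * b := by
  classical
  let rk := Fintype.equivFin A
  set σ := Tuple.sort fun v => rk (lab v)
  have hσ : Monotone ((fun v => rk (lab v)) ∘ σ) := Tuple.monotone_sort _
  have hmono : ∀ v v', σ.symm v ≤ σ.symm v' → rk (lab v) ≤ rk (lab v') := by
    intro v v' h
    simpa using hσ h
  let c : Fin N → Fin q := fun v => ⟨(σ.symm v : ℕ) / b, by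
    rw [Nat.div_lt_iff_lt_mul hb, ← hN]; exact (σ.symm v).2⟩
  have hc : ∀ v v', c v = c v' ↔ (σ.symm v : ℕ) / b = (σ.symm v' : ℕ) / b := fun v v' => Fin.ext_iff
  have hcard : ∀ i, (univ.filter fun v => c v = i).card = b := by
    intro i
    have hi : (i : ℕ) * b + b ≤ N := by
      rw [hN, ← Nat.succ_mul]; exact Nat.mul_le_mul_right _ i.2
    have : ((Ico ((i : ℕ) * b) (i * b + b)).card) = b := by simp
    rw [← this]
    apply card_bij (fun v _ => (σ.symm v : ℕ))
    · intro v hv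
      have h := Fin.ext_iff.1 (mem_filter.1 hv).2
      simp only [c] at h
      rw [Nat.div_eq_iff hb] at h
      rw [mem_Ico]
      omega
    · intro v _ v' _ h
      exact σ.symm.injective (Fin.ext h)
    · intro j hj
      rw [mem_Ico] at hj
      refine ⟨σ ⟨j, by omega⟩, ?_, by simp⟩
      simp only [mem_filter, mem_univ, true_and, c, Fin.ext_iff, Equiv.symm_apply_apply]
      rw [Nat.div_eq_iff hb]
      omega
  set X : Finset (Fin N) := univ.filter fun v => ∀ v', c v' = c v → lab v' = lab v with hX
  refine ⟨c, X, hcard, ?_, ?_⟩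
  · intro v hv v' hv'
    rw [hX, mem_filter] at hv
    refine ⟨?_, hv.2 v' hv'⟩
    rw [hX, mem_filter]
    refine ⟨mem_univ _, fun v'' h'' => ?_⟩
    rw [hv.2 v' hv', hv.2 v'' (h''.trans hv')]
  · set I := Xᶜ.image c with hI
    have h1 : Xᶜ.card ≤ I.card * b := by
      rw [mul_comm]
      refine card_le_mul_card_image (f := c) _ _ fun i _ => ?_
      rw [← hcard i]
      exact card_le_card (filter_subset_filter _ (subset_univ _))
    have h2 : I.card ≤ Fintype.card A := by
      -- send a mixed block to its smallest label
      have hmin : ∀ i ∈ I, ∃ v, c v = i ∧ (∀ v', c v' = i → rk (lab v) ≤ rk (lab v')) ∧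
          ∃ v', c v' = i ∧ rk (lab v) < rk (lab v') := by
        intro i hi
        obtain ⟨u, hu, rfl⟩ := mem_image.1 hi
        obtain ⟨v, hv, hvm⟩ := exists_min_image (univ.filter fun v => c v = c u)
          (fun v => rk (lab v)) ⟨u, by simp⟩
        refine ⟨v, (mem_filter.1 hv).2, fun v' hv' => hvm v' (by simp [hv']), ?_⟩
        by_contra! hcon
        rw [mem_compl, hX, mem_filter] at hu
        apply hu
        refine ⟨mem_univ _, fun v' hv' => ?_⟩
        have e1 := le_antisymm (hcon v' hv') (hvm v' (by simp [hv']))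
        have e2 := le_antisymm (hcon u rfl) (hvm u (by simp))
        exact rk.injective (e1.trans e2.symm)
      rcases I.eq_empty_or_nonempty with h0 | ⟨i₀, hi₀⟩
      · rw [h0, card_empty]; exact Nat.zero_le _
      have : Nonempty (Fin N) := ⟨(hmin i₀ hi₀).choose⟩
      choose! f hf1 hf2 hf3 using hmin
      rw [← card_univ]
      refine card_le_card_of_injOn (fun i => lab (f i)) (fun _ _ => mem_univ _) ?_
      have haux : ∀ i ∈ I, ∀ j ∈ I, i < j → rk (lab (f i)) < rk (lab (f j)) := by
        intro i hi j hj hij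
        obtain ⟨v', hv', hlt⟩ := hf3 i hi
        refine hlt.trans_le (hmono _ _ ?_)
        by_contra! hc'
        have h3 : (σ.symm (f j) : ℕ) / b ≤ (σ.symm v' : ℕ) / b :=
          Nat.div_le_div_right (Fin.le_def.1 hc'.le)
        have h4 : c (f j) ≤ c v' := Fin.le_def.2 h3
        rw [hf1 j hj, hv'] at h4
        exact absurd hij (not_lt.2 h4)
      intro i hi j hj hij
      simp only at hij
      by_contra hne
      rcases lt_or_gt_of_ne hne with h | h
      · have := haux i hi j hj h; rw [hij] at this; exact lt_irrefl _ this
      · have := haux j hj i hi h; rw [hij] at this; exact lt_irrefl _ this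
    exact h1.trans (Nat.mul_le_mul_right _ h2)

/-- The tuple `τ` of classes of `c` is hereditarily dense: all of its large subtuples contain at
least the proportion `d / 2` of tuples from `Edg`. -/
def HeredDense {N q : ℕ} {J : Type*} [Fintype J] [DecidableEq J] (Edg : Finset (J → Fin N))
    (c : Fin N → Fin q) (u d : ℝ) (τ : J → Fin q) : Prop :=
  ∀ U : J → Finset (Fin N), (∀ j, ∀ v ∈ U j, c v = τ j) → (∀ j, u ≤ (U j).card) →
    d / 2 * ∏ j, ((U j).card : ℝ) ≤ (Edg.filter fun f => ∀ j, f j ∈ U j).card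

theorem sum_indicator_density {T : Type*} [DecidableEq T] (Edg S : Finset T) (d : ℝ) :
    ∑ f ∈ S, (if f ∈ Edg then 1 - 1 / d else 1) = S.card - (Edg.filter fun f => f ∈ S).card / d := by
  have h : ∀ f ∈ S, (if f ∈ Edg then 1 - 1 / d else 1) = 1 - (if f ∈ Edg then 1 else 0) / d := by
    intro f _
    split_ifs <;> ring
  rw [sum_congr rfl h, sum_sub_distrib, ← sum_div, sum_boole, filter_mem_eq_inter,
    filter_mem_eq_inter, inter_comm]
  simp

theorem exists_refinement_improving {N q b : ℕ} {J : Type*} [Fintype J] [DecidableEq J]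
    (hNqb : N = q * b) (Edg : Finset (J → Fin N)) (c : Fin N → Fin q)
    (hc : ∀ i, (univ.filter fun v => c v = i).card = b) (ε d β : ℝ) (hε : 0 < ε)
    (hd : 0 < d) (F : Finset (J → Fin N))
    (hF : ∀ f ∈ F, ∀ f', c ∘ f' = c ∘ f → f' ∈ F)
    (Bd : Finset (J → Fin N)) (hBd : Bd ⊆ Edg)
    (hBd' : ∀ f ∈ Bd, ¬ HeredDense Edg c (ε * b) d (c ∘ f))
    (hbad : (β + d) * (N : ℝ) ^ Fintype.card J < Bd.card) :
    ∃ (lab : Fin N → Fin q × ((J → Fin q) × J → Bool)) (F' : Finset (J → Fin N)),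
      (∀ f ∈ F', ∀ f', lab ∘ f' = lab ∘ f → f' ∈ F') ∧
      ∑ f ∈ F, (if f ∈ Edg then 1 - 1 / d else 1) +
        ε ^ Fintype.card J * β / 2 * (N : ℝ) ^ Fintype.card J ≤
        ∑ f ∈ F', (if f ∈ Edg then 1 - 1 / d else 1) := by
  classical
  set k := Fintype.card J with hk
  set cl : (J → Fin q) → Finset (J → Fin N) := fun τ => univ.filter fun f => c ∘ f = τ with hcl
  have hclc : ∀ τ, (cl τ).card = b ^ k := by
    intro τ
    have : cl τ = Fintype.piFinset fun j => univ.filter fun v => c v = τ j := by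
      ext f
      simp [hcl, Fintype.mem_piFinset, funext_iff]
    rw [this, Fintype.card_piFinset]
    simp [hc, hk]
  set bad : (J → Fin q) → Prop := fun τ => ¬ HeredDense Edg c (ε * b) d τ ∧
    d * (b : ℝ) ^ k ≤ (Edg.filter fun f => f ∈ cl τ).card with hbaddef
  have hU : ∀ τ, bad τ → ∃ U : J → Finset (Fin N), (∀ j, ∀ v ∈ U j, c v = τ j) ∧
      (∀ j, ε * b ≤ (U j).card) ∧
      ((Edg.filter fun f => ∀ j, f j ∈ U j).card : ℝ) < d / 2 * ∏ j, ((U j).card : ℝ) := by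
    intro τ hτ
    have := hτ.1
    unfold HeredDense at this
    push Not at this
    exact this
  choose! U hU1 hU2 hU3 using hU
  let lab : Fin N → Fin q × ((J → Fin q) × J → Bool) :=
    fun v => (c v, fun p => decide (v ∈ U p.1 p.2))
  set F' : Finset (J → Fin N) := univ.filter fun f =>
    (¬ bad (c ∘ f) ∧ f ∈ F) ∨ (bad (c ∘ f) ∧ ∀ j, f j ∈ U (c ∘ f) j) with hF'
  set g : (J → Fin N) → ℝ := fun f => if f ∈ Edg then 1 - 1 / d else 1 with hg
  refine ⟨lab, F', ?_, ?_⟩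
  · intro f hf f' hff
    have h1 : c ∘ f' = c ∘ f := by
      funext j
      exact congrArg Prod.fst (congrFun hff j)
    have h2 : ∀ τ j j', f' j ∈ U τ j' ↔ f j ∈ U τ j' := by
      intro τ j j'
      have := congrFun (congrArg Prod.snd (congrFun hff j)) (τ, j')
      simpa [lab] using this
    rw [hF', mem_filter] at hf ⊢
    refine ⟨mem_univ _, ?_⟩
    rw [h1]
    rcases hf.2 with h | h
    · exact Or.inl ⟨h.1, hF f h.2 f' h1⟩
    · exact Or.inr ⟨h.1, fun j => (h2 _ _ _).2 (h.2 j)⟩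
  · have hfib : ∀ S : Finset (J → Fin N), ∑ f ∈ S, g f =
        ∑ τ, ∑ f ∈ S.filter (fun f => c ∘ f = τ), g f := fun S =>
      (sum_fiberwise_of_maps_to (fun _ _ => mem_univ _) _).symm
    -- the number of bad classes
    have hnum : β * (N : ℝ) ^ k ≤ ((univ.filter bad).card : ℝ) * (b : ℝ) ^ k := by
      have h1 : Bd ⊆
          ((univ.filter bad).biUnion cl) ∪
            (univ.filter fun τ => ¬ d * (b : ℝ) ^ k ≤ (Edg.filter fun f => f ∈ cl τ).card).biUnion
              fun τ => Edg.filter fun f => f ∈ cl τ := by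
        intro f hf
        rw [mem_union, mem_biUnion, mem_biUnion]
        have hfc : f ∈ cl (c ∘ f) := by simp [hcl]
        by_cases h : d * (b : ℝ) ^ k ≤ (Edg.filter fun f' => f' ∈ cl (c ∘ f)).card
        · exact Or.inl ⟨c ∘ f, mem_filter.2 ⟨mem_univ _, hBd' f hf, h⟩, hfc⟩
        · exact Or.inr ⟨c ∘ f, mem_filter.2 ⟨mem_univ _, h⟩, mem_filter.2 ⟨hBd hf, hfc⟩⟩
      have h2 := (card_le_card h1).trans (card_union_le _ _)
      have h3 : ((univ.filter bad).biUnion cl).card ≤ (univ.filter bad).card * b ^ k :=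
        card_biUnion_le_card_mul _ _ _ fun τ _ => (hclc τ).le
      have h4 : (((univ.filter fun τ =>
          ¬ d * (b : ℝ) ^ k ≤ (Edg.filter fun f => f ∈ cl τ).card).biUnion
              fun τ => Edg.filter fun f => f ∈ cl τ).card : ℝ) ≤ d * (N : ℝ) ^ k := by
        calc _ ≤ ∑ τ ∈ univ.filter fun τ =>
              ¬ d * (b : ℝ) ^ k ≤ (Edg.filter fun f => f ∈ cl τ).card,
                ((Edg.filter fun f => f ∈ cl τ).card : ℝ) := by exact_mod_cast card_biUnion_le
          _ ≤ ∑ τ ∈ univ.filter fun τ =>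
              ¬ d * (b : ℝ) ^ k ≤ (Edg.filter fun f => f ∈ cl τ).card, d * (b : ℝ) ^ k :=
              sum_le_sum fun τ hτ => (not_le.1 (mem_filter.1 hτ).2).le
          _ ≤ ∑ τ : J → Fin q, d * (b : ℝ) ^ k :=
              sum_le_sum_of_subset_of_nonneg (subset_univ _) fun _ _ _ => by positivity
          _ = d * (N : ℝ) ^ k := by
              rw [sum_const, card_univ, Fintype.card_fun, Fintype.card_fin, nsmul_eq_mul, hNqb]
              push_cast
              rw [mul_pow]
              ring
      have h2' : (Bd.card : ℝ) ≤
          ((univ.filter bad).card : ℝ) * (b : ℝ) ^ k +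
          ((univ.filter fun τ =>
          ¬ d * (b : ℝ) ^ k ≤ (Edg.filter fun f => f ∈ cl τ).card).biUnion
              fun τ => Edg.filter fun f => f ∈ cl τ).card := by
        exact_mod_cast h2.trans (Nat.add_le_add_right h3 _)
      linarith
    have hstep : ∀ τ, (∑ f ∈ F.filter (fun f => c ∘ f = τ), g f) +
        (if bad τ then ε ^ k / 2 * (b : ℝ) ^ k else 0) ≤
          ∑ f ∈ F'.filter (fun f => c ∘ f = τ), g f := by
      intro τ
      split_ifs with hτ
      · have h1 : ∑ f ∈ F.filter (fun f => c ∘ f = τ), g f ≤ 0 := by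
          by_cases hne : ∃ f ∈ F, c ∘ f = τ
          · obtain ⟨f, hf, hfτ⟩ := hne
            have : F.filter (fun f => c ∘ f = τ) = cl τ := by
              ext f'
              simp only [mem_filter, hcl, mem_univ, true_and, and_iff_right_iff_imp]
              intro h
              exact hF f hf f' (h.trans hfτ.symm)
            rw [this, sum_indicator_density, hclc, sub_nonpos, le_div_iff₀ hd]
            have := hτ.2
            push_cast
            linarith
          · rw [filter_eq_empty_iff.2 fun f hf h => hne ⟨f, hf, h⟩, sum_empty]
        have h2 : F'.filter (fun f => c ∘ f = τ) = Fintype.piFinset (U τ) := by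
          ext f
          rw [mem_filter, hF', mem_filter, Fintype.mem_piFinset]
          constructor
          · rintro ⟨⟨_, h | h⟩, rfl⟩
            · exact absurd hτ h.1
            · exact h.2
          · intro h
            have hcf : c ∘ f = τ := funext fun j => hU1 τ hτ j _ (h j)
            rw [hcf]
            exact ⟨⟨mem_univ _, Or.inr ⟨hτ, h⟩⟩, rfl⟩
        have h3 : (ε * b) ^ k ≤ ∏ j, ((U τ j).card : ℝ) := by
          rw [hk, ← card_univ, ← prod_const]
          exact prod_le_prod (fun _ _ => by positivity) fun j _ => hU2 τ hτ j
        have h4 := hU3 τ hτ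
        rw [h2]
        refine le_trans ?_ (sum_indicator_density Edg (Fintype.piFinset (U τ)) d).ge
        rw [Fintype.card_piFinset]
        simp only [Fintype.mem_piFinset]
        have h5 : ((Edg.filter fun f => ∀ j, f j ∈ U τ j).card : ℝ) / d ≤
            1 / 2 * ∏ j, ((U τ j).card : ℝ) := by
          rw [div_le_iff₀ hd]; linarith
        push_cast
        rw [mul_pow] at h3
        linarith
      · have : F'.filter (fun f => c ∘ f = τ) = F.filter (fun f => c ∘ f = τ) := by
          ext f
          rw [mem_filter, hF', mem_filter, mem_filter]
          constructor
          · rintro ⟨⟨_, h | h⟩, rfl⟩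
            · exact ⟨h.2, rfl⟩
            · exact absurd h.1 hτ
          · rintro ⟨h, rfl⟩
            exact ⟨⟨mem_univ _, Or.inl ⟨hτ, h⟩⟩, rfl⟩
        rw [this, add_zero]
    have hsum := sum_le_sum fun τ (_ : τ ∈ (univ : Finset (J → Fin q))) => hstep τ
    rw [sum_add_distrib, ← hfib, ← hfib, ← sum_filter, sum_const, nsmul_eq_mul] at hsum
    have h6 : ε ^ k * β / 2 * (N : ℝ) ^ k ≤
        ((univ.filter bad).card : ℝ) * (ε ^ k / 2 * (b : ℝ) ^ k) := by
      have : 0 ≤ ε ^ k / 2 := by positivity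
      have := mul_le_mul_of_nonneg_left hnum this
      linarith
    linarith

/-- The number of tuples whose coordinate at `j` is constrained to a set `S`. -/
theorem card_tuples_coord_mul {N : ℕ} {J : Type*} [Fintype J] [DecidableEq J] (S : Finset (Fin N))
    (j : J) :
    (univ.filter fun f : J → Fin N => f j ∈ S).card * N = S.card * N ^ Fintype.card J := by
  have h : (univ.filter fun f : J → Fin N => f j ∈ S) =
      Fintype.piFinset (Function.update (fun _ => univ) j S) := by
    ext f
    rw [mem_filter, Fintype.mem_piFinset]
    constructor
    · rintro ⟨_, h⟩ i
      rcases eq_or_ne i j with rfl | hi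
      · simpa using h
      · simp [hi]
    · intro h
      have := h j
      simpa using this
  have h2 : ∏ i, (Function.update (fun _ => (univ : Finset (Fin N))) j S i).card =
      S.card * N ^ (Fintype.card J - 1) := by
    rw [← mul_prod_erase univ _ (mem_univ j), Function.update_self]
    congr 1
    rw [prod_congr rfl (g := fun _ => N), prod_const, card_erase_of_mem (mem_univ j), card_univ]
    intro i hi
    rw [Function.update_of_ne (ne_of_mem_erase hi), card_univ, Fintype.card_fin]
  have h3 : 0 < Fintype.card J := Fintype.card_pos_iff.2 ⟨j⟩
  rw [h, Fintype.card_piFinset, h2, mul_assoc, ← pow_succ, Nat.sub_add_cancel h3]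

theorem card_tuples_leaving_mul_le {N : ℕ} {J : Type*} [Fintype J] [DecidableEq J]
    (X : Finset (Fin N)) :
    (univ.filter fun f : J → Fin N => ¬ ∀ j, f j ∈ X).card * N ≤
      Fintype.card J * (Xᶜ.card * N ^ Fintype.card J) := by
  have h : (univ.filter fun f : J → Fin N => ¬ ∀ j, f j ∈ X) ⊆
      univ.biUnion fun j => univ.filter fun f : J → Fin N => f j ∈ Xᶜ := by
    intro f hf
    rw [mem_filter] at hf
    push Not at hf
    obtain ⟨-, j, hj⟩ := hf
    simpa using ⟨j, hj⟩
  calc _ ≤ (∑ j, (univ.filter fun f : J → Fin N => f j ∈ Xᶜ).card) * N :=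
        Nat.mul_le_mul_right _ ((card_le_card h).trans card_biUnion_le)
    _ = _ := by
        rw [sum_mul, sum_congr rfl fun j _ => card_tuples_coord_mul Xᶜ j, sum_const, card_univ,
          smul_eq_mul]

theorem exists_regular_equipartition_aux {J : Type*} [Fintype J] [DecidableEq J] (ε d β δ : ℝ)
    (hε : 0 < ε) (hd : 0 < d) (hβ : 0 < β) (hδ : δ = ε ^ Fintype.card J * β / 4) (s : ℕ) :
    ∀ q : ℕ, 0 < q → ∃ Q M : ℕ, 0 < M ∧ ∀ N : ℕ, 0 < N → M ∣ N → ∀ Edg : Finset (J → Fin N),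
      ∀ (b : ℕ) (c : Fin N → Fin q) (F : Finset (J → Fin N)), N = q * b →
      (∀ i, (univ.filter fun v => c v = i).card = b) →
      (∀ f ∈ F, ∀ f', c ∘ f' = c ∘ f → f' ∈ F) →
      (1 - s * δ) * (N : ℝ) ^ Fintype.card J ≤ ∑ f ∈ F, (if f ∈ Edg then 1 - 1 / d else 1) →
      ∃ (q b : ℕ) (c : Fin N → Fin q), 0 < q ∧ q ≤ Q ∧ N = q * b ∧
        (∀ i, (univ.filter fun v => c v = i).card = b) ∧
        ∀ Bd ⊆ Edg, (∀ f ∈ Bd, ¬ HeredDense Edg c (ε * b) d (c ∘ f)) →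
          (Bd.card : ℝ) ≤ (β + d) * (N : ℝ) ^ Fintype.card J := by
  classical
  have hδ0 : 0 < δ := by rw [hδ]; positivity
  induction s with
  | zero =>
    intro q hq
    refine ⟨q, 1, one_pos, fun N hN _ Edg b c F hNqb hc hF hsum => ?_⟩
    refine ⟨q, b, c, hq, le_rfl, hNqb, hc, fun Bd hBd hBd' => ?_⟩
    by_contra! hcon
    obtain ⟨lab, F', -, hF'⟩ :=
      exists_refinement_improving hNqb Edg c hc ε d β hε hd F hF Bd hBd hBd' hcon
    have h1 : ∑ f ∈ F', (if f ∈ Edg then 1 - 1 / d else 1) ≤ (N : ℝ) ^ Fintype.card J := by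
      rw [sum_indicator_density]
      have h2 : ((F'.card : ℕ) : ℝ) ≤ (N : ℝ) ^ Fintype.card J := by
        have := card_le_univ F'
        rw [Fintype.card_fun, Fintype.card_fin] at this
        exact_mod_cast this
      have h3 : 0 ≤ ((Edg.filter fun f => f ∈ F').card : ℝ) / d := by positivity
      linarith
    have h4 : 0 < δ * (N : ℝ) ^ Fintype.card J := by positivity
    rw [hδ] at h4
    push_cast at hsum
    linarith
  | succ s ih =>
    intro q hq
    set A := Fin q × ((J → Fin q) × J → Bool) with hA
    obtain ⟨t, ht⟩ := exists_nat_gt ((Fintype.card J * Fintype.card A : ℝ) / δ)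
    have ht0 : 0 < t := by
      have : (0 : ℝ) < t := lt_of_le_of_lt (by positivity) ht
      exact_mod_cast this
    obtain ⟨Q, M, hM, ih⟩ := ih t ht0
    refine ⟨max q Q, t * M, by positivity, fun N hN hMN Edg b c F hNqb hc hF hsum => ?_⟩
    by_cases hconc : ∀ Bd ⊆ Edg, (∀ f ∈ Bd, ¬ HeredDense Edg c (ε * b) d (c ∘ f)) →
          (Bd.card : ℝ) ≤ (β + d) * (N : ℝ) ^ Fintype.card J
    · exact ⟨q, b, c, hq, le_max_left _ _, hNqb, hc, hconc⟩
    push Not at hconc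
    obtain ⟨Bd, hBd, hBd', hcon⟩ := hconc
    obtain ⟨lab, F', hlab, hF'⟩ :=
      exists_refinement_improving hNqb Edg c hc ε d β hε hd F hF Bd hBd hBd' hcon
    obtain ⟨b', hb'⟩ := (Dvd.intro _ rfl : t ∣ t * M).trans hMN
    have hb'0 : 0 < b' := by
      rcases Nat.eq_zero_or_pos b' with h | h
      · simp [h] at hb'; omega
      · exact h
    obtain ⟨c', X, hc', hX, hXc⟩ := exists_equipartition_refining lab t b' hb'0 hb'
    have hfin := ih N hN ((Dvd.intro_left _ rfl : M ∣ t * M).trans hMN) Edg b' c'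
      (F'.filter fun f => ∀ j, f j ∈ X) hb' hc' ?_ ?_
    · obtain ⟨q₁, b₁, c₁, h1, h2, h3⟩ := hfin
      exact ⟨q₁, b₁, c₁, h1, h2.trans (le_max_right _ _), h3⟩
    · intro f hf f' hff
      rw [mem_filter] at hf ⊢
      have h := fun j => hX (f j) (hf.2 j) (f' j) (congrFun hff j)
      exact ⟨hlab f hf.1 f' (funext fun j => (h j).2), fun j => (h j).1⟩
    · have h1 : ∑ f ∈ F', (if f ∈ Edg then 1 - 1 / d else 1) ≤
          ∑ f ∈ F'.filter (fun f => ∀ j, f j ∈ X), (if f ∈ Edg then 1 - 1 / d else 1) +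
            (univ.filter fun f : J → Fin N => ¬ ∀ j, f j ∈ X).card := by
        rw [← sum_filter_add_sum_filter_not F' (fun f => ∀ j, f j ∈ X)]
        refine add_le_add_right ?_ _
        rw [sum_indicator_density]
        have h2 : (F'.filter fun f => ¬ ∀ j, f j ∈ X).card ≤
            (univ.filter fun f : J → Fin N => ¬ ∀ j, f j ∈ X).card :=
          card_le_card (filter_subset_filter _ (subset_univ _))
        have h3 : 0 ≤ ((Edg.filter fun f => f ∈ F'.filter fun f => ¬ ∀ j, f j ∈ X).card : ℝ) / d := by
          positivity
        have h2' : ((F'.filter fun f => ¬ ∀ j, f j ∈ X).card : ℝ) ≤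
            (univ.filter fun f : J → Fin N => ¬ ∀ j, f j ∈ X).card := by exact_mod_cast h2
        linarith
      have hN' : (0 : ℝ) < N := by exact_mod_cast hN
      have h4 : ((univ.filter fun f : J → Fin N => ¬ ∀ j, f j ∈ X).card : ℝ) ≤
          δ * (N : ℝ) ^ Fintype.card J := by
        have h5 := card_tuples_leaving_mul_le (J := J) X
        have h6 : ((univ.filter fun f : J → Fin N => ¬ ∀ j, f j ∈ X).card : ℝ) * N ≤
            Fintype.card J * (Xᶜ.card * (N : ℝ) ^ Fintype.card J) := by exact_mod_cast h5
        have h7 : (Xᶜ.card : ℝ) ≤ Fintype.card A * b' := by exact_mod_cast hXc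
        rw [div_lt_iff₀ hδ0] at ht
        have hNt : (N : ℝ) = t * b' := by exact_mod_cast hb'
        have h8 : (Fintype.card J : ℝ) * Xᶜ.card ≤ δ * N := by
          have hb'' : (0 : ℝ) ≤ b' := Nat.cast_nonneg _
          calc (Fintype.card J : ℝ) * Xᶜ.card ≤ Fintype.card J * (Fintype.card A * b') := by gcongr
            _ = (Fintype.card J * Fintype.card A) * b' := by ring
            _ ≤ (t * δ) * b' := by gcongr
            _ = δ * N := by rw [hNt]; ring
        refine le_of_mul_le_mul_right (h6.trans ?_) hN'
        calc (Fintype.card J : ℝ) * (Xᶜ.card * (N : ℝ) ^ Fintype.card J)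
            = (Fintype.card J * Xᶜ.card) * (N : ℝ) ^ Fintype.card J := by ring
          _ ≤ (δ * N) * (N : ℝ) ^ Fintype.card J := by gcongr
          _ = _ := by ring
      have h9 : ε ^ Fintype.card J * β / 2 = 2 * δ := by rw [hδ]; ring
      rw [h9] at hF'
      push_cast at hsum
      linarith

/-- A weak regularity lemma for dense subtuples: after an equipartition into boundedly many
blocks, all but few tuples of `Edg` lie in a hereditarily dense tuple of blocks. -/
theorem exists_regular_equipartition (J : Type*) [Fintype J] [DecidableEq J] (ε d β : ℝ)
    (hε : 0 < ε) (hd : 0 < d) (hβ : 0 < β) :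
    ∃ Q M : ℕ, 0 < M ∧ ∀ N : ℕ, 0 < N → M ∣ N → ∀ Edg : Finset (J → Fin N),
      ∃ (q b : ℕ) (c : Fin N → Fin q), 0 < q ∧ q ≤ Q ∧ N = q * b ∧
        (∀ i, (univ.filter fun v => c v = i).card = b) ∧
        ∀ Bd ⊆ Edg, (∀ f ∈ Bd, ¬ HeredDense Edg c (ε * b) d (c ∘ f)) →
          (Bd.card : ℝ) ≤ (β + d) * (N : ℝ) ^ Fintype.card J := by
  set δ := ε ^ Fintype.card J * β / 4 with hδ
  have hδ0 : 0 < δ := by positivity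
  obtain ⟨s, hs⟩ := exists_nat_gt (1 / δ)
  obtain ⟨Q, M, hM, h⟩ := exists_regular_equipartition_aux ε d β δ hε hd hβ hδ s 1 one_pos
  refine ⟨Q, M, hM, fun N hN hMN Edg => ?_⟩
  refine h N hN hMN Edg N (fun _ => 0) ∅ (one_mul N).symm (fun i => ?_) (by simp) ?_
  · rw [Subsingleton.elim i 0]; simp
  · rw [sum_empty]
    rw [div_lt_iff₀ hδ0] at hs
    exact mul_nonpos_of_nonpos_of_nonneg (by linarith) (by positivity)

/-- A finite set which is large compared with its images under two maps contains a nonempty subset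
in which all nonempty fibres of both maps are large. -/
theorem exists_subset_fibers_large {T A B : Type*} [DecidableEq T] [DecidableEq A] [DecidableEq B]
    (F : Finset T) (π₁ : T → A) (π₂ : T → B) (t : ℝ)
    (h : t * ((F.image π₁).card + (F.image π₂).card) < F.card) :
    ∃ F' ⊆ F, F'.Nonempty ∧ ∀ f ∈ F', t ≤ (F'.filter fun f' => π₁ f' = π₁ f).card ∧
      t ≤ (F'.filter fun f' => π₂ f' = π₂ f).card := by
  rcases le_or_gt t 0 with ht | ht
  · rcases F.eq_empty_or_nonempty with rfl | hF
    · simp at h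
    · exact ⟨F, subset_rfl, hF, fun f _ => ⟨ht.trans (Nat.cast_nonneg _), ht.trans (Nat.cast_nonneg _)⟩⟩
  let val : Finset T → ℝ := fun S => S.card - t * ((S.image π₁).card + (S.image π₂).card)
  obtain ⟨F', hF', hmax⟩ := exists_max_image F.powerset val ⟨F, mem_powerset_self F⟩
  rw [mem_powerset] at hF'
  have h0 : 0 < val F' := lt_of_lt_of_le (by simp only [val]; linarith) (hmax F (mem_powerset_self F))
  have key : ∀ R ⊆ F', R.Nonempty →
      ((F' \ R).image π₁).card + ((F' \ R).image π₂).card + 1 ≤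
        (F'.image π₁).card + (F'.image π₂).card → t ≤ R.card := by
    intro R hR _ hdrop
    have h1 := hmax (F' \ R) (mem_powerset.2 (sdiff_subset.trans hF'))
    simp only [val] at h1
    rw [cast_card_sdiff hR] at h1
    have h2 : (((F' \ R).image π₁).card : ℝ) + ((F' \ R).image π₂).card + 1 ≤
        (F'.image π₁).card + (F'.image π₂).card := by exact_mod_cast hdrop
    nlinarith
  refine ⟨F', hF', ?_, fun f hf => ⟨?_, ?_⟩⟩
  · rw [nonempty_iff_ne_empty]
    rintro rfl
    simp [val] at h0
  · refine key _ (filter_subset _ _) ⟨f, by simp [hf]⟩ ?_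
    have h1 : (F' \ F'.filter fun f' => π₁ f' = π₁ f).image π₁ ⊂ F'.image π₁ := by
      refine Finset.ssubset_iff_subset_ne.2 ⟨image_subset_image sdiff_subset, fun he => ?_⟩
      have : π₁ f ∈ F'.image π₁ := mem_image_of_mem _ hf
      rw [← he] at this
      obtain ⟨x, hx, hxf⟩ := mem_image.1 this
      rw [mem_sdiff, mem_filter] at hx
      exact hx.2 ⟨hx.1, hxf⟩
    have h2 := card_lt_card h1
    have h3 := card_le_card (image_subset_image (f := π₂)
      (sdiff_subset : F' \ (F'.filter fun f' => π₁ f' = π₁ f) ⊆ F'))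
    omega
  · refine key _ (filter_subset _ _) ⟨f, by simp [hf]⟩ ?_
    have h1 : (F' \ F'.filter fun f' => π₂ f' = π₂ f).image π₂ ⊂ F'.image π₂ := by
      refine Finset.ssubset_iff_subset_ne.2 ⟨image_subset_image sdiff_subset, fun he => ?_⟩
      have : π₂ f ∈ F'.image π₂ := mem_image_of_mem _ hf
      rw [← he] at this
      obtain ⟨x, hx, hxf⟩ := mem_image.1 this
      rw [mem_sdiff, mem_filter] at hx
      exact hx.2 ⟨hx.1, hxf⟩
    have h2 := card_lt_card h1
    have h3 := card_le_card (image_subset_image (f := π₁)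
      (sdiff_subset : F' \ (F'.filter fun f' => π₂ f' = π₂ f) ⊆ F'))
    omega

theorem exists_tuple_avoiding {V J : Type*} [DecidableEq V] [Fintype J] [DecidableEq J]
    (K : Finset J) (U : J → Finset V) (u : ℕ) (hU : ∀ j, (U j).card ≤ u) (G : Finset (J → V))
    (hGU : ∀ f ∈ G, ∀ j, f j ∈ U j) (a : J → V) (hG : ∀ f ∈ G, ∀ j, j ∉ K → f j = a j)
    (W : Finset V) (hcard : K.card * (W.card * u ^ (K.card - 1)) < G.card) :
    ∃ f ∈ G, ∀ j ∈ K, f j ∉ W := by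
  by_contra! hcon
  refine absurd hcard (not_lt.2 ?_)
  have hsub : G ⊆ K.biUnion fun i => Fintype.piFinset fun j =>
      if j = i then W else if j ∈ K then U j else {a j} := by
    intro f hf
    obtain ⟨i, hi, hiW⟩ := hcon f hf
    rw [mem_biUnion]
    refine ⟨i, hi, Fintype.mem_piFinset.2 fun j => ?_⟩
    split_ifs with h1 h2
    · rwa [h1]
    · exact hGU f hf j
    · exact mem_singleton.2 (hG f hf j h2)
  refine (card_le_card hsub).trans (card_biUnion_le_card_mul _ _ _ fun i hi => ?_)
  rw [Fintype.card_piFinset]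
  have h1 : ∏ j, (if j = i then W else if j ∈ K then U j else {a j}).card =
      ∏ j ∈ K, (if j = i then W else if j ∈ K then U j else {a j}).card := by
    symm
    refine prod_subset (subset_univ _) fun j _ hj => ?_
    rw [if_neg (fun h : j = i => hj (h ▸ hi)), if_neg hj, card_singleton]
  rw [h1, ← mul_prod_erase K _ hi, if_pos rfl, ← card_erase_of_mem hi]
  refine Nat.mul_le_mul_left _ (prod_le_pow_card _ _ _ fun j hj => ?_)
  rw [if_neg (ne_of_mem_erase hj), if_pos (mem_of_mem_erase hj)]
  exact hU j

/-- `vs` is the vertex list of an `l`-path with `p` edges, where `p = 0` is allowed. -/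
def IsPathWithEdges {N : ℕ} (k l : ℕ) (E : Finset (Finset (Fin N))) (p : ℕ) (vs : List (Fin N)) :
    Prop :=
  vs.Nodup ∧ vs.length = p * (k - l) + l ∧
    ∀ i : ℕ, i * (k - l) + k ≤ vs.length →
      ((vs.drop (i * (k - l))).take k).toFinset ∈ E

theorem IsPathWithEdges.append {N k l : ℕ} {E : Finset (Finset (Fin N))} {p : ℕ}
    (hlk : l < k) {pre a w : List (Fin N)} (h : IsPathWithEdges k l E p (pre ++ a))
    (ha : a.length = l) (hw : w.length = k - l) (hnd : w.Nodup)
    (hdisj : ∀ v ∈ w, v ∉ pre ++ a) (hedge : (a ++ w).toFinset ∈ E) :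
    IsPathWithEdges k l E (p + 1) ((pre ++ a) ++ w) := by
  obtain ⟨h1, h2, h3⟩ := h
  refine ⟨List.Nodup.append h1 hnd fun v hv hv' => hdisj v hv' hv, ?_, ?_⟩
  · rw [List.length_append, h2, hw]; ring
  · intro i hi
    have hpre : pre.length = p * (k - l) := by
      rw [List.length_append] at h2; omega
    rw [List.length_append, h2, hw] at hi
    have hip : i ≤ p := by
      have h4 : (i + 1) * (k - l) ≤ (p + 1) * (k - l) := by
        rw [Nat.add_mul, Nat.add_mul]; omega
      have := Nat.le_of_mul_le_mul_right h4 (by omega)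
      omega
    rcases hip.lt_or_eq with hlt | rfl
    · have h5 : (i + 1) * (k - l) ≤ p * (k - l) := Nat.mul_le_mul_right _ hlt
      rw [Nat.add_mul] at h5
      have h6 : i * (k - l) + k ≤ (pre ++ a).length := by rw [h2]; omega
      rw [List.drop_append_of_le_length (by omega), List.take_append_of_le_length]
      · exact h3 i h6
      · rw [List.length_drop]; omega
    · rw [List.append_assoc, ← hpre, List.drop_left, List.take_of_length_le]
      · exact hedge
      · rw [List.length_append]; omega

/-- Prolonging a path by one edge which is the image of a tuple from `F`. -/
theorem exists_path_step {N k l : ℕ} {J : Type*} [Fintype J] [DecidableEq J]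
    (hJ : Fintype.card J = k) (hlk : l < k) (E : Finset (Finset (Fin N))) (hE : ∀ e ∈ E, e.card = k)
    (F : Finset (J → Fin N)) (hFE : ∀ f ∈ F, univ.image f ∈ E) (U : J → Finset (Fin N)) (u : ℕ)
    (hU : ∀ j, (U j).card ≤ u) (hFU : ∀ f ∈ F, ∀ j, f j ∈ U j)
    (la ln : List J) (hnd : (la ++ ln).Nodup) (hall : ∀ j, j ∈ la ++ ln) (hla : la.length = l)
    (p : ℕ) (pre : List (Fin N)) (f : J → Fin N)
    (hp : IsPathWithEdges k l E p (pre ++ la.map f))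
    (hlarge : (k - l) * ((p * (k - l) + l) * u ^ (k - l - 1)) <
      (F.filter fun f' => ∀ j ∈ la, f' j = f j).card) :
    ∃ f' ∈ F, la.map f' = la.map f ∧
      IsPathWithEdges k l E (p + 1) ((pre ++ la.map f) ++ ln.map f') := by
  have hln : ln.length = k - l := by
    have h1 : (la ++ ln).toFinset = univ := eq_univ_of_forall fun j => List.mem_toFinset.2 (hall j)
    have h2 := List.toFinset_card_of_nodup hnd
    rw [h1, card_univ, hJ, List.length_append] at h2
    omega
  have hnd' := List.nodup_append.1 hnd
  have hK : ln.toFinset.card = k - l := by rw [List.toFinset_card_of_nodup hnd'.2.1, hln]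
  have hW : (pre ++ la.map f).toFinset.card = p * (k - l) + l := by
    rw [List.toFinset_card_of_nodup hp.1, hp.2.1]
  obtain ⟨f', hf', hav⟩ := exists_tuple_avoiding ln.toFinset U u hU
    (F.filter fun f' => ∀ j ∈ la, f' j = f j) (fun g hg => hFU g (mem_filter.1 hg).1) f
    (fun g hg j hj => (mem_filter.1 hg).2 j (by
      have := hall j
      rw [List.mem_append] at this
      rw [List.mem_toFinset] at hj
      tauto)) (pre ++ la.map f).toFinset (by rw [hK, hW]; exact hlarge)
  rw [mem_filter] at hf'
  have heq : la.map f' = la.map f := List.map_congr_left hf'.2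
  have hinj : Function.Injective f' := by
    have h1 := hE _ (hFE f' hf'.1)
    rw [← hJ, ← card_univ, card_image_iff] at h1
    exact fun x y hxy => h1 (mem_coe.2 (mem_univ x)) (mem_coe.2 (mem_univ y)) hxy
  refine ⟨f', hf'.1, heq, hp.append hlk (by rw [List.length_map, hla])
    (by rw [List.length_map, hln]) (hnd'.2.1.map hinj) ?_ ?_⟩
  · intro v hv hv'
    obtain ⟨j, hj, rfl⟩ := List.mem_map.1 hv
    exact hav j (List.mem_toFinset.2 hj) (List.mem_toFinset.2 hv')
  · rw [← heq, ← List.map_append]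
    convert hFE f' hf'.1 using 1
    ext v
    simp only [List.mem_toFinset, List.mem_map, mem_image, mem_univ, true_and]
    exact ⟨fun ⟨j, _, h⟩ => ⟨j, h⟩, fun ⟨j, h⟩ => ⟨j, hall j, h⟩⟩

/-- Index set for the vertices of an edge: `l` vertices shared with the previous edge, `l` vertices
shared with the next edge and `r` further ones. -/
abbrev EdgeIndex (l r : ℕ) : Type := Fin l ⊕ (Fin l ⊕ Fin r)

/-- A dense `k`-partite family of edges contains a long `l`-path with all vertices distributed
evenly: every two consecutive edges use `k - l` new vertices each, visiting the classes of the
`2 l` junction indices once and all other classes twice. -/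
theorem exists_path_of_dense {N k l r : ℕ} (hk : k = l + (l + r)) (hr : 0 < r)
    (E : Finset (Finset (Fin N))) (hE : ∀ e ∈ E, e.card = k)
    (F : Finset (EdgeIndex l r → Fin N)) (hFE : ∀ f ∈ F, univ.image f ∈ E)
    (U : EdgeIndex l r → Finset (Fin N)) (u : ℕ) (hu : 0 < u)
    (hU : ∀ j, (U j).card ≤ u) (hFU : ∀ f ∈ F, ∀ j, f j ∈ U j) (d : ℝ) (hd : 0 < d)
    (hF : d * (u : ℝ) ^ k ≤ F.card) (p : ℕ) (hp : 1 ≤ p)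
    (hpu : 3 * (((k - l : ℕ) : ℝ) * ((2 * p * (k - l) + l : ℕ) : ℝ)) < d * u) :
    ∃ vs : List (Fin N), IsPath k l E vs ∧ vs.length = 2 * p * (k - l) + l ∧
      (∀ v ∈ vs, ∃ j, v ∈ U j) ∧
      ∀ (χ : Fin N → ℕ) (y : EdgeIndex l r → ℕ), (∀ v, χ v ≤ 1) →
        (∀ j, ∀ v ∈ U j, χ v = y j) →
        (vs.map χ).sum ≤ l + p * (∑ j, y (Sum.inl j) + ∑ j, y (Sum.inr (Sum.inl j)) +
          2 * ∑ j, y (Sum.inr (Sum.inr j))) := by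
  classical
  have hcJ : Fintype.card (EdgeIndex l r) = k := by simp [EdgeIndex, hk]
  set π₁ : (EdgeIndex l r → Fin N) → (Fin l → Fin N) := fun f i => f (Sum.inl i) with hπ₁
  set π₂ : (EdgeIndex l r → Fin N) → (Fin l → Fin N) := fun f i => f (Sum.inr (Sum.inl i)) with hπ₂
  have hu' : (0 : ℝ) < u := by exact_mod_cast hu
  have hkl : k - l = l + r := by omega
  have him₁ : (F.image π₁).card ≤ u ^ l := by
    have h1 : F.image π₁ ⊆ Fintype.piFinset fun i => U (Sum.inl i) := by
      intro x hx
      obtain ⟨f, hf, rfl⟩ := mem_image.1 hx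
      exact Fintype.mem_piFinset.2 fun i => hFU f hf _
    refine (card_le_card h1).trans ?_
    rw [Fintype.card_piFinset]
    simpa using prod_le_pow_card univ (fun i => (U (Sum.inl i)).card) u fun i _ => hU _
  have him₂ : (F.image π₂).card ≤ u ^ l := by
    have h1 : F.image π₂ ⊆ Fintype.piFinset fun i => U (Sum.inr (Sum.inl i)) := by
      intro x hx
      obtain ⟨f, hf, rfl⟩ := mem_image.1 hx
      exact Fintype.mem_piFinset.2 fun i => hFU f hf _
    refine (card_le_card h1).trans ?_
    rw [Fintype.card_piFinset]
    simpa using prod_le_pow_card univ (fun i => (U (Sum.inr (Sum.inl i))).card) u fun i _ => hU _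
  obtain ⟨F', hF'F, hne, hfib⟩ := exists_subset_fibers_large F π₁ π₂ (d / 3 * (u : ℝ) ^ (l + r)) (by
    have h1 : ((F.image π₁).card : ℝ) ≤ (u : ℝ) ^ l := by exact_mod_cast him₁
    have h2 : ((F.image π₂).card : ℝ) ≤ (u : ℝ) ^ l := by exact_mod_cast him₂
    have h3 : (u : ℝ) ^ k = (u : ℝ) ^ (l + r) * (u : ℝ) ^ l := by rw [← pow_add, hk]; ring
    have h4 : 0 < (u : ℝ) ^ k := by positivity
    calc d / 3 * (u : ℝ) ^ (l + r) * ((F.image π₁).card + (F.image π₂).card)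
        ≤ d / 3 * (u : ℝ) ^ (l + r) * ((u : ℝ) ^ l + (u : ℝ) ^ l) := by gcongr
      _ = 2 / 3 * (d * (u : ℝ) ^ k) := by rw [h3]; ring
      _ < d * (u : ℝ) ^ k := by nlinarith
      _ ≤ F.card := hF)
  have hlarge : ∀ i < 2 * p, ∀ S : Finset (EdgeIndex l r → Fin N), d / 3 * (u : ℝ) ^ (l + r) ≤ S.card →
      (k - l) * ((i * (k - l) + l) * u ^ (k - l - 1)) < S.card := by
    intro i hi S hS
    have h1 : (((k - l) * ((i * (k - l) + l) * u ^ (k - l - 1)) : ℕ) : ℝ) < S.card := by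
      refine lt_of_lt_of_le ?_ hS
      have h2 : (u : ℝ) ^ (l + r) = u * (u : ℝ) ^ (k - l - 1) := by
        rw [← pow_succ', hkl]; congr 1; omega
      have h3 : (((i * (k - l) + l : ℕ)) : ℝ) ≤ ((2 * p * (k - l) + l : ℕ) : ℝ) := by
        exact_mod_cast Nat.add_le_add_right (Nat.mul_le_mul_right _ hi.le) _
      have h4 : 0 < (u : ℝ) ^ (k - l - 1) := by positivity
      rw [h2, Nat.cast_mul, Nat.cast_mul, Nat.cast_pow, ← mul_assoc, ← mul_assoc]
      refine mul_lt_mul_of_pos_right ?_ h4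
      have h5 : ((k - l : ℕ) : ℝ) * ((i * (k - l) + l : ℕ) : ℝ) ≤
          ((k - l : ℕ) : ℝ) * ((2 * p * (k - l) + l : ℕ) : ℝ) := by gcongr
      linarith
    exact_mod_cast h1
  have hstep := fun la ln h1 h2 h3 i pre f hpp => exists_path_step hcJ (by omega : l < k) E hE F'
    (fun f hf => hFE f (hF'F hf)) U u hU (fun f hf => hFU f (hF'F hf)) la ln h1 h2 h3 i pre f hpp
  set A : List (EdgeIndex l r) := List.ofFn Sum.inl with hA
  set B : List (EdgeIndex l r) := List.ofFn fun i => Sum.inr (Sum.inl i) with hB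
  set C : List (EdgeIndex l r) := List.ofFn fun i => Sum.inr (Sum.inr i) with hC
  have hAn : A.Nodup := List.nodup_ofFn.2 Sum.inl_injective
  have hBn : B.Nodup := List.nodup_ofFn.2 (Sum.inr_injective.comp Sum.inl_injective)
  have hCn : C.Nodup := List.nodup_ofFn.2 (Sum.inr_injective.comp Sum.inr_injective)
  have hmem : ∀ j, j ∈ A ∨ j ∈ B ∨ j ∈ C := by
    rintro (j | j | j) <;> simp [hA, hB, hC, List.mem_ofFn]
  have hnd₁ : (A ++ (C ++ B)).Nodup := by
    rw [List.nodup_append', List.nodup_append']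
    refine ⟨hAn, ⟨hCn, hBn, ?_⟩, ?_⟩ <;> rintro (x | x | x) <;>
      simp [hA, hB, hC, List.mem_ofFn]
  have hnd₂ : (B ++ (C ++ A)).Nodup := by
    rw [List.nodup_append', List.nodup_append']
    refine ⟨hBn, ⟨hCn, hAn, ?_⟩, ?_⟩ <;> rintro (x | x | x) <;>
      simp [hA, hB, hC, List.mem_ofFn]
  have hinv : ∀ i ≤ p, ∃ (pre : List (Fin N)) (f : EdgeIndex l r → Fin N), f ∈ F' ∧
      IsPathWithEdges k l E (2 * i) (pre ++ A.map f) ∧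
      (∀ v ∈ pre ++ A.map f, ∃ j, v ∈ U j) ∧
      ∀ (χ : Fin N → ℕ) (y : EdgeIndex l r → ℕ), (∀ j, ∀ v ∈ U j, χ v = y j) →
        ((pre ++ A.map f).map χ).sum = (A.map y).sum +
          i * ((A.map y).sum + (B.map y).sum + 2 * (C.map y).sum) := by
    have hmapU : ∀ f ∈ F', ∀ L : List (EdgeIndex l r), ∀ v ∈ L.map f, ∃ j, v ∈ U j := by
      intro f hf L v hv
      obtain ⟨j, -, rfl⟩ := List.mem_map.1 hv
      exact ⟨j, hFU f (hF'F hf) j⟩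
    have hmapy : ∀ f ∈ F', ∀ L : List (EdgeIndex l r), ∀ (χ : Fin N → ℕ) (y : EdgeIndex l r → ℕ),
        (∀ j, ∀ v ∈ U j, χ v = y j) → ((L.map f).map χ) = (L.map y) := by
      intro f hf L χ y hχ
      rw [List.map_map]
      exact List.map_congr_left fun j _ => hχ j _ (hFU f (hF'F hf) j)
    intro i
    induction i with
    | zero =>
      intro _
      obtain ⟨f, hf⟩ := hne
      refine ⟨[], f, hf, ⟨?_, ?_, ?_⟩, ?_, ?_⟩
      · have hinj : Function.Injective f := by
          have h1 := hE _ (hFE f (hF'F hf))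
          rw [← hcJ, ← card_univ, card_image_iff] at h1
          exact fun x y hxy => h1 (mem_coe.2 (mem_univ x)) (mem_coe.2 (mem_univ y)) hxy
        exact hAn.map hinj
      · simp [hA]
      · intro i hi
        simp [hA] at hi
        omega
      · exact hmapU f hf _
      · intro χ y hχ
        rw [List.nil_append, hmapy f hf A χ y hχ]
        simp
    | succ i ih =>
      intro hi
      obtain ⟨pre, f, hf, hpath, hvU, hχ⟩ := ih (by omega)
      obtain ⟨f₁, hf₁, heq₁, hpath₁⟩ := hstep A (C ++ B) hnd₁ (fun j => by
        have := hmem j; simp only [List.mem_append]; tauto) (by simp [hA]) (2 * i) pre f hpath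
        (hlarge _ (by omega) _ (by
          convert (hfib f hf).1 using 4
          simp [hA, hπ₁, funext_iff, List.mem_ofFn]))
      rw [List.map_append, ← List.append_assoc] at hpath₁
      obtain ⟨f₂, hf₂, heq₂, hpath₂⟩ := hstep B (C ++ A) hnd₂ (fun j => by
        have := hmem j; simp only [List.mem_append]; tauto) (by simp [hB]) (2 * i + 1) _ f₁ hpath₁
        (hlarge _ (by omega) _ (by
          convert (hfib f₁ hf₁).2 using 4
          simp [hB, hπ₂, funext_iff, List.mem_ofFn]))
      rw [List.map_append, ← List.append_assoc] at hpath₂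
      refine ⟨_, f₂, hf₂, hpath₂, ?_, ?_⟩
      · intro v hv
        rw [List.mem_append, List.mem_append, List.mem_append, List.mem_append] at hv
        rcases hv with (((hv | hv) | hv) | hv) | hv
        · exact hvU v hv
        all_goals first | exact hmapU _ hf₁ _ v hv | exact hmapU _ hf₂ _ v hv
      · intro χ y hy
        have h0 := hχ χ y hy
        rw [List.map_append, List.map_append, List.map_append, List.map_append, List.sum_append,
          List.sum_append, List.sum_append, List.sum_append, h0, hmapy _ hf₁ C χ y hy,
          hmapy _ hf₁ B χ y hy, hmapy _ hf₂ C χ y hy, hmapy _ hf₂ A χ y hy]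
        ring
  obtain ⟨pre, f, hf, hpath, hvU, hχ⟩ := hinv p le_rfl
  refine ⟨pre ++ A.map f, ⟨hpath.1, ⟨2 * p, by omega, hpath.2.1⟩, hpath.2.2⟩, hpath.2.1, hvU, ?_⟩
  intro χ y hχ1 hy
  rw [hχ χ y hy]
  have hA1 : (A.map y).sum = ∑ j, y (Sum.inl j) := by
    rw [hA, List.map_ofFn, List.sum_ofFn]; rfl
  have hB1 : (B.map y).sum = ∑ j, y (Sum.inr (Sum.inl j)) := by
    rw [hB, List.map_ofFn, List.sum_ofFn]; rfl
  have hC1 : (C.map y).sum = ∑ j, y (Sum.inr (Sum.inr j)) := by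
    rw [hC, List.map_ofFn, List.sum_ofFn]; rfl
  rw [hA1, hB1, hC1]
  refine Nat.add_le_add_right ?_ _
  have hy1 : ∀ j, y j ≤ 1 := fun j => hy j (f j) (hFU f (hF'F hf) j) ▸ hχ1 _
  calc ∑ j : Fin l, y (Sum.inl j) ≤ ∑ j : Fin l, 1 := sum_le_sum fun j _ => hy1 _
    _ = l := by simp

/-- The share of an index in the average number of new vertices of an edge of a path. -/
noncomputable def edgeWeight (l r : ℕ) : EdgeIndex l r → ℝ :=
  Sum.elim (fun _ => 1 / 2) (Sum.elim (fun _ => 1 / 2) fun _ => 1)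

theorem half_le_edgeWeight {l r : ℕ} (j : EdgeIndex l r) : 1 / 2 ≤ edgeWeight l r j := by
  rcases j with j | j | j <;> norm_num [edgeWeight]

theorem sum_edgeWeight_mul {l r : ℕ} (y : EdgeIndex l r → ℝ) :
    2 * ∑ j, edgeWeight l r j * y j = ∑ j, y (Sum.inl j) + ∑ j, y (Sum.inr (Sum.inl j)) +
      2 * ∑ j, y (Sum.inr (Sum.inr j)) := by
  simp only [Fintype.sum_sum_type, edgeWeight, Sum.elim_inl, Sum.elim_inr, ← mul_sum]
  ring

theorem sum_edgeWeight (l r : ℕ) : ∑ j, edgeWeight l r j = (l + r : ℕ) := by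
  have := sum_edgeWeight_mul (l := l) (r := r) fun _ => 1
  simp only [mul_one, sum_const, card_univ, Fintype.card_fin, nsmul_eq_mul] at this
  push_cast
  linarith

/-- The distribution of the weights of the indices among the classes given by `τ`. -/
noncomputable def classWeight {l r q : ℕ} (τ : EdgeIndex l r → Fin q) (i : Fin q) : ℝ :=
  ∑ j, edgeWeight l r j * if τ j = i then 1 else 0

theorem classWeight_nonneg {l r q : ℕ} (τ : EdgeIndex l r → Fin q) (i : Fin q) :
    0 ≤ classWeight τ i :=
  sum_nonneg fun j _ => mul_nonneg ((by norm_num : (0 : ℝ) ≤ 1 / 2).trans (half_le_edgeWeight j))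
    (by split_ifs <;> norm_num)

theorem half_le_classWeight {l r q : ℕ} (τ : EdgeIndex l r → Fin q) (j : EdgeIndex l r) :
    1 / 2 ≤ classWeight τ (τ j) := by
  have h := single_le_sum (f := fun j' => edgeWeight l r j' * if τ j' = τ j then (1 : ℝ) else 0)
    (fun j' _ => mul_nonneg ((by norm_num : (0 : ℝ) ≤ 1 / 2).trans (half_le_edgeWeight j'))
    (by split_ifs <;> norm_num)) (mem_univ j)
  rw [if_pos rfl, mul_one] at h
  exact (half_le_edgeWeight j).trans h

theorem sum_mul_classWeight {l r q : ℕ} (τ : EdgeIndex l r → Fin q) (L : Fin q → ℝ) :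
    ∑ i, L i * classWeight τ i = ∑ j, edgeWeight l r j * L (τ j) := by
  simp only [classWeight, mul_sum]
  rw [sum_comm]
  refine sum_congr rfl fun j _ => ?_
  rw [sum_eq_single (τ j)]
  · rw [if_pos rfl]; ring
  · intro i _ hi
    rw [if_neg hi.symm]; ring
  · simp

theorem sum_classWeight {l r q : ℕ} (τ : EdgeIndex l r → Fin q) :
    ∑ i, classWeight τ i = (l + r : ℕ) := by
  have := sum_mul_classWeight τ fun _ => 1
  simp only [one_mul, mul_one, sum_edgeWeight] at this
  exact this

theorem sum_classWeight_sq_le {l r q : ℕ} (τ : EdgeIndex l r → Fin q) :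
    ∑ i, classWeight τ i ^ 2 ≤ ((l + r : ℕ) : ℝ) ^ 2 := by
  rw [← sum_classWeight τ]
  rw [sq (∑ i, _), sum_mul]
  refine sum_le_sum fun i hi => ?_
  rw [sq]
  exact mul_le_mul_of_nonneg_left
    (single_le_sum (fun i _ => classWeight_nonneg τ i) hi) (classWeight_nonneg τ i)

theorem card_filter_toFinset_eq {V : Type*} [DecidableEq V] (P : V → Prop) [DecidablePred P]
    (vs : List V) (h : vs.Nodup) :
    (vs.toFinset.filter P).card = (vs.map fun v => if P v then 1 else 0).sum := by
  rw [card_filter, List.sum_toFinset _ h]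

/-- Sum of the excesses of loads of given mean over a level slightly below 1. -/
theorem sum_excess_le {q : ℕ} (L : Fin q → ℝ) (S R ε σ : ℝ) (hσ : 0 < σ) (hε : 0 ≤ ε)
    (hq : 0 < q) (hS : ∑ i, L i = S) (hSq : S ≤ q) (hR : ∑ i, L i ^ 2 ≤ S ^ 2 / q + R)
    (hRσ : R ≤ σ ^ 2 * q) :
    ∑ i, max (L i - (1 - 2 * ε)) 0 ≤ q * (σ + 2 * ε) := by
  have hq' : (0 : ℝ) < q := by exact_mod_cast hq
  have h1 : ∀ i, max (L i - (1 - 2 * ε)) 0 ≤ σ / 2 + (L i - S / q) ^ 2 / (2 * σ) + 2 * ε := by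
    intro i
    have h2 : |L i - S / q| ≤ σ / 2 + (L i - S / q) ^ 2 / (2 * σ) := by
      have h3 : 0 ≤ (|L i - S / q| - σ) ^ 2 / (2 * σ) := by positivity
      have h4 : (|L i - S / q| - σ) ^ 2 / (2 * σ) =
          (L i - S / q) ^ 2 / (2 * σ) + σ / 2 - |L i - S / q| := by
        rw [sub_sq, sq_abs]; field_simp; ring
      linarith
    have h5 : S / q ≤ 1 := by rw [div_le_one hq']; exact hSq
    have h6 := le_abs_self (L i - S / q)
    have h7 := abs_nonneg (L i - S / q)
    exact max_le (by linarith) (by linarith)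
  have h8 : ∑ i, (L i - S / q) ^ 2 ≤ σ ^ 2 * q := by
    have h9 : ∑ i, (L i - S / q) ^ 2 = ∑ i, L i ^ 2 - S ^ 2 / q := by
      have : ∀ i, (L i - S / q) ^ 2 = L i ^ 2 - 2 * (S / q) * L i + (S / q) ^ 2 := fun i => by ring
      simp only [this, sum_add_distrib, sum_sub_distrib, ← mul_sum, hS, sum_const, card_univ,
        Fintype.card_fin, nsmul_eq_mul]
      field_simp
      ring
    linarith
  calc ∑ i, max (L i - (1 - 2 * ε)) 0
      ≤ ∑ i, (σ / 2 + (L i - S / q) ^ 2 / (2 * σ) + 2 * ε) := sum_le_sum fun i _ => h1 i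
    _ = q * (σ / 2 + 2 * ε) + (∑ i, (L i - S / q) ^ 2) / (2 * σ) := by
        simp only [sum_add_distrib, ← sum_div, sum_const, card_univ, Fintype.card_fin, nsmul_eq_mul]
        ring
    _ ≤ q * (σ / 2 + 2 * ε) + (σ ^ 2 * q) / (2 * σ) := by gcongr
    _ = q * (σ + 2 * ε) := by field_simp; ring

theorem exists_path_of_heredDense {N k l r q b : ℕ} (hk : k = l + (l + r)) (hr : 0 < r)
    (E : Finset (Finset (Fin N))) (hE : ∀ e ∈ E, e.card = k)
    (Edg : Finset (EdgeIndex l r → Fin N)) (hEdg : ∀ f ∈ Edg, univ.image f ∈ E) (c : Fin N → Fin q)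
    (ε d : ℝ) (hd : 0 < d) (τ : EdgeIndex l r → Fin q)
    (hτ : HeredDense Edg c (ε * b) d τ) (hεb : 0 < ε * b) (R : EdgeIndex l r → Finset (Fin N))
    (hRc : ∀ j, ∀ v ∈ R j, c v = τ j) (hR : ∀ j, ε * b ≤ (R j).card) (p : ℕ) (hp : 1 ≤ p)
    (hpb : 6 * (((k - l : ℕ) : ℝ) * ((2 * p * (k - l) + l : ℕ) : ℝ)) < d * (ε * b)) :
    ∃ vs : List (Fin N), IsPath k l E vs ∧ vs.length = 2 * p * (k - l) + l ∧
      (∀ v ∈ vs, ∃ j, v ∈ R j) ∧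
      ∀ i, (((vs.map fun v => if c v = i then 1 else 0).sum : ℕ) : ℝ) ≤
        l + 2 * p * classWeight τ i := by
  set u := ⌈ε * b⌉₊ with hu
  have hu0 : 0 < u := Nat.ceil_pos.2 hεb
  have huε : ε * b ≤ u := Nat.le_ceil _
  have hex : ∀ j, ∃ S ⊆ R j, S.card = u := fun j =>
    exists_subset_card_eq (Nat.ceil_le.2 (hR j))
  choose U hUR hUu using hex
  have hdense := hτ U (fun j v hv => hRc j v (hUR j hv)) fun j => by rw [hUu]; exact huε
  obtain ⟨vs, h1, h2, h3, h4⟩ := exists_path_of_dense hk hr E hE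
    (Edg.filter fun f => ∀ j, f j ∈ U j) (fun f hf => hEdg f (mem_filter.1 hf).1) U u hu0
    (fun j => (hUu j).le) (fun f hf => (mem_filter.1 hf).2) (d / 2) (by positivity)
    (by
      convert hdense using 2
      simp [hUu, hk]) p hp (by nlinarith)
  refine ⟨vs, h1, h2, fun v hv => ?_, fun i => ?_⟩
  · obtain ⟨j, hj⟩ := h3 v hv
    exact ⟨j, hUR j hj⟩
  · have h5 := h4 (fun v => if c v = i then 1 else 0) (fun j => if τ j = i then 1 else 0)
      (fun v => by split_ifs <;> simp) (fun j v hv => by rw [hRc j v (hUR j hv)])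
    have h6 : (((vs.map fun v => if c v = i then 1 else 0).sum : ℕ) : ℝ) ≤ l +
        p * (2 * classWeight τ i) := by
      rw [classWeight, sum_edgeWeight_mul]
      exact_mod_cast h5
    linarith

set_option maxHeartbeats 1000000 in
theorem exists_greedy_paths {N k l r q b : ℕ} (hk : k = l + (l + r)) (hr : 0 < r) (hq : 0 < q)
    (hb : 0 < b) (E : Finset (Finset (Fin N))) (hE : ∀ e ∈ E, e.card = k)
    (Edg : Finset (EdgeIndex l r → Fin N)) (hEdg : ∀ f ∈ Edg, univ.image f ∈ E) (c : Fin N → Fin q)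
    (hc : ∀ i, (univ.filter fun v => c v = i).card = b) (ε d κ θ m : ℝ) (hε : 0 < ε)
    (hd : 0 < d) (hm : m = (l + r : ℕ)) (p : ℕ) (hp : 1 ≤ p)
    (hpb : 6 * (((k - l : ℕ) : ℝ) * ((2 * p * (k - l) + l : ℕ) : ℝ)) < d * (ε * b))
    (hθ : θ * b = 2 * p)
    (hsel : ∀ L : Fin q → ℝ, (∀ i, 0 ≤ L i) → ∑ i, L i ≤ q → ∃ f ∈ Edg,
      HeredDense Edg c (ε * b) d (c ∘ f) ∧
        ∑ j, edgeWeight l r j * L (c (f j)) ≤ m * ((∑ i, L i) / q) + κ)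
    (T : ℕ) (hT : T * (θ * m) ≤ q) (hlT : (l * T : ℝ) ≤ ε * b) (t : ℕ) (ht : t ≤ T) :
    ∃ (P : List (List (Fin N))) (L : Fin q → ℝ) (sk : ℕ), P.length ≤ t ∧
      (∀ vs ∈ P, IsPath k l E vs) ∧ P.flatten.Nodup ∧ (∀ i, 0 ≤ L i) ∧
      ∑ i, L i = t * (θ * m) ∧
      ∑ i, L i ^ 2 ≤ (t * (θ * m)) ^ 2 / q + t * (2 * θ * κ + θ ^ 2 * m ^ 2) ∧
      (∀ i, (((P.flatten.map fun v => if c v = i then 1 else 0).sum : ℕ) : ℝ) ≤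
        L i * b + l * t) ∧
      t * (2 * p * m) - sk * (2 * p * m) ≤ P.flatten.length ∧
      sk * (θ / 2) ≤ ∑ i, max (L i - (1 - 2 * ε)) 0 := by
  classical
  have hb' : (0 : ℝ) < b := by exact_mod_cast hb
  have hq' : (0 : ℝ) < q := by exact_mod_cast hq
  have hp' : (0 : ℝ) < p := by exact_mod_cast hp
  have hθ0 : 0 < θ := by
    by_contra! h
    have := mul_nonpos_of_nonpos_of_nonneg h hb'.le
    linarith
  have hm0 : 0 ≤ m := by rw [hm]; positivity
  induction t with
  | zero =>
    refine ⟨[], fun _ => 0, 0, ?_⟩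
    simp
    positivity
  | succ t ih =>
    obtain ⟨P, L, sk, hP, hPath, hnd, hL0, hLs, hL2, hcov, hlen, hsk⟩ := ih (by omega)
    have htT : (t : ℝ) + 1 ≤ T := by exact_mod_cast ht
    obtain ⟨f, hf, hfd, hfL⟩ := hsel L hL0 (by
      rw [hLs]
      refine le_trans ?_ hT
      have : 0 ≤ θ * m := by positivity
      nlinarith)
    set τ := c ∘ f with hτ
    set x := classWeight τ with hx
    have hx0 : ∀ i, 0 ≤ x i := classWeight_nonneg τ
    have hxs : ∑ i, x i = m := by rw [hm]; exact sum_classWeight τ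
    have hx2 : ∑ i, x i ^ 2 ≤ m ^ 2 := by rw [hm]; exact sum_classWeight_sq_le τ
    have hLx : ∑ i, L i * x i ≤ m * (t * (θ * m) / q) + κ := by
      rw [hx, sum_mul_classWeight, ← hLs]; exact hfL
    set L' : Fin q → ℝ := fun i => L i + θ * x i with hL'
    have hLL' : ∀ i, L i ≤ L' i := fun i => le_add_of_nonneg_right (mul_nonneg hθ0.le (hx0 i))
    have hL'0 : ∀ i, 0 ≤ L' i := fun i => (hL0 i).trans (hLL' i)
    have hL's : ∑ i, L' i = ((t + 1 : ℕ) : ℝ) * (θ * m) := by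
      simp only [hL', sum_add_distrib, ← mul_sum, hLs, hxs]; push_cast; ring
    have hL'2 : ∑ i, L' i ^ 2 ≤ (((t + 1 : ℕ) : ℝ) * (θ * m)) ^ 2 / q +
        ((t + 1 : ℕ) : ℝ) * (2 * θ * κ + θ ^ 2 * m ^ 2) := by
      have h1 : ∑ i, L' i ^ 2 = ∑ i, L i ^ 2 + 2 * θ * ∑ i, L i * x i + θ ^ 2 * ∑ i, x i ^ 2 := by
        simp only [hL', mul_sum, ← sum_add_distrib]
        exact sum_congr rfl fun i _ => by ring
      have h2 : (((t + 1 : ℕ) : ℝ) * (θ * m)) ^ 2 / q = (t * (θ * m)) ^ 2 / q +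
          2 * θ * (m * (t * (θ * m) / q)) + (θ * m) ^ 2 / q := by
        push_cast; field_simp; ring
      have h3 : 0 ≤ (θ * m) ^ 2 / q := by positivity
      have h4 := mul_le_mul_of_nonneg_left hLx (by positivity : 0 ≤ 2 * θ)
      have h5 := mul_le_mul_of_nonneg_left hx2 (by positivity : 0 ≤ θ ^ 2)
      rw [h1, h2]
      push_cast
      linarith
    have hmono : ∀ i, max (L i - (1 - 2 * ε)) 0 ≤ max (L' i - (1 - 2 * ε)) 0 := fun i =>
      max_le_max (by linarith [hLL' i]) le_rfl
    set R : EdgeIndex l r → Finset (Fin N) := fun j =>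
      univ.filter fun v => c v = τ j ∧ v ∉ P.flatten with hR
    by_cases hav : ∀ j, ε * b ≤ (R j).card
    · obtain ⟨vs, hvs, hvl, hvR, hvχ⟩ := exists_path_of_heredDense hk hr E hE Edg hEdg c ε d hd τ
        hfd (by positivity) R (fun j v hv => (mem_filter.1 hv).2.1) hav p hp hpb
      refine ⟨vs :: P, L', sk, ?_, ?_, ?_, hL'0, hL's, hL'2, ?_, ?_, ?_⟩
      · simpa using hP
      · intro ws hws
        rcases List.mem_cons.1 hws with rfl | h
        · exact hvs
        · exact hPath ws h
      · rw [List.flatten_cons]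
        refine List.Nodup.append hvs.1 hnd fun v hv hv' => ?_
        obtain ⟨j, hj⟩ := hvR v hv
        exact (mem_filter.1 hj).2.2 hv'
      · intro i
        rw [List.flatten_cons, List.map_append, List.sum_append]
        have h1 := hcov i
        have h2 := hvχ i
        have h3 : L' i * b = L i * b + 2 * p * x i := by
          simp only [hL', add_mul]
          rw [← hθ]; ring
        rw [h3]
        push_cast at h1 h2 ⊢
        linarith
      · rw [List.flatten_cons, List.length_append, hvl]
        have hkm : ((k - l : ℕ) : ℝ) = m := by rw [hm]; congr 1; omega
        push_cast
        rw [hkm]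
        have : (0 : ℝ) ≤ l := Nat.cast_nonneg _
        linarith
      · exact hsk.trans (sum_le_sum fun i _ => hmono i)
    · push Not at hav
      obtain ⟨j, hj⟩ := hav
      refine ⟨P, L', sk + 1, by omega, hPath, hnd, hL'0, hL's, hL'2, ?_, ?_, ?_⟩
      · intro i
        refine (hcov i).trans ?_
        have := mul_le_mul_of_nonneg_right (hLL' i) hb'.le
        have : (0 : ℝ) ≤ l := Nat.cast_nonneg _
        push_cast
        nlinarith
      · push_cast
        linarith
      · have h1 : (b : ℝ) = (R j).card +
            (((P.flatten.map fun v => if c v = τ j then 1 else 0).sum : ℕ) : ℝ) := by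
          rw [← card_filter_toFinset_eq _ _ hnd, ← hc (τ j), ← Nat.cast_add]
          congr 1
          rw [← card_filter_add_card_filter_not (s := univ.filter fun v => c v = τ j)
            (fun v => v ∉ P.flatten)]
          congr 2
          · rw [hR, filter_filter]
          · ext v
            simp [and_comm]
        have h2 := hcov (τ j)
        have h3 : (l : ℝ) * t ≤ ε * b := by
          refine le_trans ?_ hlT
          gcongr
          linarith
        have h4 : 1 - 2 * ε ≤ L (τ j) := by
          have : (1 - 2 * ε) * b ≤ L (τ j) * b := by linarith
          exact le_of_mul_le_mul_right this hb'
        have h5 : L (τ j) + θ / 2 ≤ L' (τ j) := by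
          have := mul_le_mul_of_nonneg_left (half_le_classWeight τ j) hθ0.le
          simp only [hL', hx]
          linarith
        have h6 : ∑ i, (max (L i - (1 - 2 * ε)) 0 + if i = τ j then θ / 2 else 0) ≤
            ∑ i, max (L' i - (1 - 2 * ε)) 0 := by
          refine sum_le_sum fun i _ => ?_
          split_ifs with hi
          · rw [hi, max_eq_left (by linarith)]
            exact le_max_of_le_left (by linarith)
          · rw [add_zero]; exact hmono i
        rw [sum_add_distrib, sum_ite_eq' univ (τ j), if_pos (mem_univ _)] at h6
        push_cast
        linarith

/-- If tuples of hereditarily dense classes can always be chosen with below average load, then few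
paths cover almost all vertices. -/
theorem exists_path_tiling {N k l r q b : ℕ} (hk : k = l + (l + r)) (hr : 0 < r) (hq : 0 < q)
    (hb : 0 < b) (hN : N = q * b) (E : Finset (Finset (Fin N))) (hE : ∀ e ∈ E, e.card = k)
    (Edg : Finset (EdgeIndex l r → Fin N)) (hEdg : ∀ f ∈ Edg, univ.image f ∈ E) (c : Fin N → Fin q)
    (hc : ∀ i, (univ.filter fun v => c v = i).card = b) (ε d κ θ m σ : ℝ) (hε : 0 < ε)
    (hσ : 0 < σ) (hκ : 0 ≤ κ)
    (hd : 0 < d) (hm : m = (l + r : ℕ)) (p : ℕ) (hp : 1 ≤ p)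
    (hpb : 6 * (((k - l : ℕ) : ℝ) * ((2 * p * (k - l) + l : ℕ) : ℝ)) < d * (ε * b))
    (hθ : θ * b = 2 * p) (hσκ : 2 * κ + θ * m ^ 2 ≤ σ ^ 2 * m)
    (hsel : ∀ L : Fin q → ℝ, (∀ i, 0 ≤ L i) → ∑ i, L i ≤ q → ∃ f ∈ Edg,
      HeredDense Edg c (ε * b) d (c ∘ f) ∧
        ∑ j, edgeWeight l r j * L (c (f j)) ≤ m * ((∑ i, L i) / q) + κ)
    (hlT : (l : ℝ) * q ≤ ε * b * (θ * m)) :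
    ∃ P : List (List (Fin N)), (P.length : ℝ) ≤ q / (θ * m) ∧
      (∀ vs ∈ P, IsPath k l E vs) ∧ P.flatten.Nodup ∧
      (N : ℝ) - P.flatten.length ≤ (θ * m + 2 * m * σ + 4 * m * ε) * N := by
  have hb' : (0 : ℝ) < b := by exact_mod_cast hb
  have hq' : (0 : ℝ) < q := by exact_mod_cast hq
  have hq1 : (1 : ℝ) ≤ q := by exact_mod_cast hq
  have hp' : (0 : ℝ) < p := by exact_mod_cast hp
  have hθ0 : 0 < θ := by
    by_contra! h
    have := mul_nonpos_of_nonpos_of_nonneg h hb'.le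
    linarith
  have hm0 : 0 < m := by rw [hm]; exact_mod_cast (by omega : 0 < l + r)
  have hθm : 0 < θ * m := by positivity
  set T := ⌊(q : ℝ) / (θ * m)⌋₊ with hTdef
  have hTle : (T : ℝ) ≤ q / (θ * m) := Nat.floor_le (by positivity)
  have hTlt : (q : ℝ) / (θ * m) < T + 1 := Nat.lt_floor_add_one _
  have hT : T * (θ * m) ≤ q := by rwa [le_div_iff₀ hθm] at hTle
  rw [div_lt_iff₀ hθm] at hTlt
  obtain ⟨P, L, sk, hP, hPath, hnd, hL0, hLs, hL2, hcov, hlen, hsk⟩ :=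
    exists_greedy_paths hk hr hq hb E hE Edg hEdg c hc ε d κ θ m hε hd hm p hp hpb hθ hsel T hT (by
      calc (l * T : ℝ) ≤ l * (q / (θ * m)) := by gcongr
        _ = l * q / (θ * m) := by ring
        _ ≤ ε * b := by rw [div_le_iff₀ hθm]; exact hlT) T le_rfl
  refine ⟨P, le_trans (by exact_mod_cast hP) hTle, hPath, hnd, ?_⟩
  have h1 := sum_excess_le L (T * (θ * m)) (T * (2 * θ * κ + θ ^ 2 * m ^ 2)) ε σ hσ hε.le hq hLs hT
    hL2 (by
      have h2 : T * (2 * θ * κ + θ ^ 2 * m ^ 2) * m = T * (θ * m) * (2 * κ + θ * m ^ 2) := by ring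
      have h3 : T * (θ * m) * (2 * κ + θ * m ^ 2) ≤ q * (σ ^ 2 * m) := by
        gcongr
      refine le_of_mul_le_mul_right ?_ hm0
      linarith)
  have h4 : sk * (θ / 2) ≤ q * (σ + 2 * ε) := hsk.trans h1
  have hN' : (N : ℝ) = q * b := by exact_mod_cast hN
  have h5 : (T : ℝ) * (2 * p * m) = T * (θ * m) * b := by rw [← hθ]; ring
  have h6 : (sk : ℝ) * (2 * p * m) = sk * (θ / 2) * (2 * m * b) := by rw [← hθ]; ring
  have h7 : sk * (θ / 2) * (2 * m * b) ≤ q * (σ + 2 * ε) * (2 * m * b) := by gcongr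
  have h8 : (q : ℝ) * b ≤ (T * (θ * m) + θ * m) * b := by
    gcongr; linarith
  have h9 : θ * m * b ≤ θ * m * (q * b) := by
    gcongr
    exact le_mul_of_one_le_left hb'.le hq1
  rw [h5, h6] at hlen
  rw [hN']
  linarith

set_option maxHeartbeats 1000000 in
/-- Either there are few paths covering almost all vertices, or some large set of vertices contains
few edges. -/
theorem exists_path_tiling_or_sparse_set {k l r : ℕ} (hk : k = l + (l + r)) (hr : 0 < r)
    (i₀ : Fin l) (m a α γ η : ℝ) (hm : m = (l + r : ℕ)) (ha : a = 1 / (2 * m)) (hα : 0 < α)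
    (hγ : 0 < γ) (hγa : 80 * γ ≤ a) (hη : 0 < η) :
    ∃ s M N₀ : ℕ, 0 < M ∧ ∀ N : ℕ, N₀ ≤ N → M ∣ N → ∀ E : Finset (Finset (Fin N)),
      (∀ e ∈ E, e.card = k) →
      (∀ x : EdgeIndex l r → Fin N,
        Set.InjOn x {j | j ≠ Sum.inl i₀ ∧ j ≠ Sum.inr (Sum.inl i₀)} →
        (2 * a - a ^ 2 - γ) * (N : ℝ) ^ 2 ≤ ((univ.filter fun p : Fin N × Fin N =>
          univ.image (Function.update (Function.update x (Sum.inl i₀) p.1)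
            (Sum.inr (Sum.inl i₀)) p.2) ∈ E).card : ℝ)) →
      (∃ P : List (List (Fin N)), P.length ≤ s ∧ (∀ vs ∈ P, IsPath k l E vs) ∧ P.flatten.Nodup ∧
        (N : ℝ) - P.flatten.length ≤ α * N) ∨
      ∃ B : Finset (Fin N), (1 - a - (10 / a + 2) * (2 * γ)) * N ≤ B.card ∧
        ((univ.filter fun f : EdgeIndex l r → Fin N => univ.image f ∈ E ∧ ∀ j, f j ∈ B).card : ℝ) ≤
          η * (N : ℝ) ^ k := by
  classical
  have hl : 0 < l := i₀.pos
  have hm2 : 2 ≤ m := by rw [hm]; exact_mod_cast (by omega : 2 ≤ l + r)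
  have hm0 : 0 < m := by linarith
  have ha0 : 0 < a := by rw [ha]; positivity
  have ha4 : a ≤ 1 / 4 := by
    rw [ha, div_le_div_iff₀ (by positivity) (by norm_num)]; linarith
  have hk0 : (0 : ℝ) < k := by exact_mod_cast (by omega : 0 < k)
  have hcJ : Fintype.card (EdgeIndex l r) = k := by simp [EdgeIndex, hk]
  have hkl : ((k - l : ℕ) : ℝ) = m := by rw [hm]; congr 1; omega
  set σ : ℝ := α / (8 * m) with hσ
  set ε : ℝ := α / (16 * m) with hε
  have hσ0 : 0 < σ := by positivity
  have hε0 : 0 < ε := by positivity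
  set κ : ℝ := σ ^ 2 * m / 4 with hκ
  have hκ0 : 0 < κ := by positivity
  set lam : ℝ := min (1 / (4 * k)) (κ / (4 * m * k)) with hlam
  have hlam0 : 0 < lam := lt_min (by positivity) (by positivity)
  have hlam_a : lam * (4 * k) ≤ 1 := by
    rw [← le_div_iff₀ (by positivity)]; exact min_le_left _ _
  have hlam_b : lam * (4 * m * k) ≤ κ := by
    rw [← le_div_iff₀ (by positivity)]; exact min_le_right _ _
  have hlam1 : lam ≤ 1 := by
    have : (1 : ℝ) ≤ k := by exact_mod_cast (by omega : 1 ≤ k)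
    nlinarith
  set β₀ : ℝ := min (γ * lam ^ k) η with hβ₀
  have hβ₀0 : 0 < β₀ := lt_min (by positivity) hη
  set d : ℝ := β₀ / 2 with hd
  have hd0 : 0 < d := by positivity
  obtain ⟨Q, M, hM, hreg⟩ := exists_regular_equipartition (EdgeIndex l r) ε d d hε0 hd0 hd0
  set c₀ : ℝ := min (d * ε / (24 * m ^ 2)) (min (α / (8 * m)) (σ ^ 2 / (4 * m))) with hc₀
  have hc₀0 : 0 < c₀ := lt_min (by positivity) (lt_min (by positivity) (by positivity))
  have hc₀a : c₀ * (24 * m ^ 2) ≤ d * ε := by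
    rw [← le_div_iff₀ (by positivity)]; exact min_le_left _ _
  have hc₀b : c₀ * (8 * m) ≤ α := by
    rw [← le_div_iff₀ (by positivity)]; exact (min_le_right _ _).trans (min_le_left _ _)
  have hc₀c : c₀ * (4 * m) ≤ σ ^ 2 := by
    rw [← le_div_iff₀ (by positivity)]; exact (min_le_right _ _).trans (min_le_right _ _)
  set b₀ : ℝ := max (1 / c₀) (max ((12 * m * l + 1) / (d * ε)) (l * Q / (ε * c₀ * m))) with hb₀
  obtain ⟨N₀, hN₀⟩ := exists_nat_ge (max (Q * b₀) (1 / lam))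
  obtain ⟨s, hs⟩ := exists_nat_ge ((Q : ℝ) / (c₀ * m))
  refine ⟨s, M, N₀ + 1, hM, fun N hN hMN E hE hdeg => ?_⟩
  have hNpos : 0 < N := by omega
  have hNr : (0 : ℝ) < N := by exact_mod_cast hNpos
  have hNN₀ : (N₀ : ℝ) ≤ N := by exact_mod_cast (by omega : N₀ ≤ N)
  set Edg : Finset (EdgeIndex l r → Fin N) := univ.filter fun f => univ.image f ∈ E with hEdg
  obtain ⟨q, b, c, hq, hqQ, hNqb, hc, hbad⟩ := hreg N hNpos hMN Edg
  rw [hcJ] at hbad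
  have hqr : (0 : ℝ) < q := by exact_mod_cast hq
  have hqQr : (q : ℝ) ≤ Q := by exact_mod_cast hqQ
  have hNqbr : (N : ℝ) = q * b := by exact_mod_cast hNqb
  have hb : 0 < b := Nat.pos_of_ne_zero fun h => by rw [h] at hNqb; omega
  have hbr : (0 : ℝ) < b := by exact_mod_cast hb
  have hbb₀ : b₀ ≤ b := by
    have h1 : Q * b₀ ≤ q * b := hNqbr ▸ ((le_max_left _ _).trans hN₀).trans hNN₀
    by_contra! h
    have hQ : (0 : ℝ) < Q := hqr.trans_le hqQr
    have h2 : (q : ℝ) * b ≤ Q * b := by gcongr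
    have h3 : (Q : ℝ) * b < Q * b₀ := by gcongr
    linarith
  have hb1 : 1 ≤ c₀ * b := by
    have h1 : 1 / c₀ ≤ b := (le_max_left _ _).trans hbb₀
    rw [div_le_iff₀ hc₀0] at h1; linarith
  have hb2 : 12 * m * l + 1 ≤ d * ε * b := by
    have h1 : (12 * m * l + 1) / (d * ε) ≤ b :=
      ((le_max_left _ _).trans (le_max_right _ _)).trans hbb₀
    rw [div_le_iff₀ (by positivity)] at h1; linarith
  have hb3 : l * Q ≤ ε * b * (c₀ * m) := by
    have h1 : l * Q / (ε * c₀ * m) ≤ b := ((le_max_right _ _).trans (le_max_right _ _)).trans hbb₀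
    rw [div_le_iff₀ (by positivity)] at h1; linarith
  set p := ⌊c₀ * b⌋₊ with hp
  have hp1 : 1 ≤ p := Nat.one_le_floor_iff _ |>.2 hb1
  have hpr : (1 : ℝ) ≤ p := by exact_mod_cast hp1
  have hple : (p : ℝ) ≤ c₀ * b := Nat.floor_le (by positivity)
  have hplt : c₀ * b < p + 1 := Nat.lt_floor_add_one _
  set θ : ℝ := 2 * p / b with hθ
  have hθb : θ * b = 2 * p := by rw [hθ]; field_simp
  have hθ_le : θ ≤ 2 * c₀ := by rw [hθ, div_le_iff₀ hbr]; linarith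
  have hθ_ge : c₀ ≤ θ := by rw [hθ, le_div_iff₀ hbr]; linarith
  by_cases hsel : ∀ L : Fin q → ℝ, (∀ i, 0 ≤ L i) → ∑ i, L i ≤ q → ∃ f ∈ Edg,
      HeredDense Edg c (ε * b) d (c ∘ f) ∧
        ∑ j, edgeWeight l r j * L (c (f j)) ≤ m * ((∑ i, L i) / q) + κ
  · left
    obtain ⟨P, hP, hPath, hnd, hlen⟩ := exists_path_tiling hk hr hq hb hNqb E hE Edg
      (fun f hf => (mem_filter.1 hf).2) c hc ε d κ θ m σ hε0 hσ0 hκ0.le hd0 hm p hp1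
      (by
        push_cast
        rw [hkl]
        have h1 : c₀ * (24 * m ^ 2) * b ≤ d * ε * b := by gcongr
        have h2 : 24 * m ^ 2 * p ≤ 24 * m ^ 2 * (c₀ * b) := by gcongr
        linarith)
      hθb
      (by
        have h1 : θ * m ^ 2 ≤ 2 * c₀ * m ^ 2 := by gcongr
        have h2 : c₀ * (4 * m) * m ≤ σ ^ 2 * m := by gcongr
        rw [hκ]
        linarith)
      hsel
      (by
        calc (l : ℝ) * q ≤ l * Q := by gcongr
          _ ≤ ε * b * (c₀ * m) := hb3
          _ ≤ ε * b * (θ * m) := by gcongr)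
    refine ⟨P, ?_, hPath, hnd, hlen.trans ?_⟩
    · have h1 : (P.length : ℝ) ≤ s := by
        refine (hP.trans ?_).trans hs
        gcongr
      exact_mod_cast h1
    · gcongr
      have h1 : θ * m ≤ 2 * c₀ * m := by gcongr
      have h2 : 2 * m * σ = α / 4 := by rw [hσ]; field_simp; norm_num
      have h3 : 4 * m * ε = α / 4 := by rw [hε]; field_simp; norm_num
      linarith
  · right
    push Not at hsel
    obtain ⟨L, hL0, hLq, hLgood⟩ := hsel
    set Good := Edg.filter fun f => HeredDense Edg c (ε * b) d (c ∘ f) with hGood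
    have hbadc : ((Edg \ Good).card : ℝ) ≤ β₀ * (N : ℝ) ^ k := by
      have h1 := hbad (Edg \ Good) sdiff_subset fun f hf hfd => by
        rw [mem_sdiff] at hf
        exact hf.2 (mem_filter.2 ⟨hf.1, hfd⟩)
      rwa [hd, add_halves] at h1
    set h := ⌈lam * N⌉₊ with hh
    have hlamN : 1 ≤ lam * N := by
      have h1 : 1 / lam ≤ N := ((le_max_right _ _).trans hN₀).trans hNN₀
      rw [div_le_iff₀ hlam0] at h1; linarith
    have hhle : (h : ℝ) ≤ 2 * (lam * N) := by
      have := Nat.ceil_lt_add_one (by positivity : 0 ≤ lam * N)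
      linarith
    have hsumL : ∑ v, L (c v) = (∑ i, L i) / q * N := by
      have h1 : ∑ v, L (c v) = ∑ i, (b : ℝ) * L i := by
        rw [← sum_fiberwise_of_maps_to (fun v _ => mem_univ (c v))]
        refine sum_congr rfl fun i _ => ?_
        rw [sum_congr rfl fun v hv => by rw [(mem_filter.1 hv).2], sum_const, hc, nsmul_eq_mul]
      rw [h1, ← mul_sum, hNqbr]
      field_simp
    obtain ⟨g, hg0, hgs, hgP, hgG⟩ := exists_weighting (N := N) (J := EdgeIndex l r)
      (j₀ := Sum.inl i₀) (j₁ := Sum.inr (Sum.inl i₀)) (by simp) (edgeWeight l r)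
      (fun j => (by norm_num : (0 : ℝ) ≤ 1 / 2).trans (half_le_edgeWeight j)) rfl rfl m hm0
      (by rw [sum_edgeWeight, hm]) Edg Good (2 * a - a ^ 2 - γ) γ κ lam h hNpos hlam0 hlam1
      (by nlinarith)
      (by
        rw [hcJ, mul_pow, ← mul_assoc]
        refine hbadc.trans ?_
        gcongr
        exact min_le_left _ _)
      (fun x hx => by simpa [hEdg] using hdeg x hx)
      (Nat.le_ceil _)
      (by
        rw [hcJ]
        have h1 : (k : ℝ) * h ≤ k * (2 * (lam * N)) := by gcongr
        have h2 : lam * (4 * k) * N ≤ 1 * N := by gcongr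
        linarith)
      (by
        rw [hcJ]
        have h1 : 2 * m * ((k : ℝ) * h) ≤ 2 * m * (k * (2 * (lam * N))) := by gcongr
        have h2 : lam * (4 * m * k) * N ≤ κ * N := by gcongr
        linarith)
      (fun v => L (c v)) (fun v => hL0 _) ((∑ i, L i) / q) hsumL
      (by rw [div_le_one hqr]; exact hLq)
      (fun f hf => hLgood f (mem_filter.1 hf).1 (mem_filter.1 hf).2)
    rw [← ha] at hgs
    have hheavy := card_heavy_le (V := Fin N) (by simpa using hNpos) a (2 * γ) ha0 ha4 (by linarith)
      (by linarith) g hg0 (by simpa using hgs) (by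
        rw [Fintype.card_fin]
        convert hgP using 2
        ring)
    rw [Fintype.card_fin] at hheavy
    refine ⟨univ.filter fun v => ¬ a ≤ g v, ?_, ?_⟩
    · have h1 := card_filter_add_card_filter_not (s := (univ : Finset (Fin N))) fun v => a ≤ g v
      rw [card_univ, Fintype.card_fin] at h1
      have h2 : ((univ.filter fun v => a ≤ g v).card : ℝ) +
        (univ.filter fun v => ¬ a ≤ g v).card = N := by exact_mod_cast h1
      linarith
    · refine le_trans ?_ (hbadc.trans (by gcongr; exact min_le_right _ _))
      refine Nat.cast_le.2 (card_le_card fun f hf => ?_)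
      rw [mem_filter] at hf
      rw [mem_sdiff]
      refine ⟨mem_filter.2 ⟨mem_univ _, hf.2.1⟩, fun hfG => ?_⟩
      obtain ⟨j, hj⟩ := hgG f hfG
      rw [← ha] at hj
      exact (mem_filter.1 (hf.2.2 j)).2 hj

theorem two_mul_degH_le {n k : ℕ} (hk : 2 ≤ k) (E : Finset (Finset (Fin n)))
    (hE : ∀ e ∈ E, e.card = k) (S : Finset (Fin n)) (hS : S.card = k - 2) :
    2 * degH E S ≤
      (univ.filter fun p : Fin n × Fin n => insert p.1 (insert p.2 S) ∈ E).card := by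
  rw [card_eq_sum_card_fiberwise (f := fun p : Fin n × Fin n => insert p.1 (insert p.2 S))
    (t := E.filter fun e => S ⊆ e), degH, mul_comm, ← smul_eq_mul]
  · refine card_nsmul_le_sum _ _ _ fun e he => ?_
    rw [mem_filter] at he
    have h1 : (e \ S).card = 2 := by
      rw [card_sdiff_of_subset he.2, hE e he.1, hS]; omega
    have h2 : (e \ S).offDiag.card = 2 := by rw [offDiag_card, h1]
    rw [← h2]
    refine card_le_card fun p hp => ?_
    rw [mem_offDiag] at hp
    have h3 : insert p.1 (insert p.2 S) = e := by
      have h4 : ({p.1, p.2} : Finset (Fin n)) = e \ S := by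
        refine eq_of_subset_of_card_le ?_ (by rw [h1, card_pair hp.2.2])
        simp [insert_subset_iff, hp.1, hp.2.1]
      calc insert p.1 (insert p.2 S) = {p.1, p.2} ∪ S := by simp
        _ = e := by rw [h4, sdiff_union_of_subset he.2]
    simp [h3, he.1]
  · intro p hp
    have hp' := (mem_filter.1 hp).2
    exact mem_coe.2 (mem_filter.2 ⟨hp', (subset_insert _ _).trans (subset_insert _ _)⟩)

theorem card_pairs_le_card_pairs_restrict {N n : ℕ} (φ : Fin N ↪ Fin n) (R : Fin n → Fin n → Prop)
    [∀ x y, Decidable (R x y)] :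
    (univ.filter fun p : Fin n × Fin n => R p.1 p.2).card ≤
      (univ.filter fun p : Fin N × Fin N => R (φ p.1) (φ p.2)).card + 2 * ((n - N) * n) := by
  classical
  set D : Finset (Fin n) := (univ.map φ)ᶜ with hD
  have hDc : D.card = n - N := by rw [hD, card_compl, card_map]; simp
  have h1 : (univ.filter fun p : Fin n × Fin n => R p.1 p.2) ⊆
      (univ.filter fun p : Fin N × Fin N => R (φ p.1) (φ p.2)).image (fun p => (φ p.1, φ p.2)) ∪
        (D ×ˢ univ ∪ univ ×ˢ D) := by
    rintro ⟨x, y⟩ hp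
    have hR := (mem_filter.1 hp).2
    by_cases hx : x ∈ D
    · simp [hx]
    by_cases hy : y ∈ D
    · simp [hy]
    rw [hD, mem_compl, not_not, mem_map] at hx hy
    obtain ⟨u, -, rfl⟩ := hx
    obtain ⟨v, -, rfl⟩ := hy
    refine mem_union_left _ (mem_image.2 ⟨(u, v), ?_, rfl⟩)
    simpa using hR
  refine (card_le_card h1).trans ((card_union_le _ _).trans (Nat.add_le_add card_image_le ?_))
  refine (card_union_le _ _).trans (le_of_eq ?_)
  rw [card_product, card_product, hDc, card_univ, Fintype.card_fin]
  ring

theorem image_update_update {V J : Type*} [DecidableEq V] [Fintype J] [DecidableEq J] {j₀ j₁ : J}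
    (hj : j₀ ≠ j₁) (x : J → V) (u v : V) :
    univ.image (Function.update (Function.update x j₀ u) j₁ v) =
      insert u (insert v ((univ.filter fun j => j ≠ j₀ ∧ j ≠ j₁).image x)) := by
  ext z
  simp only [mem_image, mem_univ, true_and, mem_insert, mem_filter]
  constructor
  · rintro ⟨j, rfl⟩
    by_cases h1 : j = j₁
    · subst h1; simp
    by_cases h0 : j = j₀
    · subst h0; simp [h1]
    exact Or.inr (Or.inr ⟨j, ⟨h0, h1⟩, by simp [h0, h1]⟩)
  · rintro (rfl | rfl | ⟨j, ⟨h0, h1⟩, rfl⟩)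
    · exact ⟨j₀, by simp [hj]⟩
    · exact ⟨j₁, by simp⟩
    · exact ⟨j, by simp [h0, h1]⟩

theorem IsPath.map {N n k l : ℕ} (φ : Fin N ↪ Fin n) {E' : Finset (Finset (Fin N))}
    {E : Finset (Finset (Fin n))} (hEE : ∀ e ∈ E', e.map φ ∈ E) {vs : List (Fin N)}
    (h : IsPath k l E' vs) : IsPath k l E (vs.map φ) := by
  obtain ⟨h1, h2, h3⟩ := h
  refine ⟨h1.map φ.injective, by rwa [List.length_map], fun i hi => ?_⟩
  rw [List.length_map] at hi
  have h4 := hEE _ (h3 i hi)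
  rw [← List.map_drop, ← List.map_take]
  convert h4 using 1
  ext v
  simp only [List.mem_toFinset, List.mem_map, Finset.mem_map]

/-- The degree condition passes to the induced hypergraph on most of the vertices. -/
theorem card_pairs_restrict_ge {N n k l r : ℕ} (hk : k = l + (l + r)) (hr : 0 < r) (i₀ : Fin l)
    (φ : Fin N ↪ Fin n) (E : Finset (Finset (Fin n))) (hE : ∀ e ∈ E, e.card = k) (D : ℝ)
    (hdeg : ∀ S : Finset (Fin n), S.card = k - 2 → D * (Nat.choose n 2) ≤ (degH E S : ℝ))
    (x : EdgeIndex l r → Fin N)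
    (hx : Set.InjOn x {j | j ≠ Sum.inl i₀ ∧ j ≠ Sum.inr (Sum.inl i₀)}) :
    D * (n * (n - 1)) - 2 * (((n - N : ℕ) : ℝ) * n) ≤
      ((univ.filter fun p : Fin N × Fin N => (univ.image (Function.update
        (Function.update x (Sum.inl i₀) p.1) (Sum.inr (Sum.inl i₀)) p.2)).map φ ∈ E).card : ℝ) := by
  have hl : 0 < l := i₀.pos
  set K : Finset (EdgeIndex l r) :=
    univ.filter fun j => j ≠ Sum.inl i₀ ∧ j ≠ Sum.inr (Sum.inl i₀) with hK
  have hKc : K.card = k - 2 := by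
    have h1 : K = univ \ {Sum.inl i₀, Sum.inr (Sum.inl i₀)} := by
      ext j; simp [hK]
    rw [h1, card_sdiff_of_subset (subset_univ _), card_pair (by simp), card_univ]
    simp [EdgeIndex, hk]
  have hS : ((K.image x).map φ).card = k - 2 := by
    rw [card_map, card_image_of_injOn, hKc]
    intro j hj j' hj' h
    exact hx (by simpa [hK] using hj) (by simpa [hK] using hj') h
  have h1 := hdeg _ hS
  have h2 := two_mul_degH_le (by omega) E hE _ hS
  have h3 := h2.trans (card_pairs_le_card_pairs_restrict φ
    (fun u v => insert u (insert v ((K.image x).map φ)) ∈ E))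
  have h4 : ∀ p : Fin N × Fin N, (univ.image (Function.update
      (Function.update x (Sum.inl i₀) p.1) (Sum.inr (Sum.inl i₀)) p.2)).map φ =
        insert (φ p.1) (insert (φ p.2) ((K.image x).map φ)) := fun p => by
    rw [image_update_update (by simp), map_insert, map_insert]
  simp only [h4]
  have h5 : (2 : ℝ) * degH E ((K.image x).map φ) ≤ ((univ.filter fun p : Fin N × Fin N =>
      insert (φ p.1) (insert (φ p.2) ((K.image x).map φ)) ∈ E).card : ℝ) +
        2 * (((n - N : ℕ) : ℝ) * n) := by exact_mod_cast h3
  rw [Nat.cast_choose_two] at h1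
  linarith

theorem pow_le_mul_choose {n k : ℕ} (h : 2 * k ≤ n) :
    (n : ℝ) ^ k ≤ 2 ^ k * (k.factorial : ℝ) * (n.choose k : ℝ) := by
  have h1 : n ^ k ≤ 2 ^ k * (n + 1 - k) ^ k := by
    rw [← mul_pow]; exact Nat.pow_le_pow_left (by omega) k
  have h2 := h1.trans (Nat.mul_le_mul_left _ (Nat.pow_sub_le_descFactorial n k))
  rw [Nat.descFactorial_eq_factorial_mul_choose, ← mul_assoc] at h2
  exact_mod_cast h2

/-- A large set spanning few edges makes the hypergraph extremal. -/
theorem exists_sparse_set_of_card {N n k : ℕ} {J : Type*} [Fintype J] [DecidableEq J]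
    (hJ : Fintype.card J = k) (φ : Fin N ↪ Fin n) (E : Finset (Finset (Fin n)))
    (hE : ∀ e ∈ E, e.card = k) (B₀ : Finset (Fin N)) (t : ℕ) (htn : t ≤ n) (hn : 0 < n) (η ρ : ℝ)
    (hη : 0 ≤ η) (hρ : 0 ≤ ρ)
    (hB : (t : ℝ) ≤ B₀.card + ρ * n)
    (hB₀ : ((univ.filter fun f : J → Fin N =>
      (univ.image f).map φ ∈ E ∧ ∀ j, f j ∈ B₀).card : ℝ) ≤ η * (N : ℝ) ^ k) :
    ∃ B : Finset (Fin n), B.card = t ∧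
      ((E.filter fun e => e ⊆ B).card : ℝ) ≤ (η + k * ρ) * (n : ℝ) ^ k := by
  classical
  have hNn : N ≤ n := by simpa using Fintype.card_le_of_embedding φ
  set B₁ := B₀.map φ with hB₁
  have hB₁c : B₁.card = B₀.card := card_map _
  have hn' : (0 : ℝ) < n := by exact_mod_cast hn
  obtain ⟨B, hBt, hBD⟩ : ∃ B : Finset (Fin n), B.card = t ∧ ((B \ B₁).card : ℝ) ≤ ρ * n := by
    rcases le_total t B₁.card with h | h
    · obtain ⟨B, hBB, hBt⟩ := exists_subset_card_eq h
      refine ⟨B, hBt, ?_⟩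
      rw [sdiff_eq_empty_iff_subset.2 hBB]
      simp only [card_empty, Nat.cast_zero]
      positivity
    · obtain ⟨B, hBB, -, hBt⟩ := exists_subsuperset_card_eq (subset_univ B₁) h (by simpa using htn)
      refine ⟨B, hBt, ?_⟩
      rw [cast_card_sdiff hBB, hBt, hB₁c]
      linarith
  refine ⟨B, hBt, ?_⟩
  have htup : ∀ e ∈ E, ∃ f : J → Fin n, univ.image f = e := by
    intro e he
    have h1 : Fintype.card J = Fintype.card e := by rw [hJ, Fintype.card_coe, hE e he]
    let eq := Fintype.equivOfCardEq h1
    refine ⟨fun j => (eq j : Fin n), ?_⟩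
    ext v
    simp only [mem_image, mem_univ, true_and]
    exact ⟨fun ⟨j, hj⟩ => hj ▸ (eq j).2, fun hv => ⟨eq.symm ⟨v, hv⟩, by simp⟩⟩
  set G₀ := univ.filter fun f : J → Fin N => (univ.image f).map φ ∈ E ∧ ∀ j, f j ∈ B₀ with hG₀
  set G₁ := univ.filter fun f : J → Fin n => ¬ ∀ j, f j ∈ (B \ B₁)ᶜ with hG₁
  have hsub : (E.filter fun e => e ⊆ B) ⊆
      G₀.image (fun f => (univ.image f).map φ) ∪ G₁.image (fun f => univ.image f) := by
    intro e he
    rw [mem_filter] at he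
    obtain ⟨f, hf⟩ := htup e he.1
    by_cases h : ∀ j, f j ∈ (B \ B₁)ᶜ
    · have h1 : ∀ j, ∃ v ∈ B₀, φ v = f j := by
        intro j
        have h2 := h j
        have h3 : f j ∈ B := he.2 (hf ▸ mem_image_of_mem f (mem_univ j))
        rw [mem_compl, mem_sdiff] at h2
        have h4 : f j ∈ B₁ := by tauto
        exact mem_map.1 h4
      choose g hg hgf using h1
      have h5 : (univ.image g).map φ = e := by
        rw [← hf, map_eq_image, image_image]
        exact congrArg (fun h => univ.image h) (funext hgf)
      exact mem_union_left _ (mem_image.2 ⟨g, mem_filter.2 ⟨mem_univ _, h5 ▸ he.1, hg⟩, h5⟩)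
    · exact mem_union_right _ (mem_image.2 ⟨f, mem_filter.2 ⟨mem_univ _, h⟩, hf⟩)
  have h1 : (E.filter fun e => e ⊆ B).card ≤ G₀.card + G₁.card :=
    (card_le_card hsub).trans ((card_union_le _ _).trans
      (Nat.add_le_add card_image_le card_image_le))
  have h2 : (G₁.card : ℝ) ≤ k * ρ * (n : ℝ) ^ k := by
    have h3 := card_tuples_leaving_mul_le (J := J) ((B \ B₁)ᶜ)
    rw [compl_compl, hJ] at h3
    have h4 : (G₁.card : ℝ) * n ≤ k * ((B \ B₁).card * (n : ℝ) ^ k) := by exact_mod_cast h3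
    refine le_of_mul_le_mul_right (h4.trans ?_) hn'
    calc (k : ℝ) * ((B \ B₁).card * (n : ℝ) ^ k) ≤ k * ((ρ * n) * (n : ℝ) ^ k) := by gcongr
      _ = _ := by ring
  have h5 : η * (N : ℝ) ^ k ≤ η * (n : ℝ) ^ k := by gcongr
  have h6 : ((E.filter fun e => e ⊆ B).card : ℝ) ≤ G₀.card + G₁.card := by exact_mod_cast h1
  rw [add_mul]
  linarith

/-- The numerical consequences of taking `N` the largest multiple of `M` below a large `n`. -/
theorem exists_nat_ge_of_mod_bounds (k M N₀ : ℕ) (α γ : ℝ) (hM : 0 < M) (hα : 0 < α)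
    (hγ : 0 < γ) : ∃ n₀ : ℕ, ∀ n, n₀ ≤ n → 0 < n ∧ 2 * k ≤ n ∧ N₀ ≤ M * (n / M) ∧
      (n : ℝ) ≤ 2 * (M * (n / M) : ℕ) ∧ (1 + 2 * M) * 4 ≤ γ * n ∧ (M : ℝ) ≤ α * n ∧
      (M : ℝ) ≤ γ * n ∧ ((n - M * (n / M) : ℕ) : ℝ) ≤ M := by
  refine ⟨1 + 2 * k + (M + N₀) + 2 * M + ⌈(1 + 2 * M) * 4 / γ⌉₊ + ⌈M / α⌉₊, fun n hn => ?_⟩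
  have h1 : n - M * (n / M) < M := by
    have := Nat.div_add_mod n M
    have := Nat.mod_lt n hM
    omega
  have h2 : (⌈(1 + 2 * M) * 4 / γ⌉₊ : ℝ) ≤ n := Nat.cast_le.2 (by omega)
  have h3 : (⌈M / α⌉₊ : ℝ) ≤ n := Nat.cast_le.2 (by omega)
  have h4 := (div_le_iff₀' hγ).1 ((Nat.le_ceil _).trans h2)
  have h5 := (div_le_iff₀' hα).1 ((Nat.le_ceil _).trans h3)
  refine ⟨by omega, by omega, by omega, by exact_mod_cast (by omega), h4, h5, ?_, ?_⟩
  · have : (0 : ℝ) ≤ M := by positivity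
    linarith
  · exact_mod_cast h1.le

theorem stmt10 (k l : ℕ) (hk : 3 ≤ k) (hl1 : 1 ≤ l) (hl2 : 2 * l < k) :
    ∃ C γ₀ : ℝ, 0 < C ∧ 0 < γ₀ ∧
      ∀ α γ : ℝ, 0 < α → 0 < γ → γ ≤ γ₀ →
        ∃ s : ℕ, ∃ n₀ : ℕ, ∀ n : ℕ, n₀ ≤ n →
          ∀ E : Finset (Finset (Fin n)), (∀ e ∈ E, e.card = k) →
            (∀ S : Finset (Fin n), S.card = k - 2 →
              ((4 * ((k : ℝ) - l) - 1) / (4 * ((k : ℝ) - l) ^ 2) - γ) *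
                  (Nat.choose n 2) ≤ (degH E S : ℝ)) →
            (∃ (j : ℕ) (T : Fin j → List (Fin n)), j ≤ s ∧
              (∀ i, IsPath k l E (T i)) ∧
              (∀ i i', i ≠ i' → Disjoint (T i).toFinset (T i').toFinset) ∧
              (((Finset.univ.filter fun v : Fin n => ∀ i, v ∉ T i).card : ℝ) ≤ α * n)) ∨
            IsExtremal k l (C * γ) E := by
  obtain ⟨r, hr, hkr⟩ : ∃ r, 0 < r ∧ k = l + (l + r) := ⟨k - 2 * l, by omega, by omega⟩
  have hkl : k - l = l + r := by omega
  set m : ℝ := ((l + r : ℕ) : ℝ) with hm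
  have hm2 : (2 : ℝ) ≤ m := by rw [hm]; exact_mod_cast (by omega)
  have hkm : (k : ℝ) - l = m := by rw [hm, hkr]; push_cast; ring
  set a : ℝ := 1 / (2 * m) with ha
  have ha0 : 0 < a := by rw [ha]; positivity
  have ha4 : a ≤ 1 / 4 := by
    rw [ha]; exact one_div_le_one_div_of_le (by norm_num) (by linarith)
  have hdens : (4 * m - 1) / (4 * m ^ 2) = 2 * a - a ^ 2 := by
    rw [ha]; field_simp; ring
  rw [hkm, hdens]
  refine ⟨2 ^ k * (k.factorial : ℝ) * (1 + k * (4 * (10 / a + 2) + 1)), a / 160, by positivity,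
    by positivity, fun α γ hα hγ hγa => ?_⟩
  obtain ⟨s, M, N₀, hM, hmain⟩ := exists_path_tiling_or_sparse_set hkr hr ⟨0, hl1⟩ m a (α / 2)
    (2 * γ) γ hm ha (by positivity) (by positivity) (by linarith) hγ
  obtain ⟨n₀, hn₀⟩ := exists_nat_ge_of_mod_bounds k M N₀ (α / 2) γ hM (by positivity) hγ
  refine ⟨s, n₀, fun n hn E hE hdeg => ?_⟩
  obtain ⟨hn1, hn2, hN₀, hnN, hMγ, hMα, hMγ', hnNM⟩ := hn₀ n hn
  have hNn : M * (n / M) ≤ n := Nat.mul_div_le n M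
  have hMN : M ∣ M * (n / M) := dvd_mul_right _ _
  generalize M * (n / M) = N at *
  have hNn' : (N : ℝ) ≤ n := by exact_mod_cast hNn
  have hN0 : (0 : ℝ) ≤ N := by positivity
  have hn' : (1 : ℝ) ≤ n := by exact_mod_cast hn1
  have hsub : ((n - N : ℕ) : ℝ) = n - N := by rw [Nat.cast_sub hNn]
  let φ : Fin N ↪ Fin n := Fin.castLEEmb hNn
  let E' : Finset (Finset (Fin N)) := univ.filter fun e => e.map φ ∈ E
  have hE' : ∀ e, e ∈ E' ↔ e.map φ ∈ E := fun e => by simp [E']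
  have hdeg' : ∀ x : EdgeIndex l r → Fin N,
      Set.InjOn x {j | j ≠ Sum.inl ⟨0, hl1⟩ ∧ j ≠ Sum.inr (Sum.inl ⟨0, hl1⟩)} →
      (2 * a - a ^ 2 - 2 * γ) * (N : ℝ) ^ 2 ≤ ((univ.filter fun p : Fin N × Fin N =>
        univ.image (Function.update (Function.update x (Sum.inl ⟨0, hl1⟩) p.1)
          (Sum.inr (Sum.inl ⟨0, hl1⟩)) p.2) ∈ E').card : ℝ) := by
    intro x hx
    simp only [hE']
    refine le_trans ?_ (card_pairs_restrict_ge hkr hr ⟨0, hl1⟩ φ E hE _ hdeg x hx)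
    have hD0 : 0 ≤ 2 * a - a ^ 2 - γ := by nlinarith
    have hD1 : 2 * a - a ^ 2 - γ ≤ 1 := by nlinarith
    have h1 : (N : ℝ) ^ 2 ≤ (n : ℝ) ^ 2 := by gcongr
    have h2 := mul_le_mul_of_nonneg_left h1 hD0
    have h3 := mul_le_mul_of_nonneg_right hD1 (by positivity : (0 : ℝ) ≤ n)
    have h4 := mul_le_mul_of_nonneg_right hnNM (by positivity : (0 : ℝ) ≤ n)
    have h5 := mul_le_mul_of_nonneg_right hMγ (by positivity : (0 : ℝ) ≤ n)
    have h6 : (n : ℝ) * n ≤ (2 * N) * (2 * N) := by gcongr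
    have h7 := mul_le_mul_of_nonneg_left h6 hγ.le
    linarith
  rcases hmain N hN₀ hMN E' (fun e he => by rw [← card_map φ]; exact hE _ ((hE' e).1 he)) hdeg' with
    ⟨P, hPs, hP, hPd, hPc⟩ | ⟨B, hBc, hB⟩
  · refine Or.inl ⟨P.length, fun i => (P.get i).map φ, hPs,
      fun i => (hP _ (P.get_mem i)).map φ fun e he => (hE' e).1 he, fun i i' hii' => ?_, ?_⟩
    · have h1 := List.pairwise_iff_get.1 (List.nodup_flatten.1 hPd).2
      have h2 : ∀ i i' : Fin P.length, i ≠ i' → List.Disjoint (P.get i) (P.get i') := by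
        intro i i' h
        rcases lt_or_gt_of_ne h with h | h
        · exact h1 i i' h
        · exact (h1 i' i h).symm
      rw [Finset.disjoint_left]
      intro v hv hv'
      rw [List.mem_toFinset, List.mem_map] at hv hv'
      obtain ⟨u, hu, rfl⟩ := hv
      obtain ⟨u', hu', h⟩ := hv'
      rw [φ.injective h] at hu'
      exact h2 i i' hii' hu hu'
    · have h1 : (univ.filter fun v : Fin n => ∀ i, v ∉ (P.get i).map φ) ⊆
          (P.flatten.toFinset.map φ)ᶜ := by
        intro v hv
        rw [mem_compl, Finset.mem_map]
        rintro ⟨u, hu, rfl⟩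
        obtain ⟨vs, hvs, huv⟩ := List.mem_flatten.1 (List.mem_toFinset.1 hu)
        obtain ⟨i, rfl⟩ := List.get_of_mem hvs
        exact (mem_filter.1 hv).2 i (List.mem_map_of_mem huv)
      have h2 := card_le_card h1
      have h3 := card_compl_add_card (P.flatten.toFinset.map φ)
      rw [card_map, List.toFinset_card_of_nodup hPd, Fintype.card_fin] at h3
      have h4 : ((univ.filter fun v : Fin n => ∀ i, v ∉ (P.get i).map φ).card : ℝ) +
          P.flatten.length ≤ n := by exact_mod_cast (by omega)
      have h5 : α / 2 * N ≤ α / 2 * n := by gcongr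
      linarith
  · right
    have hc : 0 < (10 / a + 2) * (4 * γ) := by positivity
    have hB' : (((univ.filter fun f : EdgeIndex l r → Fin N =>
        (univ.image f).map φ ∈ E ∧ ∀ j, f j ∈ B).card : ℕ) : ℝ) ≤ γ * (N : ℝ) ^ k := by
      simpa only [hE'] using hB
    have ht : (((2 * (k - l) - 1) * n / (2 * (k - l)) : ℕ) : ℝ) ≤ (1 - a) * n := by
      refine Nat.cast_div_le.trans (le_of_eq ?_)
      rw [hkl, Nat.cast_mul, Nat.cast_sub (by omega), Nat.cast_mul, ← hm, ha]
      push_cast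
      field_simp
    have hBt : (((2 * (k - l) - 1) * n / (2 * (k - l)) : ℕ) : ℝ) ≤
        B.card + ((10 / a + 2) * (4 * γ) + γ) * n := by
      have h2 : (10 / a + 2) * (4 * γ) * N ≤ (10 / a + 2) * (4 * γ) * n := by gcongr
      have h3 : a * N ≤ a * n := by gcongr
      have h4 : (1 - a - (10 / a + 2) * (2 * (2 * γ))) * (N : ℝ) =
        N - a * N - (10 / a + 2) * (4 * γ) * N := by ring
      rw [h4] at hBc
      rw [add_mul]
      linarith
    obtain ⟨B', hB't, hB'e⟩ := exists_sparse_set_of_card (J := EdgeIndex l r)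
      (by simp [EdgeIndex, hkr]) φ E hE B ((2 * (k - l) - 1) * n / (2 * (k - l)))
      (Nat.div_le_of_le_mul (Nat.mul_le_mul_right _ (Nat.sub_le _ _))) hn1 γ
      ((10 / a + 2) * (4 * γ) + γ) hγ.le (by positivity) hBt hB'
    refine ⟨B', hB't, hB'e.trans ?_⟩
    have h1 := pow_le_mul_choose hn2
    calc (γ + k * ((10 / a + 2) * (4 * γ) + γ)) * (n : ℝ) ^ k
        ≤ (γ + k * ((10 / a + 2) * (4 * γ) + γ)) *
          (2 ^ k * (k.factorial : ℝ) * (n.choose k : ℝ)) := by gcongr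
      _ = _ := by ring
end
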